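/- The bigraded Poincaré series of the mixed trace algebra of two generic 4×4 matrices satisfies P(T_{4,2}; s,t) = (1 + s²t² + s²t³ + s³t² + s³t³ + s⁵t⁵) / ((1−s)²(1−t)²·(1−s²)(1−st)²(1−t²)·(1−s³)(1−s²t)²(1−st²)²(1−t³)·(1−s³t)(1−s²t²)(1−st³)). -/

import Mathlib

open MvPolynomial Matrix

noncomputable section

/-- Index type for the entries of a pair of generic `n × n` matrices:
`Sum.inl (i,j)` indexes the `(i,j)` entry of `x`, `Sum.inr (i,j)` that of `y`. -/
abbrev MatVar (n : ℕ) := (Fin n × Fin n) ⊕ (Fin n × Fin n)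

/-- The substitution sending the variables to the entries of the pair `(A, B)`. -/
def pairSub {K : Type*} [CommSemiring K] {n : ℕ} (A B : Matrix (Fin n) (Fin n) K) :
    MatVar n → K
  | Sum.inl ij => A ij.1 ij.2
  | Sum.inr ij => B ij.1 ij.2

/-- A polynomial function on pairs of `n × n` matrices is `GLₙ`-invariant (for the action
by simultaneous conjugation). -/
def IsMatInvariant {K : Type*} [Field K] {n : ℕ} (f : MvPolynomial (MatVar n) K) : Prop :=
  ∀ (a : GL (Fin n) K) (A B : Matrix (Fin n) (Fin n) K),
    MvPolynomial.eval
        (pairSub ((a : Matrix (Fin n) (Fin n) K) * A * ((a⁻¹ : GL (Fin n) K) : Matrix (Fin n) (Fin n) K))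
          ((a : Matrix (Fin n) (Fin n) K) * B * ((a⁻¹ : GL (Fin n) K) : Matrix (Fin n) (Fin n) K))) f =
      MvPolynomial.eval (pairSub A B) f

/-- The weight giving the bidegree: entries of `x` have weight `(1,0)`,
those of `y` have weight `(0,1)`. -/
def bideg (n : ℕ) : MatVar n → ℕ × ℕ
  | Sum.inl _ => (1, 0)
  | Sum.inr _ => (0, 1)

/-- The bigraded component of bidegree `(p, q)` of the pure trace algebra `C_{n,2}`. -/
def pureComponent (K : Type*) [Field K] (n p q : ℕ) : Set (MvPolynomial (MatVar n) K) :=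
  {f | IsMatInvariant f ∧ f.IsWeightedHomogeneous (bideg n) (p, q)}

/-- `dim_K C_{n,2}^{(p,q)}`. -/
def pureDim (K : Type*) [Field K] (n p q : ℕ) : ℕ :=
  Set.finrank K (pureComponent K n p q)

/-- The bigraded Poincaré series `P(C_{n,2}; s, t)`, with `s` the variable `X 0` and
`t` the variable `X 1`. -/
def purePS2 (K : Type*) [Field K] (n : ℕ) : MvPowerSeries (Fin 2) ℚ :=
  fun d => (pureDim K n (d 0) (d 1) : ℚ)

/-- abbreviation for the power series variable `s`. -/
def ps : MvPowerSeries (Fin 2) ℚ := MvPowerSeries.X 0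

/-- abbreviation for the power series variable `t`. -/
def pt : MvPowerSeries (Fin 2) ℚ := MvPowerSeries.X 1


/-- A polynomial map `M_n² → M_n`, given by a matrix of polynomials in the entries of the
pair `(x, y)`, is `GLₙ`-equivariant. -/
def IsMatEquivariant {K : Type*} [Field K] {n : ℕ}
    (M : Matrix (Fin n) (Fin n) (MvPolynomial (MatVar n) K)) : Prop :=
  ∀ (a : GL (Fin n) K) (A B : Matrix (Fin n) (Fin n) K),
    M.map (MvPolynomial.eval
        (pairSub ((a : Matrix (Fin n) (Fin n) K) * A * ((a⁻¹ : GL (Fin n) K) : Matrix (Fin n) (Fin n) K))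
          ((a : Matrix (Fin n) (Fin n) K) * B * ((a⁻¹ : GL (Fin n) K) : Matrix (Fin n) (Fin n) K)))) =
      (a : Matrix (Fin n) (Fin n) K) * M.map (MvPolynomial.eval (pairSub A B)) *
        ((a⁻¹ : GL (Fin n) K) : Matrix (Fin n) (Fin n) K)

/-- The bigraded component of bidegree `(p, q)` of the mixed trace algebra `T_{n,2}`. -/
def mixedComponent (K : Type*) [Field K] (n p q : ℕ) :
    Set (Matrix (Fin n) (Fin n) (MvPolynomial (MatVar n) K)) :=
  {M | IsMatEquivariant M ∧ ∀ i j, (M i j).IsWeightedHomogeneous (bideg n) (p, q)}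

/-- `dim_K T_{n,2}^{(p,q)}`. -/
def mixedDim (K : Type*) [Field K] (n p q : ℕ) : ℕ :=
  Set.finrank K (mixedComponent K n p q)

/-- The bigraded Poincaré series `P(T_{n,2}; s, t)`, with `s` the variable `X 0` and
`t` the variable `X 1`. -/
def mixedPS2 (K : Type*) [Field K] (n : ℕ) : MvPowerSeries (Fin 2) ℚ :=
  fun d => (mixedDim K n (d 0) (d 1) : ℚ)


/-- Laurent polynomials in four variables. -/
abbrev LL := AddMonoidAlgebra ℚ (Fin 4 → ℤ)

def mono (μ : Fin 4 → ℤ) : LL := AddMonoidAlgebra.single μ 1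

lemma mono_mul (μ ν : Fin 4 → ℤ) : mono μ * mono ν = mono (μ + ν) := by
  simp [mono, AddMonoidAlgebra.single_mul_single]

lemma mono_zero : mono 0 = 1 := rfl

def ctL : LL →ₗ[ℚ] ℚ where
  toFun f := f.coeff 0
  map_add' f g := by simp
  map_smul' c f := by simp

lemma ctL_mono (μ : Fin 4 → ℤ) : ctL (mono μ) = if μ = 0 then 1 else 0 := by
  show (mono μ).coeff 0 = _
  simp [mono, Finsupp.single_apply]

lemma LL_ext {M : Type*} [AddCommMonoid M] [Module ℚ M] {f g : LL →ₗ[ℚ] M}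
    (h : ∀ μ, f (mono μ) = g (mono μ)) : f = g := by
  ext μ
  simpa [mono] using h μ

lemma LL_induction {p : LL → Prop} (f : LL) (h0 : p 0) (ha : ∀ f g, p f → p g → p (f + g))
    (hs : ∀ μ (c : ℚ), p (c • mono μ)) : p f := by
  induction f using AddMonoidAlgebra.induction_linear with
  | zero => exact h0
  | add f g hf hg => exact ha f g hf hg
  | single μ c => 
    have := hs μ c
    simpa [mono, AddMonoidAlgebra.smul_single] using this

def DLin (i : Fin 4) : LL →ₗ[ℚ] LL :=
  (Finsupp.lsum ℚ (fun μ : Fin 4 → ℤ => LinearMap.toSpanSingleton ℚ LL ((μ i : ℚ) • mono μ))) ∘ₗ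
    (AddMonoidAlgebra.coeffLinearEquiv ℚ).toLinearMap

lemma DLin_mono (i : Fin 4) (μ : Fin 4 → ℤ) : DLin i (mono μ) = (μ i : ℚ) • mono μ := by
  simp [DLin, mono]

lemma DLin_mul (i : Fin 4) (f g : LL) : DLin i (f * g) = f * DLin i g + DLin i f * g := by
  induction f using LL_induction with
  | h0 => simp
  | ha f f' hf hf' => simp only [add_mul, map_add, hf, hf']; ring
  | hs μ c =>
    induction g using LL_induction with
    | h0 => simp
    | ha f f' hf hf' => simp only [mul_add, map_add, hf, hf']; ring
    | hs ν d =>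
      simp only [smul_mul_assoc, mul_smul_comm, map_smul, mono_mul, DLin_mono, smul_smul, ← add_smul]
      congr 1
      simp only [Pi.add_apply]; push_cast; ring

def DD (i : Fin 4) : Derivation ℚ LL LL := Derivation.mk' (DLin i) (by
  intro a b; rw [DLin_mul]; simp only [smul_eq_mul]; ring)

lemma DD_mono (i : Fin 4) (μ : Fin 4 → ℤ) : DD i (mono μ) = (μ i : ℚ) • mono μ := DLin_mono i μ

lemma ctL_DD (i : Fin 4) (f : LL) : ctL (DD i f) = 0 := by
  have : ctL ∘ₗ (DD i : LL →ₗ[ℚ] LL) = 0 := by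
    apply LL_ext
    intro μ
    simp only [LinearMap.comp_apply, Derivation.coeFn_coe, DD_mono, map_smul, ctL_mono,
      LinearMap.zero_apply]
    split_ifs with h
    · simp [h]
    · simp
  exact congrArg (fun F => F f) this

def xx (i : Fin 4) : LL := mono (Pi.single i 1)
def yy (i : Fin 4) : LL := mono (-Pi.single i 1)

lemma xx_mul_yy (i : Fin 4) : xx i * yy i = 1 := by
  simp [xx, yy, mono_mul, mono_zero]

lemma DD_xx (i j : Fin 4) : DD i (xx j) = if i = j then xx j else 0 := by
  simp only [xx, DD_mono, Pi.single_apply]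
  split_ifs <;> simp

lemma DD_yy (i j : Fin 4) : DD i (yy j) = if i = j then - yy j else 0 := by
  simp only [yy, DD_mono, Pi.neg_apply, Pi.single_apply]
  split_ifs <;> simp

def delta : LL := (xx 0 - xx 1) * (xx 0 - xx 2) * (xx 0 - xx 3) * (xx 1 - xx 2) * (xx 1 - xx 3) *
  (xx 2 - xx 3)
def deltab : LL := (yy 0 - yy 1) * (yy 0 - yy 2) * (yy 0 - yy 3) * (yy 1 - yy 2) * (yy 1 - yy 3) *
  (yy 2 - yy 3)

lemma xx_pow (i : Fin 4) (k : ℕ) : xx i ^ k = mono (Pi.single i (k : ℤ)) := by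
  induction k with
  | zero => simp [mono_zero]
  | succ k ih => rw [pow_succ, ih, xx, mono_mul, ← Pi.single_add]; push_cast; rfl

lemma yy_pow (i : Fin 4) (k : ℕ) : yy i ^ k = mono (-Pi.single i (k : ℤ)) := by
  induction k with
  | zero => simp [mono_zero]
  | succ k ih => rw [pow_succ, ih, yy, mono_mul, ← neg_add, ← Pi.single_add]; push_cast; rfl

lemma mono_prod {ι : Type*} (s : Finset ι) (f : ι → Fin 4 → ℤ) :
    ∏ i ∈ s, mono (f i) = mono (∑ i ∈ s, f i) := by
  classical
  induction s using Finset.induction_on with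
  | empty => simp [mono_zero]
  | insert a s ha ih => rw [Finset.prod_insert ha, Finset.sum_insert ha, ih, mono_mul]

lemma delta_sum : delta = ∑ σ : Equiv.Perm (Fin 4), ((Equiv.Perm.sign σ : ℤ) : ℚ) •
    mono (fun i => ((σ⁻¹ i : Fin 4) : ℤ)) := by
  have h := Matrix.det_vandermonde (fun i => xx i)
  have h2 : delta = (Matrix.vandermonde (fun i => xx i)).det := by
    rw [h]; simp [Fin.prod_univ_succ, delta]
    ring
  rw [h2, Matrix.det_apply']
  refine Finset.sum_congr rfl fun σ _ => ?_
  have : ∏ i, Matrix.vandermonde (fun i => xx i) (σ i) i = mono (fun i => ((σ⁻¹ i : Fin 4) : ℤ)) := by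
    simp only [Matrix.vandermonde_apply, xx_pow, mono_prod]
    congr 1
    funext j
    simp only [Finset.sum_apply, Pi.single_apply]
    rw [Finset.sum_eq_single (σ⁻¹ j)]
    · simp
    · intro b _ hb
      rw [if_neg]; rintro rfl; simp at hb
    · simp
  rw [this, Algebra.smul_def]
  simp

/-- inversion on Laurent polynomials -/
def invL : LL →+* LL := AddMonoidAlgebra.mapDomainRingHom ℚ (negAddMonoidHom : (Fin 4 → ℤ) →+ _)

lemma invL_mono (μ) : invL (mono μ) = mono (-μ) := by
  simp [invL, mono]

lemma invL_smul (c : ℚ) (f : LL) : invL (c • f) = c • invL f := by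
  rw [Algebra.smul_def, map_mul, Algebra.smul_def]
  congr 1
  simp [invL]

lemma invL_xx (i) : invL (xx i) = yy i := by simp [xx, yy, invL_mono]

lemma invL_delta : invL delta = deltab := by
  simp [delta, deltab, invL_xx]

lemma deltab_sum : deltab = ∑ σ : Equiv.Perm (Fin 4), ((Equiv.Perm.sign σ : ℤ) : ℚ) •
    mono (fun i => -((σ⁻¹ i : Fin 4) : ℤ)) := by
  rw [← invL_delta, delta_sum, map_sum]
  refine Finset.sum_congr rfl fun σ _ => ?_
  rw [invL_smul, invL_mono]; rfl

lemma ctL_delta : ctL (delta * deltab) = 24 := by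
  rw [delta_sum, deltab_sum, Finset.sum_mul_sum, map_sum]
  simp only [map_sum, smul_mul_assoc, mul_smul_comm, map_smul, mono_mul, ctL_mono]
  have : ∀ σ τ : Equiv.Perm (Fin 4), (((fun i => ((σ⁻¹ i : Fin 4) : ℤ)) + (fun i => -((τ⁻¹ i : Fin 4) : ℤ))) = 0)
      ↔ σ = τ := by
    intro σ τ
    constructor
    · intro h
      have : σ⁻¹ = τ⁻¹ := by
        ext i
        have := congrFun h i
        simp only [Pi.add_apply, Pi.zero_apply] at this
        omega
      simpa using this
    · rintro rfl; funext i; simp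
  simp only [this]
  have h2 : ∀ σ : Equiv.Perm (Fin 4), ((Equiv.Perm.sign σ : ℤ) : ℚ) * ((Equiv.Perm.sign σ : ℤ) : ℚ) = 1 := by
    intro σ
    rcases Int.units_eq_one_or (Equiv.Perm.sign σ) with h | h <;> simp [h]
  simp [h2]
  simp [Fintype.card_perm]
  norm_num [Nat.factorial]

lemma lap_deltab : ∑ i, DD i (DD i deltab) = (14 : ℚ) • deltab := by
  rw [deltab_sum]
  simp only [map_sum, Derivation.map_smul, DD_mono, smul_smul]
  rw [Finset.sum_comm, Finset.smul_sum]
  refine Finset.sum_congr rfl fun σ _ => ?_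
  rw [← Finset.sum_smul, smul_smul]
  congr 1
  have : ∑ i : Fin 4, (((σ⁻¹ i : Fin 4) : ℕ) : ℚ) ^ 2 = 14 := by
    rw [Equiv.sum_comp σ⁻¹ (fun i : Fin 4 => ((i : ℕ) : ℚ) ^ 2)]
    simp [Fin.sum_univ_succ]; norm_num
  rw [← this, Finset.sum_mul]
  refine Finset.sum_congr rfl fun i _ => ?_
  push_cast; ring

lemma ctL_lap (f : LL) : ctL (deltab * ∑ i, DD i (DD i f)) = 14 * ctL (deltab * f) := by
  have h1 : ∀ i, ctL (deltab * DD i (DD i f)) = ctL (DD i (DD i deltab) * f) := by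
    intro i
    have e1 := ctL_DD i (deltab * DD i f)
    have e2 := ctL_DD i (DD i deltab * f)
    rw [Derivation.leibniz, map_add] at e1 e2
    simp only [smul_eq_mul] at e1 e2
    rw [mul_comm (DD i f)] at e1
    rw [mul_comm f] at e2
    linarith
  rw [Finset.mul_sum, map_sum]
  simp only [h1]
  rw [← map_sum, ← Finset.sum_mul, lap_deltab]
  simp

set_option maxHeartbeats 1000000 in
lemma lap_delta : ∑ i, DD i (DD i delta) = (14 : ℚ) • delta := by
  rw [delta_sum]
  simp only [map_sum, Derivation.map_smul, DD_mono, smul_smul]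
  rw [Finset.sum_comm, Finset.smul_sum]
  refine Finset.sum_congr rfl fun σ _ => ?_
  rw [← Finset.sum_smul, smul_smul]
  congr 1
  have : ∑ i : Fin 4, (((σ⁻¹ i : Fin 4) : ℕ) : ℚ) ^ 2 = 14 := by
    rw [Equiv.sum_comp σ⁻¹ (fun i : Fin 4 => ((i : ℕ) : ℚ) ^ 2)]
    simp [Fin.sum_univ_succ]; norm_num
  rw [← this, Finset.sum_mul]
  refine Finset.sum_congr rfl fun i _ => ?_
  push_cast; ring


set_option maxHeartbeats 2000000 in
lemma radial_part (χ : LL) (T : Fin 4 → Fin 4 → LL)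
    (h1 : ∀ i, T i i = DD i (DD i χ))
    (h2 : ∀ i j, i ≠ j → (xx i - xx j) * T i j = xx i * (DD i χ - DD j χ))
    (h3 : ∑ i, DD i χ = 0) :
    delta * ∑ i, ∑ j, T i j = (∑ i, DD i (DD i (delta * χ))) - (14 : ℚ) • (delta * χ) := by
  have e1 : ∀ i, DD i (DD i (delta * χ)) =
      delta * DD i (DD i χ) + 2 * DD i delta * DD i χ + DD i (DD i delta) * χ := by
    intro i
    simp only [Derivation.leibniz, smul_eq_mul, map_add]
    ring
  have e2 : (∑ i, DD i (DD i (delta * χ))) - (14 : ℚ) • (delta * χ)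
      = delta * ∑ i, DD i (DD i χ) + 2 * ∑ i, DD i delta * DD i χ := by
    simp only [e1, Finset.sum_add_distrib, ← Finset.sum_mul, lap_delta, ← Finset.mul_sum,
      smul_mul_assoc, mul_assoc]
    ring
  rw [e2]
  have d0 : DD 0 delta = xx 0 * ((xx 0 - xx 2) * (xx 0 - xx 3) + (xx 0 - xx 1) * (xx 0 - xx 3) +
     (xx 0 - xx 1) * (xx 0 - xx 2)) * ((xx 1 - xx 2) * (xx 1 - xx 3) * (xx 2 - xx 3)) := by
    simp [delta, Derivation.leibniz, DD_xx]; ring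
  have d1 : DD 1 delta = xx 1 * (-((xx 1 - xx 2) * (xx 1 - xx 3)) + (xx 0 - xx 1) * (xx 1 - xx 3) +
     (xx 0 - xx 1) * (xx 1 - xx 2)) * ((xx 0 - xx 2) * (xx 0 - xx 3) * (xx 2 - xx 3)) := by
    simp [delta, Derivation.leibniz, DD_xx]; ring
  have d2 : DD 2 delta = xx 2 * (-((xx 1 - xx 2) * (xx 2 - xx 3)) - (xx 0 - xx 2) * (xx 2 - xx 3) +
     (xx 0 - xx 2) * (xx 1 - xx 2)) * ((xx 0 - xx 1) * (xx 0 - xx 3) * (xx 1 - xx 3)) := by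
    simp [delta, Derivation.leibniz, DD_xx]; ring
  have d3 : DD 3 delta = xx 3 * (-((xx 1 - xx 3) * (xx 2 - xx 3)) - (xx 0 - xx 3) * (xx 2 - xx 3) -
     (xx 0 - xx 3) * (xx 1 - xx 3)) * ((xx 0 - xx 1) * (xx 0 - xx 2) * (xx 1 - xx 2)) := by
    simp [delta, Derivation.leibniz, DD_xx]; ring
  simp only [Fin.sum_univ_four, d0, d1, d2, d3, h1] at *
  have p01 := h2 0 1 (by decide)
  have p10 := h2 1 0 (by decide)
  have p02 := h2 0 2 (by decide)
  have p20 := h2 2 0 (by decide)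
  have p03 := h2 0 3 (by decide)
  have p30 := h2 3 0 (by decide)
  have p12 := h2 1 2 (by decide)
  have p21 := h2 2 1 (by decide)
  have p13 := h2 1 3 (by decide)
  have p31 := h2 3 1 (by decide)
  have p23 := h2 2 3 (by decide)
  have p32 := h2 3 2 (by decide)
  generalize DD 0 χ = a0 at *
  generalize DD 1 χ = a1 at *
  generalize DD 2 χ = a2 at *
  generalize DD 3 χ = a3 at *
  have : a3 = - a0 - a1 - a2 := by linear_combination h3
  subst this
  simp only [delta]
  generalize xx 0 = x0 at *
  generalize xx 1 = x1 at *
  generalize xx 2 = x2 at *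
  generalize xx 3 = x3 at *
  linear_combination ((x0 - x2) * (x0 - x3) * (x1 - x2) * (x1 - x3) * (x2 - x3)) * (p01 - p10)
    + ((x0 - x1) * (x0 - x3) * (x1 - x2) * (x1 - x3) * (x2 - x3)) * (p02 - p20)
    + ((x0 - x1) * (x0 - x2) * (x1 - x2) * (x1 - x3) * (x2 - x3)) * (p03 - p30)
    + ((x0 - x1) * (x0 - x2) * (x0 - x3) * (x1 - x3) * (x2 - x3)) * (p12 - p21)
    + ((x0 - x1) * (x0 - x2) * (x0 - x3) * (x1 - x2) * (x2 - x3)) * (p13 - p31)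
    + ((x0 - x1) * (x0 - x2) * (x0 - x3) * (x1 - x2) * (x1 - x3)) * (p23 - p32)

lemma ct_radial (χ : LL) (T : Fin 4 → Fin 4 → LL)
    (h1 : ∀ i, T i i = DD i (DD i χ))
    (h2 : ∀ i j, i ≠ j → (xx i - xx j) * T i j = xx i * (DD i χ - DD j χ))
    (h3 : ∑ i, DD i χ = 0) :
    ctL (delta * deltab * ∑ i, ∑ j, T i j) = 0 := by
  rw [mul_comm delta, mul_assoc, radial_part χ T h1 h2 h3, mul_sub, map_sub, ctL_lap,
    mul_smul_comm, map_smul, smul_eq_mul, sub_self]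

section weyl
variable {B : Type*} [Fintype B] [DecidableEq B] (wt : B → Fin 4 → ℤ)

/-- weighted trace -/
def wtr (A : Matrix B B ℚ) : LL := ∑ b, A b b • mono (wt b)

lemma wtr_sub (A A' : Matrix B B ℚ) : wtr wt (A - A') = wtr wt A - wtr wt A' := by
  simp [wtr, sub_smul]

lemma wtr_cyc (X Y : Matrix B B ℚ) (α : Fin 4 → ℤ)
    (hX : ∀ b c, X b c ≠ 0 → wt b = wt c + α) :
    wtr wt (X * Y) = mono α * wtr wt (Y * X) := by
  simp only [wtr, Matrix.mul_apply, Finset.mul_sum, Finset.sum_smul]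
  rw [Finset.sum_comm]
  refine Finset.sum_congr rfl fun c _ => Finset.sum_congr rfl fun b _ => ?_
  by_cases h : X b c = 0
  · simp [h]
  · rw [hX b c h, mul_smul_comm, mono_mul, mul_comm, add_comm]

lemma wtr_H (A : Matrix B B ℚ) (i : Fin 4) :
    wtr wt (A * Matrix.diagonal (fun b => (wt b i : ℚ))) = DD i (wtr wt A) := by
  simp only [wtr, Matrix.mul_diagonal, map_sum, Derivation.map_smul, DD_mono, smul_smul]

end weyl

section weyl
variable {B : Type*} [Fintype B] [DecidableEq B] (wt : B → Fin 4 → ℤ)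
theorem weyl_abstract (E : Fin 4 → Fin 4 → Matrix B B ℚ) (N : B → ℚ) (hN : ∀ b, 0 < N b)
    (hadj : ∀ i j b c, N b * E i j b c = N c * E j i c b)
    (hcomm : ∀ i j k l, E i j * E k l - E k l * E i j =
      (if j = k then E i l else 0) - (if l = i then E k j else 0))
    (hH : ∀ i, E i i = Matrix.diagonal (fun b => (wt b i : ℚ)))
    (hsum : ∀ b, ∑ i, wt b i = 0) :
    ∃ P A : Matrix B B ℚ, P * P = P ∧ (∀ i j, E i j * P = 0) ∧
      P = 1 - A * ∑ i, ∑ j, E i j * E j i ∧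
      24 * P.trace = ctL (delta * deltab * ∑ b, mono (wt b)) := by
  classical
  set C : Matrix B B ℚ := ∑ i, ∑ j, E i j * E j i with hC
  -- form
  let q : (B → ℚ) → (B → ℚ) → ℚ := fun v w => ∑ b, N b * v b * w b
  have qE : ∀ i j v w, q v (E i j *ᵥ w) = q (E j i *ᵥ v) w := by
    intro i j v w
    simp only [q, Matrix.mulVec, dotProduct, Finset.mul_sum, Finset.sum_mul]
    rw [Finset.sum_comm]
    refine Finset.sum_congr rfl fun c _ => Finset.sum_congr rfl fun b _ => ?_
    have := hadj i j b c
    linear_combination (v b * w c) * this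
  have qadd : ∀ v (s : Fin 4 → (B → ℚ)), q v (∑ i, s i) = ∑ i, q v (s i) := by
    intro v s
    simp only [q, Finset.sum_apply, Finset.mul_sum]
    rw [Finset.sum_comm]
  have qnn : ∀ v, 0 ≤ q v v := by
    intro v
    refine Finset.sum_nonneg fun b _ => ?_
    rw [mul_assoc]
    exact mul_nonneg (hN b).le (mul_self_nonneg _)
  have qz : ∀ v, q v v = 0 → v = 0 := by
    intro v h
    have h' := (Finset.sum_eq_zero_iff_of_nonneg (fun b _ => by
      rw [mul_assoc]
      exact mul_nonneg (hN b).le (mul_self_nonneg _))).1 h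
    funext b
    have := h' b (Finset.mem_univ b)
    rw [mul_assoc] at this
    rcases mul_eq_zero.1 this with h | h
    · exact absurd h (hN b).ne'
    · simpa using h
  have Cv : ∀ v, C *ᵥ v = ∑ i, ∑ j, E i j *ᵥ (E j i *ᵥ v) := by
    intro v
    simp only [hC, Matrix.sum_mulVec, Matrix.mulVec_mulVec]
  have qC : ∀ v w, q v (C *ᵥ w) = ∑ i, ∑ j, q (E j i *ᵥ v) (E j i *ᵥ w) := by
    intro v w
    simp only [Cv, qadd, qE]
  have qsymm : ∀ v w, q v w = q w v := by
    intro v w; refine Finset.sum_congr rfl fun b _ => ?_; ring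
  have kerC : ∀ v, C *ᵥ v = 0 → ∀ i j, E i j *ᵥ v = 0 := by
    intro v hv i j
    have h0 : q v (C *ᵥ v) = 0 := by rw [hv]; simp [q]
    rw [qC] at h0
    have h1 := (Finset.sum_eq_zero_iff_of_nonneg (fun i _ =>
      Finset.sum_nonneg (fun j _ => qnn _))).1 h0 j (Finset.mem_univ _)
    have h2 := (Finset.sum_eq_zero_iff_of_nonneg (fun j _ => qnn _)).1 h1 i (Finset.mem_univ _)
    exact qz _ h2
  have kerC2 : ∀ v, C *ᵥ (C *ᵥ v) = 0 → C *ᵥ v = 0 := by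
    intro v hv
    apply qz
    rw [qC]
    have := kerC _ hv
    refine Finset.sum_eq_zero fun i _ => Finset.sum_eq_zero fun j _ => ?_
    rw [this]; simp [q]
  have kerCM : ∀ X : Matrix B B ℚ, C * (C * X) = 0 → C * X = 0 := by
    intro X hX
    have : ∀ c, (C * X).col c = 0 := by
      intro c
      have e : ∀ Y : Matrix B B ℚ, (C * Y).col c = C *ᵥ (Y.col c) := by
        intro Y; ext b; rfl
      rw [e]
      apply kerC2
      rw [← e, ← e, hX]; rfl
    ext b c
    exact congrFun (this c) b
  -- annihilating polynomial
  obtain ⟨g, k, hg0, hgk⟩ : ∃ (g : Polynomial ℚ) (k : ℕ), g.coeff 0 ≠ 0 ∧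
      Polynomial.aeval C (Polynomial.X ^ k * g) = 0 := by
    have hne : C.charpoly ≠ 0 := (Matrix.charpoly_monic C).ne_zero
    obtain ⟨g, hg, hg'⟩ := Polynomial.exists_eq_pow_rootMultiplicity_mul_and_not_dvd C.charpoly hne 0
    rw [Polynomial.C_0, sub_zero] at hg hg'
    refine ⟨g, Polynomial.rootMultiplicity 0 C.charpoly, ?_, ?_⟩
    · rwa [Polynomial.X_dvd_iff] at hg'
    · rw [← hg]; exact Matrix.aeval_self_charpoly C
  have hCg : C * Polynomial.aeval C g = 0 := by
    have : ∀ k : ℕ, C ^ k * Polynomial.aeval C g = 0 → C * Polynomial.aeval C g = 0 := by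
      intro k
      induction k with
      | zero => intro h; rw [pow_zero, one_mul] at h; rw [h, mul_zero]
      | succ k ih =>
        intro h
        cases k with
        | zero => simpa using h
        | succ k =>
          apply ih
          rw [pow_succ', pow_succ', mul_assoc, mul_assoc] at h
          rw [pow_succ', mul_assoc]
          exact kerCM _ h
    apply this k
    rw [map_mul, map_pow, Polynomial.aeval_X] at hgk
    exact hgk
  have hcommC : ∀ k l, Commute C (E k l) := by
    intro k l
    have c1 : ∀ i j, E i j * E j i * E k l - E k l * (E i j * E j i) =
        (if i = k then E i j * E j l else 0) - (if l = j then E i j * E k i else 0)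
        + (if j = k then E i l * E j i else 0) - (if l = i then E k j * E j i else 0) := by
      intro i j
      have a1 := congrArg (fun Z => E i j * Z) (hcomm j i k l)
      have a2 := congrArg (fun Z => Z * E j i) (hcomm i j k l)
      simp only [mul_sub, sub_mul, mul_ite, ite_mul, mul_zero, zero_mul] at a1 a2
      rw [show E i j * E j i * E k l - E k l * (E i j * E j i) =
        (E i j * (E j i * E k l) - E i j * (E k l * E j i)) +
        (E i j * E k l * E j i - E k l * E i j * E j i) by noncomm_ring, a1, a2]
      abel
    have c2 : C * E k l - E k l * C = 0 := by
      simp only [hC, Finset.sum_mul, Finset.mul_sum, ← Finset.sum_sub_distrib, c1]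
      simp only [Finset.sum_sub_distrib, Finset.sum_add_distrib, Finset.sum_ite_eq,
        Finset.sum_ite_eq', Finset.mem_univ, if_true]
      have z : ∀ (p : Fin 4 → Prop) [DecidablePred p] (f : Fin 4 → Fin 4 → Matrix B B ℚ),
        ∑ i, ∑ j, (if p i then f i j else 0) = ∑ i, if p i then ∑ j, f i j else 0 := by
        intro p _ f
        refine Finset.sum_congr rfl fun i _ => ?_
        split_ifs <;> simp
      rw [z (fun i => i = k), z (fun i => l = i)]
      simp only [Finset.sum_ite_eq, Finset.sum_ite_eq', Finset.mem_univ, if_true]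
      abel
    exact sub_eq_zero.1 c2
  obtain ⟨h, hh⟩ : ∃ h : Polynomial ℚ, Polynomial.C (g.coeff 0)⁻¹ * g = 1 - h * Polynomial.X := by
    have : Polynomial.X ∣ 1 - Polynomial.C (g.coeff 0)⁻¹ * g := by
      rw [Polynomial.X_dvd_iff]
      simp [hg0]
    obtain ⟨h, hh⟩ := this
    refine ⟨h, ?_⟩
    rw [mul_comm h, ← hh]; ring
  refine ⟨Polynomial.aeval C (Polynomial.C (g.coeff 0)⁻¹ * g), Polynomial.aeval C h, ?_⟩
  set P := Polynomial.aeval C (Polynomial.C (g.coeff 0)⁻¹ * g) with hP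
  set A := Polynomial.aeval C h with hA
  have P1 : P = 1 - A * C := by
    rw [hP, hh]; simp [hA]
  have CP : C * P = 0 := by
    rw [hP, map_mul, Polynomial.aeval_C, Algebra.algebraMap_eq_smul_one, smul_mul_assoc, one_mul,
      mul_smul_comm, hCg, smul_zero]
  have EP : ∀ i j, E i j * P = 0 := by
    intro i j
    ext b c
    have e : C *ᵥ (P.col c) = 0 := by
      have : C *ᵥ (P.col c) = (C * P).col c := by ext b; rfl
      rw [this, CP]; rfl
    exact congrFun (kerC _ e i j) b
  have AE : ∀ i j, Commute A (E i j) := by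
    intro i j
    have : A ∈ Subalgebra.centralizer ℚ {E i j} := by
      have hc : C ∈ Subalgebra.centralizer ℚ {E i j} := by
        rw [Subalgebra.mem_centralizer_iff]
        rintro _ rfl
        exact (hcommC i j).eq.symm
      exact Algebra.adjoin_le (Set.singleton_subset_iff.2 hc) (Polynomial.aeval_mem_adjoin_singleton ℚ C)
    rw [Subalgebra.mem_centralizer_iff] at this
    exact (this _ rfl).symm
  refine ⟨?_, EP, P1, ?_⟩
  · nth_rw 1 [P1]
    rw [sub_mul, mul_assoc, CP, mul_zero, one_mul, sub_zero]
  have wz : ∀ b c, P b c ≠ 0 → wt b = 0 := by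
    intro b c h
    funext i
    have := congrFun (congrFun (EP i i) b) c
    rw [hH, Matrix.diagonal_mul] at this
    simp only [Matrix.zero_apply, mul_eq_zero, h, or_false] at this
    exact_mod_cast this
  have shift : ∀ i j b c, E i j b c ≠ 0 → wt b = wt c + (Pi.single i 1 - Pi.single j 1) := by
    intro i j b c h
    funext k
    have := congrFun (congrFun (hcomm k k i j) b) c
    rw [hH k] at this
    simp only [Matrix.sub_apply, Matrix.diagonal_mul, Matrix.mul_diagonal] at this
    have e : (wt b k : ℚ) - wt c k = (if k = i then 1 else 0) - (if k = j then 1 else 0) := by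
      apply mul_right_cancel₀ h
      rw [sub_mul, mul_comm (wt c k : ℚ), this]
      by_cases hi : k = i <;> by_cases hj : k = j
      · subst hi; subst hj; simp
      · subst hi; simp [hj, Ne.symm hj]
      · subst hj; simp [hi]
      · simp [hi, hj, Ne.symm hj]
    have e' : wt b k - wt c k = (if k = i then 1 else 0) - (if k = j then 1 else 0) := by
      have : ((wt b k - wt c k : ℤ) : ℚ) = (((if k = i then 1 else 0) - (if k = j then 1 else 0) : ℤ) : ℚ) := by
        push_cast; exact e
      exact_mod_cast this
    simp only [Pi.add_apply, Pi.sub_apply, Pi.single_apply]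
    linarith
  have hT := ct_radial (wtr wt A) (fun i j => wtr wt (A * (E i j * E j i)))
    (by
      intro i
      rw [← mul_assoc, hH, wtr_H, wtr_H])
    (by
      intro i j hij
      have k1 : A * (E i j * E j i) = E i j * (A * E j i) := by
        rw [← mul_assoc, (AE i j).eq, mul_assoc]
      have k2 : A * E j i * E i j = A * (E i j * E j i) - (A * E i i - A * E j j) := by
        have := hcomm i j j i
        simp only [if_true] at this
        rw [← mul_sub, ← this]; noncomm_ring
      have k3 := wtr_cyc wt (E i j) (A * E j i) _ (shift i j)
      rw [← k1, k2, wtr_sub, wtr_sub, hH, hH, wtr_H, wtr_H] at k3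
      have k4 : xx j * mono (Pi.single i 1 - Pi.single j 1) = xx i := by
        simp [xx, mono_mul]
      linear_combination (-xx j) * k3 - (wtr wt (A * (E i j * E j i)) -
        ((DD i) (wtr wt A) - (DD j) (wtr wt A))) * k4)
    (by
      simp only [← wtr_H]
      simp only [wtr, Matrix.mul_diagonal]
      rw [Finset.sum_comm]
      refine Finset.sum_eq_zero fun b _ => ?_
      rw [← Finset.sum_smul, ← Finset.mul_sum]
      have := hsum b
      have : ∑ i, (wt b i : ℚ) = 0 := by exact_mod_cast this
      rw [this]; simp)
  have hsumT : wtr wt (A * C) = ∑ i, ∑ j, wtr wt (A * (E i j * E j i)) := by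
    have lin : ∀ f : Fin 4 → Matrix B B ℚ, wtr wt (∑ i, f i) = ∑ i, wtr wt (f i) := by
      intro f
      simp only [wtr, Matrix.sum_apply, Finset.sum_smul]
      rw [Finset.sum_comm]
    simp only [hC, Finset.mul_sum, lin]
  rw [← hsumT] at hT
  have h1 : ∑ b, mono (wt b) = wtr wt P + wtr wt (A * C) := by
    rw [P1, wtr_sub]
    simp [wtr]
  have hP' : wtr wt P = P.trace • (1 : LL) := by
    simp only [wtr, Matrix.trace, Matrix.diag, Finset.sum_smul]
    refine Finset.sum_congr rfl fun b _ => ?_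
    by_cases h : P b b = 0
    · simp [h]
    · rw [wz b b h, mono_zero]
  rw [h1, mul_add, map_add, hT, add_zero, hP', mul_smul_comm, mul_one, map_smul, ctL_delta,
    smul_eq_mul, mul_comm]
end weyl

section lie
variable (R : Type*) [CommRing R]

abbrev MP := MvPolynomial (MatVar 4) R
abbrev MM := Matrix (Fin 4) (Fin 4) (MP R)

/-- the two copies -/
def vr (e : Bool) (i j : Fin 4) : MatVar 4 := if e then Sum.inl (i, j) else Sum.inr (i, j)

def Dl (i j : Fin 4) : Derivation R (MP R) (MP R) :=
  ∑ e : Bool, ((∑ k, (X (vr e k i) : MP R) • pderiv (vr e k j)) -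
    ∑ l, (X (vr e j l) : MP R) • pderiv (vr e i l))

lemma vr_inj (e e' : Bool) (i j i' j' : Fin 4) : vr e i j = vr e' i' j' ↔ e = e' ∧ i = i' ∧ j = j' := by
  cases e <;> cases e' <;> simp [vr]

lemma vr_surj (v : MatVar 4) : ∃ e i j, v = vr e i j := by
  rcases v with ⟨i, j⟩ | ⟨i, j⟩
  · exact ⟨true, i, j, rfl⟩
  · exact ⟨false, i, j, rfl⟩

lemma der_sum {ι : Type*} (s : Finset ι) (D : ι → Derivation R (MP R) (MP R)) (f : MP R) :
    (∑ i ∈ s, D i) f = ∑ i ∈ s, D i f := by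
  classical
  induction s using Finset.induction_on with
  | empty => simp
  | insert a s ha ih => rw [Finset.sum_insert ha, Finset.sum_insert ha, Derivation.add_apply, ih]

lemma Dl_apply (i j : Fin 4) (f : MP R) : Dl R i j f =
  ∑ e : Bool, ((∑ k, X (vr e k i) * pderiv (vr e k j) f) -
    ∑ l, X (vr e j l) * pderiv (vr e i l) f) := by
  simp only [Dl, der_sum, Derivation.sub_apply, Derivation.smul_apply, smul_eq_mul]

lemma Dl_X (i j k l : Fin 4) (e : Bool) : Dl R i j (X (vr e k l)) =
    (if j = l then X (vr e k i) else 0) - (if k = i then X (vr e j l) else 0) := by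
  simp only [Dl_apply, pderiv_X, Pi.single_apply, vr_inj]
  rw [Finset.sum_eq_single e]
  · simp only [true_and, mul_ite, mul_one, mul_zero]
    congr 1
    · rw [Finset.sum_eq_single k]
      · simp [eq_comm]
      · intro b _ hb; simp [Ne.symm hb]
      · simp
    · rw [Finset.sum_eq_single l]
      · simp 
      · intro b _ hb; simp [Ne.symm hb]
      · simp
  · intro e' _ he
    simp [Ne.symm he]
  · simp

lemma Dl_comm (i j k l : Fin 4) (f : MP R) : Dl R i j (Dl R k l f) - Dl R k l (Dl R i j f) =
    (if j = k then Dl R i l f else 0) - (if l = i then Dl R k j f else 0) := by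
  have : ⁅Dl R i j, Dl R k l⁆ = (if j = k then Dl R i l else 0) - (if l = i then Dl R k j else 0) := by
    apply MvPolynomial.derivation_ext
    intro v
    obtain ⟨e, a, b, rfl⟩ := vr_surj v
    rw [Derivation.commutator_apply]
    have t : ∀ (p : Prop) [Decidable p] (D : Derivation R (MP R) (MP R)) (g : MP R),
        (if p then D else 0) g = if p then D g else 0 := by
      intro p _ D g; split_ifs <;> simp
    have t' : ∀ (p : Prop) [Decidable p] (D : Derivation R (MP R) (MP R)) (g : MP R),
        D (if p then g else 0) = if p then D g else 0 := by
      intro p _ D g; split_ifs <;> simp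
    have t'' : ∀ (p : Prop) [Decidable p] (g : MP R),
        (if p then g else 0) = (if p then 1 else 0) * g := by
      intro p _ g; simp
    simp only [Derivation.coe_sub, Pi.sub_apply, t, Dl_X, map_sub, t']
    simp only [t'' _ (X _), t'' _ (_ - _)]
    ring
  have h := congrArg (fun D => D f) this
  rw [Derivation.commutator_apply] at h
  rw [h]
  simp only [Derivation.coe_sub, Pi.sub_apply]
  split_ifs <;> simp
end lie

section lie
variable (R : Type*) [CommRing R]

abbrev eu (i j : Fin 4) : MM R := Matrix.single i j 1

def Ll (i j : Fin 4) (M : MM R) : MM R := M.map (Dl R i j) + (eu R i j * M - M * eu R i j)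

lemma Dl_mul_const (i j k l : Fin 4) (M : MM R) :
    (M * eu R k l).map (Dl R i j) = M.map (Dl R i j) * eu R k l := by
  ext a b : 2
  by_cases h : l = b
  · subst h; simp
  · simp [Matrix.mul_single_apply_of_ne, Ne.symm h]

lemma Dl_const_mul (i j k l : Fin 4) (M : MM R) :
    (eu R k l * M).map (Dl R i j) = eu R k l * M.map (Dl R i j) := by
  ext a b : 2
  by_cases h : k = a
  · subst h; simp
  · simp [Matrix.single_mul_apply_of_ne, Ne.symm h]

lemma eu_mul (i j k l : Fin 4) : eu R i j * eu R k l = if j = k then eu R i l else 0 := by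
  split_ifs with h
  · subst h; simp [eu]
  · simp [eu, h]

lemma map_Dl_add (i j : Fin 4) (M N : MM R) : (M + N).map (Dl R i j) = M.map (Dl R i j) + N.map (Dl R i j) := by
  ext a b : 2; simp
lemma map_Dl_sub (i j : Fin 4) (M N : MM R) : (M - N).map (Dl R i j) = M.map (Dl R i j) - N.map (Dl R i j) := by
  ext a b : 2; simp

lemma Ll_add (i j : Fin 4) (M N : MM R) : Ll R i j (M + N) = Ll R i j M + Ll R i j N := by
  simp only [Ll, map_Dl_add, mul_add, add_mul]; abel

lemma Ll_smul (i j : Fin 4) (c : R) (M : MM R) : Ll R i j (c • M) = c • Ll R i j M := by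
  have : (c • M).map (Dl R i j) = c • M.map (Dl R i j) := by
    ext a b : 2; simp
  simp only [Ll, this, Matrix.mul_smul, Matrix.smul_mul, smul_add, smul_sub]

def LlL (i j : Fin 4) : MM R →ₗ[R] MM R where
  toFun := Ll R i j
  map_add' := Ll_add R i j
  map_smul' := Ll_smul R i j

lemma Ll_comm (i j k l : Fin 4) (M : MM R) : Ll R i j (Ll R k l M) - Ll R k l (Ll R i j M) =
    (if j = k then Ll R i l M else 0) - (if l = i then Ll R k j M else 0) := by
  have h1 : (M.map (Dl R k l)).map (Dl R i j) - (M.map (Dl R i j)).map (Dl R k l) =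
     (if j = k then M.map (Dl R i l) else 0) - (if l = i then M.map (Dl R k j) else 0) := by
    ext a b : 2
    have := Dl_comm R i j k l (M a b)
    simp only [Matrix.sub_apply, Matrix.map_apply]
    rw [this]
    split_ifs <;> simp
  have h2 := eu_mul R i j k l
  have h3 := eu_mul R k l i j
  have h4 : ∀ (p : Prop) [Decidable p] (a b : Fin 4), (if p then Ll R a b M else 0) =
      (if p then M.map (Dl R a b) else 0) + (if p then eu R a b else 0) * M -
        M * (if p then eu R a b else 0) := by
    intro p _ a b
    split_ifs
    · simp only [Ll]; abel
    · simp
  rw [h4, h4, ← h2, ← h3]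
  rw [show ∀ A B C D E F : MM R, A + B - C - (D + E - F) = (A - D) + (B - C - E + F) by
    intros; abel, ← h1]
  simp only [Ll, map_Dl_add, map_Dl_sub, Dl_mul_const, Dl_const_mul]
  noncomm_ring

def xd (u v : MatVar 4) (d' d : MatVar 4 →₀ ℕ) : ℤ :=
  if d' + Finsupp.single v 1 = d + Finsupp.single u 1 then (d v : ℤ) else 0

def dz (i j : Fin 4) (d' d : MatVar 4 →₀ ℕ) : ℤ :=
  ∑ e : Bool, ((∑ k, xd (vr e k i) (vr e k j) d' d) - ∑ l, xd (vr e j l) (vr e i l) d' d)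

def az (i j : Fin 4) (a c : Fin 4 × Fin 4) : ℤ :=
  (if j = c.1 ∧ a.1 = i ∧ a.2 = c.2 then 1 else 0) - (if c.2 = i ∧ a.1 = c.1 ∧ a.2 = j then 1 else 0)

abbrev JJ := (MatVar 4 →₀ ℕ) × (Fin 4 × Fin 4)

def ez (i j : Fin 4) (b c : JJ) : ℤ :=
  (if b.2 = c.2 then dz i j b.1 c.1 else 0) + (if b.1 = c.1 then az i j b.2 c.2 else 0)

def bas (b : JJ) : MM R := Matrix.single b.2.1 b.2.2 (monomial b.1 1)

lemma bas_apply (b : JJ) (k l : Fin 4) : bas R b k l = if b.2 = (k, l) then monomial b.1 1 else 0 := by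
  simp only [bas, Matrix.single_apply, Prod.ext_iff]

lemma coeff_xd (u v : MatVar 4) (d' d : MatVar 4 →₀ ℕ) :
    coeff d' (X u * pderiv v (monomial d (1 : R))) = (xd u v d' d : R) := by
  rw [pderiv_monomial, mul_comm, coeff_mul_X', xd]
  by_cases hv : d v = 0
  · simp [hv]
  have hd : d - Finsupp.single v 1 + Finsupp.single v 1 = d := by
    ext w
    by_cases h : w = v
    · subst h; simp; omega
    · simp [Finsupp.single_apply, Ne.symm h]
  by_cases hu : d' + Finsupp.single v 1 = d + Finsupp.single u 1
  · have : d' = (d - Finsupp.single v 1) + Finsupp.single u 1 := by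
      apply add_right_cancel (b := Finsupp.single v 1)
      rw [hu, add_right_comm, hd]
    rw [if_pos (by rw [this]; simp), if_pos hu, this]
    simp
  · rw [if_neg hu]
    split_ifs with h
    · rw [coeff_monomial, if_neg]
      · simp
      · intro h'
        apply hu
        have h'' : d' = d' - Finsupp.single u 1 + Finsupp.single u 1 := by
          ext w
          by_cases hw : w = u
          · subst hw; simp at h; simp; omega
          · simp [Finsupp.single_apply, Ne.symm hw]
        rw [h'', ← h', add_right_comm, hd]
    · simp

lemma coeff_dz (i j : Fin 4) (d' d : MatVar 4 →₀ ℕ) :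
    coeff d' (Dl R i j (monomial d 1)) = (dz i j d' d : R) := by
  rw [Dl_apply]
  simp only [coeff_sum, coeff_sub, coeff_xd, dz]
  push_cast; rfl

lemma coeff_ez (i j : Fin 4) (b c : JJ) :
    coeff b.1 (Ll R i j (bas R c) b.2.1 b.2.2) = (ez i j b c : R) := by
  obtain ⟨d', k', l'⟩ := b
  obtain ⟨d, k, l⟩ := c
  simp only [Ll, Matrix.add_apply, Matrix.map_apply, Matrix.sub_apply, coeff_add, coeff_sub, ez]
  push_cast
  congr 1
  · rw [bas_apply]
    split_ifs with h1 h2 h3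
    · exact coeff_dz R i j d' d
    · exact absurd h1.symm h2
    · exact absurd h3.symm h1
    · simp
  · have e1 : eu R i j * bas R (d, k, l) = if j = k then Matrix.single i l (monomial d 1) else 0 := by
      split_ifs with h
      · subst h; simp [bas, eu]
      · simp [bas, eu, h]
    have e2 : bas R (d, k, l) * eu R i j = if l = i then Matrix.single k j (monomial d 1) else 0 := by
      split_ifs with h
      · subst h; simp [bas, eu]
      · simp [bas, eu, h]
    rw [e1, e2]
    have e3 : ∀ (p : Prop) [Decidable p] (a b : Fin 4),
        coeff d' ((if p then (Matrix.single a b (monomial d 1) : MM R) else 0) k' l') =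
        if d' = d then (if p ∧ k' = a ∧ l' = b then 1 else 0) else 0 := by
      intro p _ a b
      by_cases hp : p
      · simp only [hp, if_true, Matrix.single_apply, true_and]
        by_cases h : a = k' ∧ b = l'
        · obtain ⟨rfl, rfl⟩ := h
          rw [if_pos ⟨rfl, rfl⟩, coeff_monomial]; simp [eq_comm]
        · have h' : ¬ (k' = a ∧ l' = b) := fun hh => h ⟨hh.1.symm, hh.2.symm⟩
          simp [h, h']
      · simp [hp]
    rw [e3, e3]
    simp only [az]
    split_ifs <;> simp
end lie


abbrev Sd (p q : ℕ) := {d : MatVar 4 →₀ ℕ // Finsupp.weight (bideg 4) d = (p, q)}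

lemma weight_eq (d : MatVar 4 →₀ ℕ) : Finsupp.weight (bideg 4) d =
    (∑ a : Fin 4 × Fin 4, d (Sum.inl a), ∑ a : Fin 4 × Fin 4, d (Sum.inr a)) := by
  rw [Finsupp.weight_apply, Finsupp.sum_fintype _ _ (by simp)]
  rw [Fintype.sum_sum_type]
  ext <;> simp [bideg, Prod.fst_sum, Prod.snd_sum]

instance (p q : ℕ) : Finite (Sd p q) := by
  have : Set.Finite {d : MatVar 4 →₀ ℕ | ∀ v, d v ≤ p + q} := by
    have h := (Set.finite_Iic (Finsupp.equivFunOnFinite.symm (fun _ : MatVar 4 => p + q)))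
    refine h.subset ?_
    intro d hd v
    exact hd v
  refine Set.Finite.subset this ?_
  intro d hd v
  have hd' := weight_eq d
  rw [show Finsupp.weight (bideg 4) d = (p, q) from hd, Prod.ext_iff] at hd'
  simp only at hd'
  rcases v with a | a
  · have := Finset.single_le_sum (f := fun a => d (Sum.inl a)) (fun _ _ => Nat.zero_le _) (Finset.mem_univ a)
    rw [← hd'.1] at this
    omega
  · have := Finset.single_le_sum (f := fun a => d (Sum.inr a)) (fun _ _ => Nat.zero_le _) (Finset.mem_univ a)
    rw [← hd'.2] at this
    omega

instance (p q : ℕ) : Fintype (Sd p q) := Fintype.ofFinite _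

abbrev BI (p q : ℕ) := Sd p q × (Fin 4 × Fin 4)

def toJ {p q : ℕ} (b : BI p q) : JJ := (b.1.1, b.2)

lemma toJ_inj {p q : ℕ} : Function.Injective (toJ (p := p) (q := q)) := by
  rintro ⟨⟨d, hd⟩, a⟩ ⟨⟨d', hd'⟩, a'⟩ h
  simp only [toJ, Prod.mk.injEq] at h
  obtain ⟨rfl, rfl⟩ := h
  rfl

section phi
variable (R : Type*) [CommRing R] (p q : ℕ)

def Phi : (BI p q → R) →ₗ[R] MM R :=
  Fintype.linearCombination R (fun b : BI p q => bas R (toJ b))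

lemma Phi_apply (v : BI p q → R) : Phi R p q v = ∑ b, v b • bas R (toJ b) := by
  simp [Phi, Fintype.linearCombination_apply]

lemma coeff_Phi (v : BI p q → R) (b : BI p q) : coeff b.1.1 (Phi R p q v b.2.1 b.2.2) = v b := by
  rw [Phi_apply, Matrix.sum_apply, coeff_sum, Finset.sum_eq_single b]
  · simp [bas_apply, toJ]
  · intro c _ hc
    simp only [Matrix.smul_apply, bas_apply, toJ]
    by_cases h2 : c.2 = b.2
    · have h1 : c.1.1 ≠ b.1.1 := fun h => hc (Prod.ext (Subtype.ext h) h2)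
      simp [h2, coeff_smul, coeff_monomial, h1]
    · have : ¬ c.2 = (b.2.1, b.2.2) := h2
      simp [this]
  · simp

lemma Phi_inj : Function.Injective (Phi R p q) := by
  intro v w h
  funext b
  rw [← coeff_Phi R p q v b, h, coeff_Phi]

def HomM (M : MM R) : Prop := ∀ i j, (M i j).IsWeightedHomogeneous (bideg 4) (p, q)

lemma Phi_hom (v : BI p q → R) : HomM R p q (Phi R p q v) := by
  intro i j
  rw [Phi_apply, Matrix.sum_apply]
  refine IsWeightedHomogeneous.sum _ _ _ ?_ 
  intro b _
  rw [Matrix.smul_apply, bas_apply]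
  split_ifs
  · rw [smul_monomial]
    exact isWeightedHomogeneous_monomial _ _ _ b.1.2
  · rw [smul_zero]; exact isWeightedHomogeneous_zero _ _ _

lemma hom_ext {M N : MM R} (hM : HomM R p q M) (hN : HomM R p q N)
    (h : ∀ b : BI p q, coeff b.1.1 (M b.2.1 b.2.2) = coeff b.1.1 (N b.2.1 b.2.2)) : M = N := by
  ext i j d
  by_cases hd : Finsupp.weight (bideg 4) d = (p, q)
  · exact h (⟨d, hd⟩, (i, j))
  · have h1 : coeff d (M i j) = 0 := by
      by_contra hc; exact hd (hM i j hc)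
    have h2 : coeff d (N i j) = 0 := by
      by_contra hc; exact hd (hN i j hc)
    rw [h1, h2]

lemma Phi_surj (M : MM R) (hM : HomM R p q M) :
    Phi R p q (fun b => coeff b.1.1 (M b.2.1 b.2.2)) = M := by
  apply hom_ext R p q (Phi_hom R p q _) hM
  intro b
  rw [coeff_Phi]

def Ez (i j : Fin 4) : Matrix (BI p q) (BI p q) ℤ := Matrix.of fun b c => ez i j (toJ b) (toJ c)

def ER (i j : Fin 4) : Matrix (BI p q) (BI p q) R := (Ez p q i j).map (Int.castRingHom R)

lemma vr_bideg (e : Bool) (i j k l : Fin 4) : bideg 4 (vr e i j) = bideg 4 (vr e k l) := by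
  cases e <;> rfl

lemma hom_Dl (i j : Fin 4) (f : MP R) (hf : f.IsWeightedHomogeneous (bideg 4) (p, q)) :
    (Dl R i j f).IsWeightedHomogeneous (bideg 4) (p, q) := by
  have key : ∀ d, Finsupp.weight (bideg 4) d = (p, q) →
      (Dl R i j (monomial d 1)).IsWeightedHomogeneous (bideg 4) (p, q) := by
    intro d hd d' h
    rw [coeff_dz] at h
    have h1 : dz i j d' d ≠ 0 := by
      rintro h0; rw [h0] at h; simp at h
    by_contra hd'
    apply h1
    have hx : ∀ u v, bideg 4 u = bideg 4 v → xd u v d' d = 0 := by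
      intro u v huv
      rw [xd, if_neg]
      intro hh
      have := congrArg (Finsupp.weight (bideg 4)) hh
      rw [map_add, map_add, hd, Finsupp.weight_single, Finsupp.weight_single, huv] at this
      exact hd' (add_right_cancel this)
    simp only [dz]
    refine Finset.sum_eq_zero fun e _ => ?_
    rw [Finset.sum_eq_zero (fun k _ => hx _ _ (vr_bideg e _ _ _ _)),
      Finset.sum_eq_zero (fun k _ => hx _ _ (vr_bideg e _ _ _ _)), sub_zero]
  rw [f.as_sum, map_sum]
  refine IsWeightedHomogeneous.sum _ _ _ ?_
  intro d hd
  rw [show monomial d (coeff d f) = (coeff d f) • monomial d (1 : R) by rw [smul_monomial]; simp,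
    Derivation.map_smul]
  exact (weightedHomogeneousSubmodule R (bideg 4) (p, q)).smul_mem _
    (key d (hf (by simpa using hd)))

lemma hom_Ll (i j : Fin 4) (M : MM R) (hM : HomM R p q M) : HomM R p q (Ll R i j M) := by
  intro k l
  have hs : ∀ f g : MP R, f.IsWeightedHomogeneous (bideg 4) (p, q) →
    g.IsWeightedHomogeneous (bideg 4) (p, q) → (f - g).IsWeightedHomogeneous (bideg 4) (p, q) :=
    fun f g hf hg => (weightedHomogeneousSubmodule R (bideg 4) (p, q)).sub_mem hf hg
  refine (hom_Dl R p q i j _ (hM k l)).add (hs _ _ ?_ ?_)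
  · by_cases h : i = k
    · subst h; simp; exact hM _ _
    · rw [Matrix.single_mul_apply_of_ne _ _ _ _ _ (Ne.symm h)]; exact isWeightedHomogeneous_zero _ _ _
  · by_cases h : j = l
    · subst h; simp; exact hM _ _
    · rw [Matrix.mul_single_apply_of_ne _ _ _ _ _ (Ne.symm h)]; exact isWeightedHomogeneous_zero _ _ _

lemma Ll_Phi (i j : Fin 4) (v : BI p q → R) : Ll R i j (Phi R p q v) = Phi R p q (ER R p q i j *ᵥ v) := by
  apply hom_ext R p q (hom_Ll R p q i j _ (Phi_hom R p q v)) (Phi_hom R p q _)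
  intro b
  rw [coeff_Phi, Phi_apply]
  have : Ll R i j (∑ b, v b • bas R (toJ b)) = ∑ b, v b • Ll R i j (bas R (toJ b)) := by
    change LlL R i j _ = _
    rw [map_sum]
    simp only [map_smul]
    rfl
  rw [this, Matrix.sum_apply, coeff_sum, Matrix.mulVec, dotProduct]
  refine Finset.sum_congr rfl fun c _ => ?_
  rw [Matrix.smul_apply, coeff_smul, smul_eq_mul, mul_comm]
  congr 1
  exact coeff_ez R i j (toJ b) (toJ c)

lemma ER_comm (i j k l : Fin 4) : ER R p q i j * ER R p q k l - ER R p q k l * ER R p q i j =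
      (if j = k then ER R p q i l else 0) - (if l = i then ER R p q k j else 0) := by
  apply Matrix.mulVec_injective
  funext v
  apply Phi_inj R p q
  rw [Matrix.sub_mulVec, Matrix.sub_mulVec, ← Matrix.mulVec_mulVec, ← Matrix.mulVec_mulVec, map_sub,
    map_sub, ← Ll_Phi, ← Ll_Phi, ← Ll_Phi, ← Ll_Phi, Ll_comm, Ll_Phi, Ll_Phi]
  split_ifs <;> simp
end phi

instance instDecBI (p q : ℕ) : DecidableEq (BI p q) := Classical.decEq _

def wtJ (b : JJ) (i : Fin 4) : ℤ :=
  (∑ e : Bool, ((∑ k, (b.1 (vr e k i) : ℤ)) - ∑ l, (b.1 (vr e i l) : ℤ))) +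
    ((if b.2.1 = i then 1 else 0) - (if b.2.2 = i then 1 else 0))

lemma wtJ_sum (b : JJ) : ∑ i, wtJ b i = 0 := by
  simp only [wtJ, Finset.sum_add_distrib, Finset.sum_sub_distrib]
  have h0 : ∀ f : Fin 4 → Bool → ℤ, ∑ i, ∑ e, f i e = ∑ e, ∑ i, f i e := fun f => Finset.sum_comm
  rw [h0, h0]
  have : ∀ e : Bool, ∑ i, ∑ k, (b.1 (vr e k i) : ℤ) = ∑ i, ∑ k, (b.1 (vr e i k) : ℤ) := by
    intro e; rw [Finset.sum_comm]
  simp [this]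

lemma ez_diag (i : Fin 4) (b c : JJ) : ez i i b c = if b = c then wtJ b i else 0 := by
  obtain ⟨d', k', l'⟩ := b
  obtain ⟨d, k, l⟩ := c
  have hx : ∀ v, xd v v d' d = if d' = d then (d v : ℤ) else 0 := by
    intro v; simp [xd]
  have hdz : dz i i d' d = if d' = d then ∑ e : Bool, ((∑ k, (d (vr e k i) : ℤ)) - ∑ l, (d (vr e i l) : ℤ)) else 0 := by
    simp only [dz, hx]
    split_ifs <;> simp
  simp only [ez, hdz, az, wtJ]
  by_cases h1 : d' = d
  · subst h1
    by_cases h2 : (k', l') = (k, l)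
    · obtain ⟨rfl, rfl⟩ := Prod.mk.inj h2
      simp only [if_true]
      congr 2 
      · by_cases h : i = k'
        · subst h; simp
        · simp [h, Ne.symm h]
      · by_cases h : l' = i
        · subst h; simp
        · simp [h]
    · have h3 : ¬ (d', k', l') = (d', k, l) := by simpa using h2
      rw [if_neg h2, if_neg h3]
      simp only [if_true, zero_add]
      have : ∀ (P Q : Prop) [Decidable P] [Decidable Q], ¬ P → ¬ Q → ((if P then (1:ℤ) else 0) - if Q then 1 else 0) = 0 := by
        intro P Q _ _ hP hQ; simp [hP, hQ]
      apply this
      · rintro ⟨rfl, rfl, rfl⟩; exact h2 rfl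
      · rintro ⟨rfl, rfl, rfl⟩; exact h2 rfl
  · simp [h1]

def NN (d : MatVar 4 →₀ ℕ) : ℕ := ∏ v, (d v).factorial

lemma NN_add (m : MatVar 4 →₀ ℕ) (v : MatVar 4) : NN (m + Finsupp.single v 1) = NN m * (m v + 1) := by
  unfold NN
  rw [← Finset.mul_prod_erase _ _ (Finset.mem_univ v), ← Finset.mul_prod_erase _ (fun v => (m v).factorial) (Finset.mem_univ v)]
  have : ∏ x ∈ Finset.univ.erase v, ((m + Finsupp.single v 1 : MatVar 4 →₀ ℕ) x).factorial = ∏ x ∈ Finset.univ.erase v, (m x).factorial := by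
    refine Finset.prod_congr rfl fun x hx => ?_
    have := Finset.ne_of_mem_erase hx
    simp [Finsupp.single_apply, Ne.symm this]
  rw [this]
  simp [Nat.factorial_succ]
  ring

attribute [irreducible] NN

lemma xd_adj (u v : MatVar 4) (d' d : MatVar 4 →₀ ℕ) :
    (NN d' : ℤ) * xd u v d' d = NN d * xd v u d d' := by
  unfold xd
  by_cases h : d' + Finsupp.single v 1 = d + Finsupp.single u 1
  · rw [if_pos h, if_pos h.symm]
    by_cases huv : u = v
    · subst huv
      rw [add_right_cancel h]
    · have h1 := DFunLike.congr_fun h v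
      simp [Finsupp.single_apply, huv] at h1
      have hd : d - Finsupp.single v 1 + Finsupp.single v 1 = d := by
        ext w
        by_cases h : w = v
        · subst h; simp; omega
        · simp [Ne.symm h]
      set m := d - Finsupp.single v 1 with hm
      have hd' : d' = m + Finsupp.single u 1 := by
        apply add_right_cancel (b := Finsupp.single v 1)
        rw [h, add_right_comm, hd]
      rw [← hd, hd', NN_add, NN_add]
      simp only [Finsupp.add_apply, Finsupp.single_eq_same]
      push_cast
      ring
  · rw [if_neg h, if_neg (Ne.symm h), mul_zero, mul_zero]

lemma dz_adj (i j : Fin 4) (d' d : MatVar 4 →₀ ℕ) :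
    (NN d' : ℤ) * dz i j d' d = NN d * dz j i d d' := by
  simp only [dz, Finset.mul_sum, mul_sub, xd_adj]

lemma az_adj (i j : Fin 4) (a c : Fin 4 × Fin 4) : az i j a c = az j i c a := by
  simp only [az]
  congr 1
  · congr 1; apply propext; constructor <;> (rintro ⟨h1, h2, h3⟩; simp_all)
  · congr 1; apply propext; constructor <;> (rintro ⟨h1, h2, h3⟩; simp_all)

lemma ez_adj (i j : Fin 4) (b c : JJ) : (NN b.1 : ℤ) * ez i j b c = NN c.1 * ez j i c b := by
  simp only [ez, mul_add]
  congr 1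
  · by_cases h : b.2 = c.2
    · rw [if_pos h, if_pos h.symm, dz_adj]
    · rw [if_neg h, if_neg (Ne.symm h), mul_zero, mul_zero]
  · by_cases h : b.1 = c.1
    · rw [if_pos h, if_pos h.symm, h, az_adj]
    · rw [if_neg h, if_neg (Ne.symm h), mul_zero, mul_zero]

theorem weyl_concrete (p q : ℕ) : ∃ P A : Matrix (BI p q) (BI p q) ℚ, P * P = P ∧
    (∀ i j, ER ℚ p q i j * P = 0) ∧ P = 1 - A * ∑ i, ∑ j, ER ℚ p q i j * ER ℚ p q j i ∧
      24 * P.trace = ctL (delta * deltab * ∑ b : BI p q, mono (wtJ (toJ b))) := by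
  refine weyl_abstract (fun b : BI p q => wtJ (toJ b)) (ER ℚ p q) (fun b => (NN b.1.1 : ℚ)) ?_ ?_ ?_ ?_ ?_
  · intro b
    have : 0 < NN b.1.1 := by
      unfold NN; exact Finset.prod_pos fun v _ => Nat.factorial_pos _
    exact_mod_cast this
  · intro i j b c
    have := ez_adj i j (toJ b) (toJ c)
    simp only [ER, Matrix.map_apply, Ez, Matrix.of_apply, eq_intCast]
    exact_mod_cast this
  · exact ER_comm ℚ p q
  · intro i
    ext b c
    simp only [ER, Matrix.map_apply, Ez, Matrix.of_apply, eq_intCast, ez_diag, Matrix.diagonal_apply,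
      toJ_inj.eq_iff]
    split_ifs <;> simp
  · intro b
    exact wtJ_sum _


lemma ring_aux1 {A : Type*} [Ring A] (Ti T E M' D' : A) (z1 : Ti * E = E) (z2 : E * T = E) :
    (-E * M' + Ti * (-D')) * T + Ti * M' * E = -(Ti * (D' + (E * M' - M' * E)) * T) := by
  have e1 : Ti * (D' + (E * M' - M' * E)) * T = Ti * D' * T + (Ti * E) * M' * T - Ti * M' * (E * T) := by
    noncomm_ring
  rw [e1, z1, z2]
  noncomm_ring

lemma ring_aux2 {A : Type*} [Ring A] (Ti T L : A) (z1 : T * Ti = 1) (h : 0 = -(Ti * L * T)) :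
    L = 0 := by
  have h' : Ti * L * T = 0 := neg_eq_zero.1 h.symm
  calc L = (T * Ti) * L * (T * Ti) := by rw [z1]; simp
    _ = T * (Ti * L * T) * Ti := by noncomm_ring
    _ = 0 := by rw [h']; simp

section conj
variable {S : Type*} [CommRing S]
def tv (i j : Fin 4) (c : S) : Matrix (Fin 4) (Fin 4) S := 1 + Matrix.single i j c

lemma conj_entry (i j : Fin 4) (c : S) (A : Matrix (Fin 4) (Fin 4) S) (k l : Fin 4) :
    (tv i j c * A * tv i j (-c)) k l = A k l + (if k = i then c * A j l else 0)
      - (if j = l then c * A k i else 0) - (if k = i then (if j = l then c ^ 2 * A j i else 0) else 0) := by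
  have h1 : ∀ (B : Matrix (Fin 4) (Fin 4) S) (c : S) k l, (Matrix.single i j c * B) k l =
      if k = i then c * B j l else 0 := by
    intro B c k l
    split_ifs with h
    · subst h; simp
    · rw [Matrix.single_mul_apply_of_ne _ _ _ _ _ h]
  have h2 : ∀ (B : Matrix (Fin 4) (Fin 4) S) (c : S) k l, (B * Matrix.single i j c) k l =
      if j = l then c * B k i else 0 := by
    intro B c k l
    split_ifs with h
    · subst h; simp [mul_comm]
    · rw [Matrix.mul_single_apply_of_ne _ _ _ _ _ (Ne.symm h)]
  simp only [tv, add_mul, mul_add, one_mul, mul_one, Matrix.add_apply, h1, h2]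
  split_ifs <;> ring

lemma tv_mul (i j : Fin 4) (h : i ≠ j) (c d : S) : tv i j c * tv i j d = tv i j (c + d) := by
  simp only [tv, add_mul, mul_add, one_mul, mul_one, Matrix.single_mul_single_of_ne _ _ _ _ h.symm,
    Matrix.single_add]
  abel

lemma tv_zero (i j : Fin 4) : tv i j (0 : S) = 1 := by simp [tv]

lemma map_tv {S' : Type*} [CommRing S'] (f : S →+* S') (i j : Fin 4) (c : S) :
    (tv i j c).map f = tv i j (f c) := by
  ext a b
  simp [tv, Matrix.one_apply, Matrix.single_apply, apply_ite f]
end conj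

section deriv
variable (K : Type*) [Field K]
abbrev PP := Polynomial (MP K)

def gen (e : Bool) : Matrix (Fin 4) (Fin 4) (PP K) := Matrix.of fun k l => Polynomial.C (X (vr e k l))

def sg (i j : Fin 4) : MP K →ₐ[K] PP K := aeval (pairSub
  (tv i j Polynomial.X * gen K true * tv i j (-Polynomial.X))
  (tv i j Polynomial.X * gen K false * tv i j (-Polynomial.X)))

lemma sg_X (i j : Fin 4) (e : Bool) (k l : Fin 4) : sg K i j (X (vr e k l)) =
    (tv i j Polynomial.X * gen K e * tv i j (-Polynomial.X) : Matrix (Fin 4) (Fin 4) (PP K)) k l := by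
  cases e <;> simp [sg, vr, pairSub]

lemma sg_der_X (i j : Fin 4) (hij : i ≠ j) (e : Bool) (k l : Fin 4) :
    Polynomial.derivative (sg K i j (X (vr e k l))) = - sg K i j (Dl K i j (X (vr e k l))) := by
  rw [Dl_X]
  have t : ∀ (p : Prop) [Decidable p] (g : MP K),
        sg K i j (if p then g else 0) = if p then sg K i j g else 0 := by
      intro p _ g; split_ifs <;> simp
  simp only [map_sub, t, sg_X, conj_entry, gen, Matrix.of_apply]
  have t' : ∀ (p : Prop) [Decidable p] (g : PP K),
        Polynomial.derivative (if p then g else 0) = if p then Polynomial.derivative g else 0 := by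
      intro p _ g; split_ifs <;> simp
  simp only [map_add, map_sub, t', hij, hij.symm, if_false, Polynomial.derivative_C,
    Polynomial.derivative_mul, Polynomial.derivative_X, Polynomial.derivative_X_pow]
  have c2 : (Polynomial.C (2 : MP K)) = 2 := map_ofNat Polynomial.C 2
  split_ifs <;> simp [c2] <;> ring

lemma sg_der (i j : Fin 4) (hij : i ≠ j) (f : MP K) :
    Polynomial.derivative (sg K i j f) = - sg K i j (Dl K i j f) := by
  induction f using MvPolynomial.induction_on with
  | C a => 
    have : sg K i j (C a) = Polynomial.C (C a) := by
      simp only [sg, aeval_C]; rfl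
    rw [this]; simp
  | add f g hf hg => simp only [map_add, hf, hg]; ring
  | mul_X f v hf =>
    obtain ⟨e, k, l, rfl⟩ := vr_surj v
    simp only [map_mul, Polynomial.derivative_mul, Derivation.leibniz, smul_eq_mul, map_add, hf,
      sg_der_X K i j hij]
    ring

lemma map_der_mul (A B : Matrix (Fin 4) (Fin 4) (PP K)) :
    (A * B).map Polynomial.derivative = A.map Polynomial.derivative * B + A * B.map Polynomial.derivative := by
  ext1 a b
  simp only [Matrix.map_apply, Matrix.mul_apply, Matrix.add_apply, map_sum, Polynomial.derivative_mul,
    Finset.sum_add_distrib]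

def Nc (i j : Fin 4) (M : MM K) : Matrix (Fin 4) (Fin 4) (PP K) :=
  tv i j (-Polynomial.X) * M.map (sg K i j) * tv i j Polynomial.X

lemma Nc_der (i j : Fin 4) (hij : i ≠ j) (M : MM K) : (Nc K i j M).map Polynomial.derivative =
    - (tv i j (-Polynomial.X) * (Ll K i j M).map (sg K i j) * tv i j Polynomial.X) := by
  have h1 : (tv i j (Polynomial.X : PP K)).map Polynomial.derivative = Matrix.single i j 1 := by
    ext1 a b
    simp only [tv, Matrix.map_apply, Matrix.add_apply, Matrix.one_apply, Matrix.single_apply, map_add]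
    split_ifs <;> simp
  have h2 : (tv i j (-Polynomial.X : PP K)).map Polynomial.derivative = -Matrix.single i j 1 := by
    ext1 a b
    simp only [tv, Matrix.map_apply, Matrix.add_apply, Matrix.one_apply, Matrix.single_apply, map_add,
      Matrix.neg_apply]
    split_ifs <;> simp
  have h3 : (M.map (sg K i j)).map Polynomial.derivative = - ((M.map (Dl K i j)).map (sg K i j)) := by
    ext1 a b
    simp [sg_der K i j hij]
  have h5 : (eu K i j).map (sg K i j) = Matrix.single i j 1 := by
    ext1 a b
    simp only [Matrix.map_apply, Matrix.single_apply]
    split_ifs <;> simp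
  have h4 : (Ll K i j M).map (sg K i j) = (M.map (Dl K i j)).map (sg K i j) +
      (Matrix.single i j 1 * M.map (sg K i j) - M.map (sg K i j) * Matrix.single i j 1) := by
    have := Matrix.map_mul (L := eu K i j) (M := M) (f := (sg K i j : MP K →+* PP K))
    have h6 : (eu K i j * M).map (sg K i j) = (eu K i j).map (sg K i j) * M.map (sg K i j) := this
    have := Matrix.map_mul (L := M) (M := eu K i j) (f := (sg K i j : MP K →+* PP K))
    have h7 : (M * eu K i j).map (sg K i j) = M.map (sg K i j) * (eu K i j).map (sg K i j) := this
    rw [h5] at h6 h7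
    rw [← h6, ← h7]
    ext1 a b
    simp only [Ll, Matrix.map_apply, Matrix.add_apply, Matrix.sub_apply, map_add, map_sub]
  have z1 : tv i j (-Polynomial.X : PP K) * Matrix.single i j 1 = Matrix.single i j 1 := by
    simp [tv, add_mul, Matrix.single_mul_single_of_ne _ _ _ _ hij.symm]
  have z2 : Matrix.single i j 1 * tv i j (Polynomial.X : PP K)  = Matrix.single i j 1 := by
    simp [tv, mul_add, Matrix.single_mul_single_of_ne _ _ _ _ hij.symm]
  rw [Nc, map_der_mul, map_der_mul, h1, h2, h3, h4]
  exact ring_aux1 _ _ _ _ _ z1 z2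

def ev (c : K) (A B : Matrix (Fin 4) (Fin 4) K) : PP K →+* K :=
  Polynomial.eval₂RingHom (MvPolynomial.eval (pairSub A B)) c

lemma ev_C (c : K) (A B : Matrix (Fin 4) (Fin 4) K) (f : MP K) : ev K c A B (Polynomial.C f) =
    MvPolynomial.eval (pairSub A B) f := by simp [ev]
lemma ev_XX (c : K) (A B : Matrix (Fin 4) (Fin 4) K) : ev K c A B Polynomial.X = c := by simp [ev]

lemma ev_sg (i j : Fin 4) (c : K) (A B : Matrix (Fin 4) (Fin 4) K) (f : MP K) :
    ev K c A B (sg K i j f) = MvPolynomial.eval (pairSub (tv i j c * A * tv i j (-c))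
      (tv i j c * B * tv i j (-c))) f := by
  have : (ev K c A B).comp (sg K i j : MP K →+* PP K) = MvPolynomial.eval (pairSub (tv i j c * A * tv i j (-c))
      (tv i j c * B * tv i j (-c))) := by
    have hg : ∀ e, (gen K e).map (ev K c A B) = if e then A else B := by
      intro e
      ext k l
      cases e <;> simp [gen, ev_C, vr, pairSub]
    apply MvPolynomial.ringHom_ext
    · intro r
      have : sg K i j (C r) = Polynomial.C (C r) := by
        simp only [sg, aeval_C]; rfl
      simp [this, ev_C]
    · intro v
      obtain ⟨e, k, l, rfl⟩ := vr_surj v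
      have h : (tv i j Polynomial.X * gen K e * tv i j (-Polynomial.X)).map (ev K c A B) =
        tv i j c * (if e then A else B) * tv i j (-c) := by
        rw [Matrix.map_mul, Matrix.map_mul, map_tv, map_tv, map_neg, ev_XX, hg]
      have := congrFun (congrFun h k) l
      simp only [RingHom.comp_apply, RingHom.coe_coe, sg_X]
      rw [Matrix.map_apply] at this
      rw [this]
      cases e <;> simp [vr, pairSub]
  rw [← this]; rfl

lemma pp_ext [Infinite K] {f g : PP K} (h : ∀ c A B, ev K c A B f = ev K c A B g) : f = g := by
  ext1 n
  apply MvPolynomial.funext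
  intro x
  obtain ⟨A, B, rfl⟩ : ∃ A B, x = pairSub A B := by
    refine ⟨Matrix.of fun i j => x (Sum.inl (i, j)), Matrix.of fun i j => x (Sum.inr (i, j)), ?_⟩
    funext v
    rcases v with ⟨i, j⟩ | ⟨i, j⟩ <;> rfl
  have : f.map (MvPolynomial.eval (pairSub A B)) = g.map (MvPolynomial.eval (pairSub A B)) := by
    apply Polynomial.funext
    intro c
    have := h c A B
    simpa [ev, Polynomial.eval_map] using this
  have := congrArg (fun p => p.coeff n) this
  simpa using this

lemma ev0_sg (i j : Fin 4) (f : MP K) : (sg K i j f).coeff 0 = f := by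
  rw [Polynomial.coeff_zero_eq_eval_zero]
  have : (Polynomial.evalRingHom (0 : MP K)).comp (sg K i j : MP K →+* PP K) = RingHom.id _ := by
    apply MvPolynomial.ringHom_ext
    · intro r
      have : sg K i j (C r) = Polynomial.C (C r) := by
        simp only [sg, aeval_C]; rfl
      simp [this]
    · intro v
      obtain ⟨e, k, l, rfl⟩ := vr_surj v
      simp only [RingHom.comp_apply, RingHom.coe_coe, sg_X, conj_entry]
      split_ifs <;> simp [gen]
  exact congrArg (fun F => F f) this

theorem lie_iff [CharZero K] (i j : Fin 4) (hij : i ≠ j) (M : MM K) : Ll K i j M = 0 ↔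
    ∀ (c : K) (A B : Matrix (Fin 4) (Fin 4) K),
      M.map (MvPolynomial.eval (pairSub (tv i j c * A * tv i j (-c)) (tv i j c * B * tv i j (-c)))) =
        tv i j c * M.map (MvPolynomial.eval (pairSub A B)) * tv i j (-c) := by
  have e1 : ∀ (c : K) A B, (Nc K i j M).map (ev K c A B) = tv i j (-c) *
      M.map (MvPolynomial.eval (pairSub (tv i j c * A * tv i j (-c)) (tv i j c * B * tv i j (-c))))
      * tv i j c := by
    intro c A B
    rw [Nc, Matrix.map_mul, Matrix.map_mul, map_tv, map_tv, map_neg, ev_XX, Matrix.map_map]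
    congr 2
    ext a b
    simp [ev_sg]
  have hne : ∀ {c : K}, tv i j (-c) * tv i j c = 1 := by
    intro c; rw [tv_mul i j hij]; simp [tv_zero]
  have hne' : ∀ {c : K}, tv i j c * tv i j (-c) = 1 := by
    intro c; rw [tv_mul i j hij]; simp [tv_zero]
  have e2 : (∀ (c : K) (A B : Matrix (Fin 4) (Fin 4) K),
      M.map (MvPolynomial.eval (pairSub (tv i j c * A * tv i j (-c)) (tv i j c * B * tv i j (-c)))) =
        tv i j c * M.map (MvPolynomial.eval (pairSub A B)) * tv i j (-c)) ↔
      Nc K i j M = M.map Polynomial.C := by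
    constructor
    · intro h
      ext1 a b
      apply pp_ext
      intro c A B
      have h1 := congrFun (congrFun (e1 c A B) a) b
      rw [h c A B] at h1
      rw [show tv i j (-c) * (tv i j c * M.map (MvPolynomial.eval (pairSub A B)) * tv i j (-c)) * tv i j c =
        (tv i j (-c) * tv i j c) * M.map (MvPolynomial.eval (pairSub A B)) * (tv i j (-c) * tv i j c) by
        simp only [mul_assoc], hne, one_mul, mul_one] at h1
      rw [Matrix.map_apply] at h1
      rw [h1, Matrix.map_apply, Matrix.map_apply, ev_C]
    · intro h c A B
      have h1 := e1 c A B
      rw [h, Matrix.map_map] at h1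
      have h2 : M.map (⇑(ev K c A B) ∘ ⇑Polynomial.C) = M.map (MvPolynomial.eval (pairSub A B)) := by
        ext a b; simp [ev_C]
      rw [h2] at h1
      rw [h1]
      generalize M.map (MvPolynomial.eval (pairSub (tv i j c * A * tv i j (-c)) (tv i j c * B * tv i j (-c)))) = M'
      rw [show tv i j c * (tv i j (-c) * M' * tv i j c) * tv i j (-c) =
        (tv i j c * tv i j (-c)) * M' * (tv i j c * tv i j (-c)) by
        simp only [mul_assoc], hne', one_mul, mul_one]
  rw [e2]
  have hX1 : tv i j (-Polynomial.X) * tv i j Polynomial.X = (1 : Matrix (Fin 4) (Fin 4) (PP K)) := by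
    rw [tv_mul i j hij]; simp [tv_zero]
  have hX2 : tv i j Polynomial.X * tv i j (-Polynomial.X) = (1 : Matrix (Fin 4) (Fin 4) (PP K)) := by
    rw [tv_mul i j hij]; simp [tv_zero]
  have hd := Nc_der K i j hij M
  constructor
  · intro h
    rw [h] at hd
    have hd0 : (Nc K i j M).map Polynomial.derivative = 0 := by
      rw [hd]
      have : (0 : MM K).map (sg K i j) = 0 := by ext1 a b; simp
      rw [this]; simp
    have hcoef : (Nc K i j M).map (Polynomial.evalRingHom 0) = M := by
      rw [Nc, Matrix.map_mul, Matrix.map_mul, map_tv, map_tv, Matrix.map_map]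
      simp only [Polynomial.coe_evalRingHom, Polynomial.eval_neg, Polynomial.eval_X, neg_zero, tv_zero,
        one_mul, mul_one]
      ext1 a b
      have := ev0_sg K i j (M a b)
      rw [Polynomial.coeff_zero_eq_eval_zero] at this
      simpa using this
    ext1 a b
    have h1 := congrFun (congrFun hd0 a) b
    rw [Matrix.map_apply, Matrix.zero_apply] at h1
    have h2 := Polynomial.eq_C_of_derivative_eq_zero h1
    have h3 := congrFun (congrFun hcoef a) b
    rw [Matrix.map_apply, Polynomial.coe_evalRingHom, ← Polynomial.coeff_zero_eq_eval_zero] at h3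
    rw [h2, h3, Matrix.map_apply]
  · intro h
    have hz : (M.map (Polynomial.C : MP K → PP K)).map Polynomial.derivative = 0 := by
      ext1 a b; simp
    rw [h, hz] at hd
    have h1 : (Ll K i j M).map (sg K i j) = 0 := by
      exact ring_aux2 _ _ _ hX2 hd
    ext1 a b
    have := congrFun (congrFun h1 a) b
    rw [Matrix.map_apply] at this
    rw [← ev0_sg K i j (Ll K i j M a b), this]
    simp
end deriv

section grp
variable (K : Type*) [Field K] (p q : ℕ)

def vrow : MatVar 4 → Fin 4 | Sum.inl a => a.1 | Sum.inr a => a.1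
def vcol : MatVar 4 → Fin 4 | Sum.inl a => a.2 | Sum.inr a => a.2

def Rn (d : MatVar 4 →₀ ℕ) (i : Fin 4) : ℕ := ∑ e : Bool, ∑ l, d (vr e i l)
def Cn (d : MatVar 4 →₀ ℕ) (i : Fin 4) : ℕ := ∑ e : Bool, ∑ k, d (vr e k i)

lemma wtJ_eq (d : MatVar 4 →₀ ℕ) (k l i : Fin 4) : wtJ (d, (k, l)) i = (Cn d i : ℤ) - Rn d i +
    ((if k = i then 1 else 0) - (if l = i then 1 else 0)) := by
  simp only [wtJ, Cn, Rn, Finset.sum_sub_distrib]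
  push_cast; rfl

lemma prod_matvar {S : Type*} [CommMonoid S] (f : MatVar 4 → S) :
    ∏ v, f v = ∏ e : Bool, ∏ a, ∏ b, f (vr e a b) := by
  rw [Fintype.prod_sum_type, Fintype.prod_bool, Fintype.prod_prod_type, Fintype.prod_prod_type]
  rfl

lemma chi_prod (g : Fin 4 → K) (d : MatVar 4 →₀ ℕ) :
    ∏ v, (g (vrow v) * (g (vcol v))⁻¹) ^ d v = (∏ i, g i ^ Rn d i) * (∏ i, g i ^ Cn d i)⁻¹ := by
  simp only [mul_pow, Finset.prod_mul_distrib, inv_pow, Finset.prod_inv_distrib]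
  congr 1
  · rw [prod_matvar, Finset.prod_comm]
    refine Finset.prod_congr rfl fun a _ => ?_
    simp only [Rn, ← Finset.prod_pow_eq_pow_sum]
    refine Finset.prod_congr rfl fun e _ => Finset.prod_congr rfl fun b _ => ?_
    cases e <;> rfl
  · congr 1
    rw [prod_matvar]
    simp only [Cn, ← Finset.prod_pow_eq_pow_sum]
    have h0 : ∀ f : Fin 4 → Bool → K, ∏ i, ∏ e, f i e = ∏ e, ∏ i, f i e := fun f => Finset.prod_comm
    rw [h0]
    refine Finset.prod_congr rfl fun e _ => ?_
    rw [Finset.prod_comm]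
    refine Finset.prod_congr rfl fun b _ => Finset.prod_congr rfl fun a _ => ?_
    cases e <;> rfl

lemma chi_wt (g : Fin 4 → K) (hg : ∀ i, g i ≠ 0) (d : MatVar 4 →₀ ℕ) (k l : Fin 4)
    (h : ∀ i, wtJ (d, (k, l)) i = 0) :
    ∏ v, (g (vrow v) * (g (vcol v))⁻¹) ^ d v = g k * (g l)⁻¹ := by
  rw [chi_prod]
  have h1 : ∀ i, Cn d i + (if i = k then 1 else 0) = Rn d i + (if i = l then 1 else 0) := by
    intro i
    have := h i
    rw [wtJ_eq] at this
    simp only [eq_comm (a := i)]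
    split_ifs at * <;> omega
  have h2 : ∏ i, g i ^ (Cn d i + (if i = k then 1 else 0)) = ∏ i, g i ^ (Rn d i + (if i = l then 1 else 0)) := by
    simp only [h1]
  simp only [pow_add, Finset.prod_mul_distrib, pow_ite, pow_one, pow_zero, Finset.prod_ite_eq',
    Finset.mem_univ, if_true] at h2
  have hc : ∏ i, g i ^ Cn d i ≠ 0 := Finset.prod_ne_zero_iff.2 fun i _ => pow_ne_zero _ (hg i)
  have := hg l
  field_simp
  linear_combination -h2

lemma diag_equiv (M : MM K) (hw : ∀ k l d, coeff d (M k l) ≠ 0 → ∀ i, wtJ (d, (k, l)) i = 0)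
    (g : Fin 4 → K) (hg : ∀ i, g i ≠ 0) (A B : Matrix (Fin 4) (Fin 4) K) :
    M.map (MvPolynomial.eval (pairSub (diagonal g * A * diagonal (fun i => (g i)⁻¹))
      (diagonal g * B * diagonal (fun i => (g i)⁻¹)))) =
    diagonal g * M.map (MvPolynomial.eval (pairSub A B)) * diagonal (fun i => (g i)⁻¹) := by
  have hs : ∀ v, pairSub (diagonal g * A * diagonal (fun i => (g i)⁻¹))
      (diagonal g * B * diagonal (fun i => (g i)⁻¹)) v = (g (vrow v) * (g (vcol v))⁻¹) * pairSub A B v := by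
    intro v
    rcases v with ⟨i, j⟩ | ⟨i, j⟩ <;> simp [pairSub, vrow, vcol] <;> ring
  ext k l
  simp only [Matrix.map_apply, Matrix.mul_diagonal, Matrix.diagonal_mul]
  rw [MvPolynomial.eval_eq', MvPolynomial.eval_eq', Finset.mul_sum, Finset.sum_mul]
  refine Finset.sum_congr rfl fun d hd => ?_
  simp only [hs, mul_pow (_ * _), Finset.prod_mul_distrib]
  have hc := chi_wt K g hg d k l (hw k l d (by simpa using hd))
  rw [hc]; ring

lemma ER_diag (i : Fin 4) (v : BI p q → K) (b : BI p q) :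
    (ER K p q i i *ᵥ v) b = (wtJ (toJ b) i : K) * v b := by
  simp only [Matrix.mulVec, dotProduct, ER, Ez, Matrix.map_apply, Matrix.of_apply, ez_diag]
  rw [Finset.sum_eq_single b]
  · simp
  · intro c _ hc
    rw [if_neg (fun h => hc (toJ_inj h).symm)]; simp
  · simp

variable [CharZero K]

def EqP (M : MM K) (T : Matrix (Fin 4) (Fin 4) K) : Prop := ∀ A B : Matrix (Fin 4) (Fin 4) K,
  M.map (MvPolynomial.eval (pairSub (T * A * T⁻¹) (T * B * T⁻¹))) =
    T * M.map (MvPolynomial.eval (pairSub A B)) * T⁻¹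

lemma EqP_mul (M : MM K) (T U : Matrix (Fin 4) (Fin 4) K) (hT : EqP K M T) (hU : EqP K M U) :
    EqP K M (T * U) := by
  intro A B
  have e : ∀ X : Matrix (Fin 4) (Fin 4) K, T * U * X * (T * U)⁻¹ = T * (U * X * U⁻¹) * T⁻¹ := by
    intro X; rw [Matrix.mul_inv_rev]; simp only [mul_assoc]
  rw [e, e, hT, hU, e]

lemma tv_inv (i j : Fin 4) (h : i ≠ j) (c : K) : (tv i j c)⁻¹ = tv i j (-c) :=
  Matrix.inv_eq_right_inv (by rw [tv_mul i j h]; simp [tv_zero])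

lemma lie_to_grp (M : MM K) (hM : HomM K p q M) (h : ∀ i j, Ll K i j M = 0) : IsMatEquivariant M := by
  obtain ⟨v, rfl⟩ : ∃ v, Phi K p q v = M := ⟨_, Phi_surj K p q M hM⟩
  have hv : ∀ i b, (wtJ (toJ b) i : K) * v b = 0 := by
    intro i b
    have := h i i
    rw [Ll_Phi] at this
    have h2 := Phi_inj K p q (this.trans (map_zero _).symm)
    rw [← ER_diag, h2]; rfl
  have hw : ∀ k l d, coeff d (Phi K p q v k l) ≠ 0 → ∀ i, wtJ (d, (k, l)) i = 0 := by
    intro k l d hd i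
    have hdd := Phi_hom K p q v k l hd
    have h3 := coeff_Phi K p q v (⟨d, hdd⟩, (k, l))
    have h4 := hv i (⟨d, hdd⟩, (k, l))
    rcases mul_eq_zero.1 h4 with h5 | h5
    · exact_mod_cast h5
    · exact absurd (h3.trans h5) hd
  have key : ∀ T : Matrix (Fin 4) (Fin 4) K, T.det ≠ 0 → EqP K (Phi K p q v) T := by
    intro T hT
    refine Matrix.diagonal_transvection_induction_of_det_ne_zero (EqP K (Phi K p q v)) T hT ?_ ?_ ?_
    · intro D hD A B
      have hg : ∀ i, D i ≠ 0 := by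
        rw [Matrix.det_diagonal] at hD
        intro i; exact Finset.prod_ne_zero_iff.1 hD i (Finset.mem_univ _)
      have : (diagonal D)⁻¹ = diagonal (fun i => (D i)⁻¹) := by
        apply Matrix.inv_eq_right_inv
        rw [Matrix.diagonal_mul_diagonal, ← Matrix.diagonal_one]
        congr 1; ext i; exact mul_inv_cancel₀ (hg i)
      rw [this]
      exact diag_equiv K _ hw D hg A B
    · intro t A B
      have h1 := (lie_iff K t.i t.j t.hij (Phi K p q v)).1 (h _ _) t.c A B
      have h2 : t.toMatrix = tv t.i t.j t.c := rfl
      rw [h2, tv_inv K t.i t.j t.hij]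
      exact h1
    · intro A B _ _ hA hB
      exact EqP_mul K _ A B hA hB
  intro a A B
  have hd : (a : Matrix (Fin 4) (Fin 4) K).det ≠ 0 := by
    have := (Matrix.isUnit_iff_isUnit_det _).1 a.isUnit
    exact this.ne_zero
  have := key a hd A B
  rw [← Matrix.coe_units_inv] at this
  exact this

lemma grp_to_lie (M : MM K) (hM : HomM K p q M) (h : IsMatEquivariant M) : ∀ i j, Ll K i j M = 0 := by
  have h1 : ∀ i j, i ≠ j → Ll K i j M = 0 := by
    intro i j hij
    rw [lie_iff K i j hij]
    intro c A B
    exact h ⟨tv i j c, tv i j (-c), by rw [tv_mul i j hij]; simp [tv_zero],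
      by rw [tv_mul i j hij]; simp [tv_zero]⟩ A B
  have h0 : ∀ i j, Ll K i j 0 = 0 := fun i j => (LlL K i j).map_zero
  have h2 : ∀ i j, Ll K i i M = Ll K j j M := by
    intro i j
    by_cases hij : i = j
    · rw [hij]
    have := Ll_comm K i j j i M
    rw [h1 i j hij, h1 j i (Ne.symm hij), h0, h0] at this
    simp only [if_true, sub_self] at this
    exact (sub_eq_zero.1 this.symm)
  intro i j
  by_cases hij : i = j
  swap
  · exact h1 i j hij
  subst hij
  obtain ⟨v, rfl⟩ : ∃ v, Phi K p q v = M := ⟨_, Phi_surj K p q M hM⟩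
  rw [Ll_Phi]
  suffices ER K p q i i *ᵥ v = 0 by rw [this, map_zero]
  have h3 : ∀ j, ER K p q i i *ᵥ v = ER K p q j j *ᵥ v := by
    intro j
    have := h2 i j
    rw [Ll_Phi, Ll_Phi] at this
    exact Phi_inj K p q this
  ext b
  have h4 : ∑ j, (ER K p q j j *ᵥ v) b = 0 := by
    simp only [ER_diag, ← Finset.sum_mul]
    have : (∑ j, (wtJ (toJ b) j : K)) = ((∑ j, wtJ (toJ b) j : ℤ) : K) := by push_cast; rfl
    rw [this, wtJ_sum]; simp
  simp only [← h3] at h4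
  simpa using h4

lemma ER_map (i j : Fin 4) : ER K p q i j = (ER ℚ p q i j).map (algebraMap ℚ K) := by
  ext b c; simp [ER]

theorem mixedDim_eq : 24 * (mixedDim K 4 p q : ℚ) =
    ctL (delta * deltab * ∑ b : BI p q, mono (wtJ (toJ b))) := by
  obtain ⟨P, A, hPP, hEP, hPA, htr⟩ := weyl_concrete p q
  rw [← htr]
  congr 1
  set PK := P.map (algebraMap ℚ K) with hPK
  have hPP' : PK * PK = PK := by
    rw [hPK, ← Matrix.map_mul, hPP]
  have hEP' : ∀ i j, ER K p q i j * PK = 0 := by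
    intro i j
    rw [ER_map, hPK, ← Matrix.map_mul, hEP]; simp
  have hfix : ∀ v : BI p q → K, (∀ i j, ER K p q i j *ᵥ v = 0) → PK *ᵥ v = v := by
    intro v hv
    have : PK = 1 - A.map (algebraMap ℚ K) * ∑ i, ∑ j, ER K p q i j * ER K p q j i := by
      rw [hPK, hPA]
      rw [show ∀ M : Matrix (BI p q) (BI p q) ℚ, M.map (algebraMap ℚ K) = (algebraMap ℚ K).mapMatrix M from fun _ => rfl]
      rw [map_sub, map_one, map_mul, map_sum]
      simp only [map_sum, map_mul]
      simp only [ER_map K]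
      rfl
    rw [this, Matrix.sub_mulVec, Matrix.one_mulVec, ← Matrix.mulVec_mulVec, Matrix.sum_mulVec]
    simp [Matrix.sum_mulVec, ← Matrix.mulVec_mulVec, hv]
  have hset : mixedComponent K 4 p q = ((LinearMap.range PK.mulVecLin).map (Phi K p q) : Set (MM K)) := by
    ext M
    constructor
    · rintro ⟨h1, h2⟩
      have h3 := grp_to_lie K p q M h2 h1
      obtain ⟨v, rfl⟩ : ∃ v, Phi K p q v = M := ⟨_, Phi_surj K p q M h2⟩
      refine ⟨v, ⟨v, ?_⟩, rfl⟩
      apply hfix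
      intro i j
      have := h3 i j
      rw [Ll_Phi] at this
      exact Phi_inj K p q (this.trans (map_zero _).symm)
    · rintro ⟨v, ⟨w, rfl⟩, rfl⟩
      refine ⟨lie_to_grp K p q _ (Phi_hom K p q _) ?_, Phi_hom K p q _⟩
      intro i j
      rw [Ll_Phi, Matrix.mulVecLin_apply, Matrix.mulVec_mulVec, hEP']; simp
  rw [mixedDim, hset, Set.finrank, Submodule.span_eq]
  have hfr := LinearEquiv.finrank_eq (Submodule.equivMapOfInjective (Phi K p q) (Phi_inj K p q)
    (LinearMap.range PK.mulVecLin))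
  rw [← hfr]
  have hproj : LinearMap.IsProj (LinearMap.range PK.mulVecLin) PK.mulVecLin := by
    constructor
    · intro x; exact ⟨x, rfl⟩
    · rintro _ ⟨w, rfl⟩
      simp only [Matrix.mulVecLin_apply, Matrix.mulVec_mulVec, hPP']
  have ht := hproj.trace
  have ht2 : LinearMap.trace K _ PK.mulVecLin = PK.trace := by
    have := Matrix.trace_toLin'_eq PK
    rwa [Matrix.toLin'_apply'] at this
  rw [ht2] at ht
  have ht3 : PK.trace = algebraMap ℚ K P.trace := by
    simp [hPK, Matrix.trace]
  rw [ht3] at ht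
  apply (algebraMap ℚ K).injective
  rw [ht]; simp
end grp

section c1

abbrev SS := MvPowerSeries (Fin 2) LL

def BsM (N : AddSubmonoid (Fin 4 → ℤ)) : Submodule ℚ LL := Submodule.span ℚ (mono '' N)

lemma BsM_mul (N : AddSubmonoid (Fin 4 → ℤ)) {a b : LL} (ha : a ∈ BsM N) (hb : b ∈ BsM N) : a * b ∈ BsM N := by
  have := Submodule.mul_mem_mul ha hb
  rw [BsM, Submodule.span_mul_span] at this
  refine Submodule.span_mono ?_ this
  rintro _ ⟨_, ⟨μ, hμ, rfl⟩, _, ⟨ν, hν, rfl⟩, rfl⟩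
  exact ⟨μ + ν, N.add_mem hμ hν, (mono_mul _ _).symm⟩

def Bs (N : AddSubmonoid (Fin 4 → ℤ)) : Subring LL where
  carrier := BsM N
  mul_mem' := BsM_mul N
  one_mem' := Submodule.subset_span ⟨0, N.zero_mem, rfl⟩
  add_mem' := (BsM N).add_mem
  zero_mem' := (BsM N).zero_mem
  neg_mem' := (BsM N).neg_mem

lemma mono_mem_Bs {N : AddSubmonoid (Fin 4 → ℤ)} {μ : Fin 4 → ℤ} (h : μ ∈ N) : mono μ ∈ Bs N :=
  Submodule.subset_span ⟨μ, h, rfl⟩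

def serR (B : Subring LL) : Subring SS where
  carrier := {f | ∀ n, MvPowerSeries.coeff n f ∈ B}
  mul_mem' := by
    intro a b ha hb n
    rw [MvPowerSeries.coeff_mul]
    exact B.sum_mem fun p _ => B.mul_mem (ha _) (hb _)
  one_mem' := by
    intro n; rw [MvPowerSeries.coeff_one]; split_ifs
    · exact B.one_mem
    · exact B.zero_mem
  add_mem' := by intro a b ha hb n; rw [map_add]; exact B.add_mem (ha n) (hb n)
  zero_mem' := by intro n; rw [map_zero]; exact B.zero_mem
  neg_mem' := by intro a ha n; rw [map_neg]; exact B.neg_mem (ha n)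

def JJi (a : SS) : SS := MvPowerSeries.invOfUnit (1 - a) 1

lemma JJi_mul {a : SS} (h : MvPowerSeries.constantCoeff a = 0) : (1 - a) * JJi a = 1 :=
  MvPowerSeries.mul_invOfUnit _ _ (by simp [h])

lemma JJi_mem {B : Subring LL} {a : SS} (ha : a ∈ serR B) : JJi a ∈ serR B := by
  have h1 : (1 - a) ∈ serR B := sub_mem (one_mem _) ha
  intro n
  induction n using WellFoundedLT.induction with
  | ind n ih =>
    rw [JJi, MvPowerSeries.coeff_invOfUnit]
    split_ifs
    · simpa using B.one_mem
    · refine B.mul_mem (by simpa using B.neg_mem B.one_mem) (B.sum_mem fun p _ => ?_)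
      split_ifs with h
      · exact B.mul_mem (h1 _) (ih _ h)
      · exact B.zero_mem

lemma JJi_uniq {a b : SS} (h : MvPowerSeries.constantCoeff a = 0) (hb : (1 - a) * b = 1) : b = JJi a := by
  have := JJi_mul h
  calc b = b * ((1 - a) * JJi a) := by rw [this, mul_one]
    _ = ((1 - a) * b) * JJi a := by ring
    _ = JJi a := by rw [hb, one_mul]

lemma JJi_map (φ : LL →+* LL) {a : SS} (h : MvPowerSeries.constantCoeff a = 0) :
    MvPowerSeries.map φ (JJi a) = JJi (MvPowerSeries.map φ a) := by
  apply JJi_uniq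
  · have := MvPowerSeries.constantCoeff_map φ a
    rw [this, h, map_zero]
  · rw [← map_one (MvPowerSeries.map φ), ← map_sub, ← map_mul, JJi_mul h]

/-! projection to weight zero -/
def piL (l : Fin 4) : LL →ₗ[ℚ] LL :=
  (Finsupp.lsum ℚ (fun μ : Fin 4 → ℤ => LinearMap.toSpanSingleton ℚ LL (if μ l = 0 then mono μ else 0))) ∘ₗ
    (AddMonoidAlgebra.coeffLinearEquiv ℚ).toLinearMap

lemma piL_mono (l : Fin 4) (μ : Fin 4 → ℤ) : piL l (mono μ) = if μ l = 0 then mono μ else 0 := by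
  simp [piL, mono]

def Nz (l : Fin 4) : AddSubmonoid (Fin 4 → ℤ) where
  carrier := {μ | μ l = 0}
  add_mem' := by intro a b ha hb; simp at *; omega
  zero_mem' := by simp
def Nge (l : Fin 4) : AddSubmonoid (Fin 4 → ℤ) where
  carrier := {μ | 0 ≤ μ l}
  add_mem' := by intro a b ha hb; simp at *; omega
  zero_mem' := by simp
def Nle (l : Fin 4) : AddSubmonoid (Fin 4 → ℤ) where
  carrier := {μ | μ l ≤ 0}
  add_mem' := by intro a b ha hb; simp at *; omega
  zero_mem' := by simp

lemma piL_mul (l : Fin 4) {a : LL} (ha : a ∈ Bs (Nz l)) (b : LL) : piL l (a * b) = a * piL l b := by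
  change a ∈ Submodule.span ℚ _ at ha
  induction ha using Submodule.span_induction with
  | mem x h =>
    obtain ⟨μ, hμ, rfl⟩ := h
    change μ l = 0 at hμ
    induction b using LL_induction with
    | h0 => simp
    | ha f g hf hg => simp only [mul_add, map_add, hf, hg]
    | hs ν c =>
      simp only [mul_smul_comm, map_smul, mono_mul, piL_mono]
      simp only [Pi.add_apply, hμ, zero_add]
      split_ifs
      · rw [mono_mul]
      · simp
  | zero => simp
  | add x y _ _ hx hy => simp only [add_mul, map_add, hx, hy]
  | smul c x _ hx => simp only [smul_mul_assoc, map_smul, hx]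

lemma piL_one (l : Fin 4) : piL l 1 = 1 := by rw [← mono_zero, piL_mono]; simp

lemma piL_pos (l : Fin 4) {a : LL} (ha : a ∈ Bs (Nge l)) (μ : Fin 4 → ℤ) (hμ : 0 < μ l) :
    piL l (mono μ * a) = 0 := by
  change a ∈ Submodule.span ℚ _ at ha
  induction ha using Submodule.span_induction with
  | mem x h =>
    obtain ⟨ν, hν, rfl⟩ := h
    change 0 ≤ ν l at hν
    rw [mono_mul, piL_mono, if_neg]
    simp only [Pi.add_apply]; omega
  | zero => simp
  | add x y _ _ hx hy => simp only [mul_add, map_add, hx, hy, add_zero]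
  | smul c x _ hx => simp only [mul_smul_comm, map_smul, hx, smul_zero]

lemma piL_neg (l : Fin 4) {a : LL} (ha : a ∈ Bs (Nle l)) (μ : Fin 4 → ℤ) (hμ : μ l < 0) :
    piL l (mono μ * a) = 0 := by
  change a ∈ Submodule.span ℚ _ at ha
  induction ha using Submodule.span_induction with
  | mem x h =>
    obtain ⟨ν, hν, rfl⟩ := h
    change ν l ≤ 0 at hν
    rw [mono_mul, piL_mono, if_neg]
    simp only [Pi.add_apply]; omega
  | zero => simp
  | add x y _ _ hx hy => simp only [mul_add, map_add, hx, hy, add_zero]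
  | smul c x _ hx => simp only [mul_smul_comm, map_smul, hx, smul_zero]

lemma ctL_piL (l : Fin 4) (a : LL) : ctL (piL l a) = ctL a := by
  have : ctL ∘ₗ piL l = ctL := by
    apply LL_ext
    intro μ
    simp only [LinearMap.comp_apply, piL_mono, ctL_mono]
    split_ifs with h1 h2 h2
    · subst h2; simp [ctL_mono]
    · simp [ctL_mono, h2]
    · subst h2; simp at h1
    · simp
  exact LinearMap.congr_fun this a

def piS (l : Fin 4) : SS →+ SS where
  toFun f := fun n => piL l (MvPowerSeries.coeff n f)
  map_zero' := by
    ext1 n; change piL l (MvPowerSeries.coeff n 0) = _; simp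
  map_add' f g := by
    ext1 n; change piL l (MvPowerSeries.coeff n (f + g)) = piL l (MvPowerSeries.coeff n f) + piL l (MvPowerSeries.coeff n g)
    simp

lemma coeff_piS (l : Fin 4) (f : SS) (n : Fin 2 →₀ ℕ) :
    MvPowerSeries.coeff n (piS l f) = piL l (MvPowerSeries.coeff n f) := rfl

lemma piS_mul (l : Fin 4) {a : SS} (ha : a ∈ serR (Bs (Nz l))) (b : SS) : piS l (a * b) = a * piS l b := by
  ext1 n
  rw [coeff_piS, MvPowerSeries.coeff_mul, MvPowerSeries.coeff_mul, map_sum]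
  refine Finset.sum_congr rfl fun p _ => ?_
  rw [piL_mul l (ha _), coeff_piS]

lemma piS_one (l : Fin 4) : piS l 1 = 1 := by
  ext1 n
  rw [coeff_piS, MvPowerSeries.coeff_one]
  split_ifs
  · exact piL_one l
  · simp

lemma piS_self (l : Fin 4) {a : SS} (ha : a ∈ serR (Bs (Nz l))) : piS l a = a := by
  have := piS_mul l ha 1
  rwa [piS_one, mul_one] at this

def cS : LL →+* SS := MvPowerSeries.C

lemma piS_pos (l : Fin 4) {a : SS} (ha : a ∈ serR (Bs (Nge l))) (μ : Fin 4 → ℤ) (hμ : 0 < μ l) :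
    piS l (cS (mono μ) * a) = 0 := by
  ext1 n
  rw [coeff_piS, cS, MvPowerSeries.coeff_C_mul, piL_pos l (ha _) μ hμ, map_zero]

lemma piS_neg (l : Fin 4) {a : SS} (ha : a ∈ serR (Bs (Nle l))) (μ : Fin 4 → ℤ) (hμ : μ l < 0) :
    piS l (cS (mono μ) * a) = 0 := by
  ext1 n
  rw [coeff_piS, cS, MvPowerSeries.coeff_C_mul, piL_neg l (ha _) μ hμ, map_zero]

lemma cS_mem {B : Subring LL} {a : LL} (h : a ∈ B) : cS a ∈ serR B := by
  intro n
  rw [cS, MvPowerSeries.coeff_C]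
  split_ifs
  · exact h
  · exact B.zero_mem

lemma X_mem (B : Subring LL) (i : Fin 2) : (MvPowerSeries.X i : SS) ∈ serR B := by
  intro n
  rw [MvPowerSeries.coeff_X]
  split_ifs
  · exact B.one_mem
  · exact B.zero_mem

lemma serR_mono {N N' : AddSubmonoid (Fin 4 → ℤ)} (h : N ≤ N') : serR (Bs N) ≤ serR (Bs N') := by
  intro f hf n
  exact Submodule.span_mono (Set.image_mono h) (hf n)

lemma Nz_le_ge (l : Fin 4) : Nz l ≤ Nge l := fun μ (h : μ l = 0) => show 0 ≤ μ l by omega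
lemma Nz_le_le (l : Fin 4) : Nz l ≤ Nle l := fun μ (h : μ l = 0) => show μ l ≤ 0 by omega

instance : IsDomain LL := inferInstanceAs (IsDomain (AddMonoidAlgebra ℚ (Fin 4 → ℤ)))
instance : NoZeroDivisors SS := inferInstance
end c1

section c2

def xS (i : Fin 4) : SS := cS (xx i)
def yS (i : Fin 4) : SS := cS (yy i)
def sS : SS := MvPowerSeries.X 0
def uS : SS := MvPowerSeries.X 1
def tS : SS := sS * uS

lemma xyS (i : Fin 4) : xS i * yS i = 1 := by
  rw [xS, yS, ← map_mul, xx_mul_yy, map_one]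

lemma ccs : MvPowerSeries.constantCoeff sS = 0 := by simp [sS]
lemma ccu : MvPowerSeries.constantCoeff uS = 0 := by simp [uS]
lemma cct : MvPowerSeries.constantCoeff tS = 0 := by simp [tS, ccs]

lemma xS_mem {l i : Fin 4} (h : i ≠ l) : xS i ∈ serR (Bs (Nz l)) := by
  apply cS_mem; apply mono_mem_Bs
  change (_ : Fin 4 → ℤ) l = 0
  simp [h.symm]
lemma yS_mem {l i : Fin 4} (h : i ≠ l) : yS i ∈ serR (Bs (Nz l)) := by
  apply cS_mem; apply mono_mem_Bs
  change (_ : Fin 4 → ℤ) l = 0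
  simp [h.symm]
lemma xS_memge {l : Fin 4} : xS l ∈ serR (Bs (Nge l)) := by
  apply cS_mem; apply mono_mem_Bs
  change 0 ≤ (_ : Fin 4 → ℤ) l
  simp
lemma yS_memle {l : Fin 4} : yS l ∈ serR (Bs (Nle l)) := by
  apply cS_mem; apply mono_mem_Bs
  change (_ : Fin 4 → ℤ) l ≤ 0
  simp
lemma sS_mem (B : Subring LL) : sS ∈ serR B := X_mem B 0
lemma uS_mem (B : Subring LL) : uS ∈ serR B := X_mem B 1
lemma tS_mem (B : Subring LL) : tS ∈ serR B := mul_mem (sS_mem B) (uS_mem B)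

lemma piS_x (l : Fin 4) {a : SS} (ha : a ∈ serR (Bs (Nge l))) : piS l (xS l * a) = 0 := by
  apply piS_pos l ha; simp
lemma piS_y (l : Fin 4) {a : SS} (ha : a ∈ serR (Bs (Nle l))) : piS l (yS l * a) = 0 := by
  apply piS_neg l ha; simp

def Cg (l : Fin 4) (b f γ : SS) : Prop := f ∈ serR (Bs (Nge l)) ∧ γ ∈ serR (Bs (Nz l)) ∧
  ∃ h ∈ serR (Bs (Nge l)), f - γ = (xS l - b) * h

lemma Cg_const {l : Fin 4} {b f : SS} (hf : f ∈ serR (Bs (Nz l))) : Cg l b f f :=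
  ⟨serR_mono (Nz_le_ge l) hf, hf, 0, zero_mem _, by simp⟩
lemma Cg_x {l i : Fin 4} {b : SS} (h : i ≠ l) : Cg l b (xS i) (xS i) := Cg_const (xS_mem h)
lemma Cg_y {l i : Fin 4} {b : SS} (h : i ≠ l) : Cg l b (yS i) (yS i) := Cg_const (yS_mem h)
lemma Cg_s {l : Fin 4} {b : SS} : Cg l b sS sS := Cg_const (sS_mem _)
lemma Cg_u {l : Fin 4} {b : SS} : Cg l b uS uS := Cg_const (uS_mem _)
lemma Cg_t {l : Fin 4} {b : SS} : Cg l b tS tS := Cg_const (tS_mem _)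
lemma Cg_one {l : Fin 4} {b : SS} : Cg l b 1 1 := Cg_const (one_mem _)
lemma Cg_var {l : Fin 4} {b : SS} (hb : b ∈ serR (Bs (Nz l))) : Cg l b (xS l) b :=
  ⟨xS_memge, hb, 1, one_mem _, by simp⟩
lemma Cg_add {l : Fin 4} {b f γ f' γ' : SS} (h : Cg l b f γ) (h' : Cg l b f' γ') : Cg l b (f + f') (γ + γ') := by
  obtain ⟨h1, h2, k, h3, h4⟩ := h
  obtain ⟨h1', h2', k', h3', h4'⟩ := h'
  exact ⟨add_mem h1 h1', add_mem h2 h2', k + k', add_mem h3 h3', by linear_combination h4 + h4'⟩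
lemma Cg_sub {l : Fin 4} {b f γ f' γ' : SS} (h : Cg l b f γ) (h' : Cg l b f' γ') : Cg l b (f - f') (γ - γ') := by
  obtain ⟨h1, h2, k, h3, h4⟩ := h
  obtain ⟨h1', h2', k', h3', h4'⟩ := h'
  exact ⟨sub_mem h1 h1', sub_mem h2 h2', k - k', sub_mem h3 h3', by linear_combination h4 - h4'⟩
lemma Cg_mul {l : Fin 4} {b f γ f' γ' : SS} (h : Cg l b f γ) (h' : Cg l b f' γ') : Cg l b (f * f') (γ * γ') := by
  obtain ⟨h1, h2, k, h3, h4⟩ := h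
  obtain ⟨h1', h2', k', h3', h4'⟩ := h'
  exact ⟨mul_mem h1 h1', mul_mem h2 h2', f * k' + γ' * k,
    add_mem (mul_mem h1 h3') (mul_mem (serR_mono (Nz_le_ge l) h2') h3), by
    linear_combination γ' * h4 + f * h4'⟩
lemma Cg_J {l : Fin 4} {b f γ : SS} (hf : MvPowerSeries.constantCoeff f = 0)
    (hγ : MvPowerSeries.constantCoeff γ = 0) (h : Cg l b f γ) : Cg l b (JJi f) (JJi γ) := by
  obtain ⟨h1, h2, k, h3, h4⟩ := h
  refine ⟨JJi_mem h1, JJi_mem h2, JJi f * JJi γ * k, mul_mem (mul_mem (JJi_mem h1)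
    (serR_mono (Nz_le_ge l) (JJi_mem h2))) h3, ?_⟩
  linear_combination JJi γ * JJi_mul hf - JJi f * JJi_mul hγ + JJi f * JJi γ * h4

lemma Cg_pow {l : Fin 4} {b f γ : SS} (h : Cg l b f γ) (n : ℕ) : Cg l b (f ^ n) (γ ^ n) := by
  induction n with
  | zero => simpa using Cg_one
  | succ n ih => rw [pow_succ, pow_succ]; exact Cg_mul ih h

lemma residue1 (l : Fin 4) {b G g γ : SS} (hb : b ∈ serR (Bs (Nz l)))
    (hb0 : MvPowerSeries.constantCoeff b = 0) (hG : G * (1 - b * yS l) = g) (hc : Cg l b g γ) :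
    piS l G = γ := by
  obtain ⟨h1, h2, k, h3, h4⟩ := hc
  have h5 : MvPowerSeries.constantCoeff (b * yS l) = 0 := by rw [map_mul, hb0, zero_mul]
  have h6 := JJi_mul h5
  have e : G = γ * (1 + yS l * (b * JJi (b * yS l))) + xS l * k := by
    linear_combination (-G + γ + xS l * k) * h6 + JJi (b * yS l) * (hG + h4) + k * b * JJi (b * yS l) * xyS l
  have hbl := serR_mono (Nz_le_le l) hb
  rw [e, map_add, piS_x l h3, add_zero, piS_mul l h2, map_add, piS_one, piS_y, add_zero, mul_one]
  exact mul_mem hbl (JJi_mem (mul_mem hbl yS_memle))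

def prmL (σ : Equiv.Perm (Fin 4)) : LL →+* LL :=
  AddMonoidAlgebra.mapDomainRingHom ℚ
    ({ toFun := fun m => m ∘ σ.symm, map_zero' := rfl, map_add' := fun _ _ => rfl } : (Fin 4 → ℤ) →+ (Fin 4 → ℤ))

lemma prmL_mono (σ : Equiv.Perm (Fin 4)) (μ : Fin 4 → ℤ) : prmL σ (mono μ) = mono (μ ∘ σ.symm) := by
  simp [prmL, mono]

lemma prmL_smul (σ : Equiv.Perm (Fin 4)) (c : ℚ) (a : LL) : prmL σ (c • a) = c • prmL σ a := by
  rw [Algebra.smul_def, Algebra.smul_def, map_mul]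
  congr 1
  rw [Algebra.algebraMap_eq_smul_one]
  simp [prmL, AddMonoidAlgebra.one_def]

lemma ctL_prmL (σ : Equiv.Perm (Fin 4)) (a : LL) : ctL (prmL σ a) = ctL a := by
  induction a using LL_induction with
  | h0 => simp
  | ha f g hf hg => simp only [map_add, hf, hg]
  | hs μ c =>
    rw [prmL_smul, map_smul, map_smul, prmL_mono, ctL_mono, ctL_mono]
    congr 2
    rw [eq_iff_iff]
    constructor
    · intro h; ext i; have := congrFun h (σ i); simpa using this
    · rintro rfl; rfl

lemma prmL_xx (σ : Equiv.Perm (Fin 4)) (i : Fin 4) : prmL σ (xx i) = xx (σ i) := by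
  rw [xx, prmL_mono, xx]
  congr 1; ext j
  simp only [Function.comp, Pi.single_apply, Equiv.symm_apply_eq]
lemma prmL_yy (σ : Equiv.Perm (Fin 4)) (i : Fin 4) : prmL σ (yy i) = yy (σ i) := by
  rw [yy, prmL_mono, yy]
  congr 1; ext j
  simp only [Function.comp, Pi.single_apply, Equiv.symm_apply_eq, Pi.neg_apply]

def prm (σ : Equiv.Perm (Fin 4)) : SS →+* SS := MvPowerSeries.map (prmL σ)

lemma prm_x (σ : Equiv.Perm (Fin 4)) (i : Fin 4) : prm σ (xS i) = xS (σ i) := by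
  simp [prm, xS, cS, prmL_xx]
lemma prm_y (σ : Equiv.Perm (Fin 4)) (i : Fin 4) : prm σ (yS i) = yS (σ i) := by
  simp [prm, yS, cS, prmL_yy]
lemma prm_s (σ : Equiv.Perm (Fin 4)) : prm σ sS = sS := by simp [prm, sS]
lemma prm_u (σ : Equiv.Perm (Fin 4)) : prm σ uS = uS := by simp [prm, uS]
lemma prm_t (σ : Equiv.Perm (Fin 4)) : prm σ tS = tS := by simp [tS, prm_s, prm_u]
lemma prm_J (σ : Equiv.Perm (Fin 4)) {a : SS} (h : MvPowerSeries.constantCoeff a = 0) :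
    prm σ (JJi a) = JJi (prm σ a) := JJi_map _ h

abbrev QQ := MvPowerSeries (Fin 2) ℚ

def ctS : SS →+ QQ where
  toFun f := fun n => ctL (MvPowerSeries.coeff n f)
  map_zero' := by
    ext1 n; change ctL (MvPowerSeries.coeff n 0) = _; simp
  map_add' f g := by
    ext1 n; change ctL (MvPowerSeries.coeff n (f + g)) = ctL (MvPowerSeries.coeff n f) + ctL (MvPowerSeries.coeff n g)
    simp

lemma coeff_ctS (f : SS) (n : Fin 2 →₀ ℕ) :
    MvPowerSeries.coeff n (ctS f) = ctL (MvPowerSeries.coeff n f) := rfl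

lemma ctS_prm (σ : Equiv.Perm (Fin 4)) (f : SS) : ctS (prm σ f) = ctS f := by
  ext1 n; rw [coeff_ctS, coeff_ctS, prm, MvPowerSeries.coeff_map, ctL_prmL]

lemma ctS_piS (l : Fin 4) (f : SS) : ctS (piS l f) = ctS f := by
  ext1 n; rw [coeff_ctS, coeff_ctS, coeff_piS, ctL_piL]

def emb : QQ →+* SS := MvPowerSeries.map (algebraMap ℚ LL)

lemma ctS_emb_mul (c : QQ) (f : SS) : ctS (emb c * f) = c * ctS f := by
  ext1 n
  rw [coeff_ctS, MvPowerSeries.coeff_mul, MvPowerSeries.coeff_mul, map_sum]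
  refine Finset.sum_congr rfl fun p _ => ?_
  rw [emb, MvPowerSeries.coeff_map, coeff_ctS, ← Algebra.smul_def, map_smul, smul_eq_mul]

lemma ctS_one : ctS 1 = 1 := by
  ext1 n
  rw [coeff_ctS, MvPowerSeries.coeff_one, MvPowerSeries.coeff_one]
  split_ifs
  · rw [← mono_zero, ctL_mono]; simp
  · simp

lemma ctS_emb (c : QQ) : ctS (emb c) = c := by
  have := ctS_emb_mul c 1
  rwa [mul_one, ctS_one, mul_one] at this

lemma emb_s : emb (MvPowerSeries.X 0) = sS := by simp [emb, sS]
lemma emb_u : emb (MvPowerSeries.X 1) = uS := by simp [emb, uS]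
end c2

section c3

/-! residue lemmas -/
lemma residue2 (l : Fin 4) {b1 b2 F g γ1 γ2 : SS}
    (m1 : b1 ∈ serR (Bs (Nz l))) (m2 : b2 ∈ serR (Bs (Nz l)))
    (z1 : MvPowerSeries.constantCoeff b1 = 0) (z2 : MvPowerSeries.constantCoeff b2 = 0)
    (hF : F = g * JJi (b1 * yS l) * JJi (b2 * yS l))
    (h1 : Cg l b1 g γ1) (h2 : Cg l b2 g γ2) :
    (b1 - b2) * piS l F = b1 * γ1 - b2 * γ2 := by
  have k1 := JJi_mul (a := b1 * yS l) (by rw [map_mul, z1, zero_mul])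
  have k2 := JJi_mul (a := b2 * yS l) (by rw [map_mul, z2, zero_mul])
  have r1 := residue1 l m1 z1 (G := g * JJi (b1 * yS l)) (g := g) (by linear_combination g * k1) h1
  have r2 := residue1 l m2 z2 (G := g * JJi (b2 * yS l)) (g := g) (by linear_combination g * k2) h2
  rw [← piS_mul l (sub_mem m1 m2), ← r1, ← r2, ← piS_mul l m1, ← piS_mul l m2, ← map_sub, hF]
  congr 1
  linear_combination (b1 * g * JJi (b1 * yS l)) * k2 - b2 * g * JJi (b2 * yS l) * k1

lemma residue3 (l : Fin 4) {b1 b2 b3 F g γ1 γ2 γ3 : SS}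
    (m1 : b1 ∈ serR (Bs (Nz l))) (m2 : b2 ∈ serR (Bs (Nz l))) (m3 : b3 ∈ serR (Bs (Nz l)))
    (z1 : MvPowerSeries.constantCoeff b1 = 0) (z2 : MvPowerSeries.constantCoeff b2 = 0)
    (z3 : MvPowerSeries.constantCoeff b3 = 0)
    (hF : F = g * JJi (b1 * yS l) * JJi (b2 * yS l) * JJi (b3 * yS l))
    (h1 : Cg l b1 g γ1) (h2 : Cg l b2 g γ2) (h3 : Cg l b3 g γ3) :
    (b1 - b2) * (b1 - b3) * (b2 - b3) * piS l F =
      b1 ^ 2 * (b2 - b3) * γ1 - b2 ^ 2 * (b1 - b3) * γ2 + b3 ^ 2 * (b1 - b2) * γ3 := by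
  have k1 := JJi_mul (a := b1 * yS l) (by rw [map_mul, z1, zero_mul])
  have k2 := JJi_mul (a := b2 * yS l) (by rw [map_mul, z2, zero_mul])
  have k3 := JJi_mul (a := b3 * yS l) (by rw [map_mul, z3, zero_mul])
  have r1 := residue1 l m1 z1 (G := g * JJi (b1 * yS l)) (g := g) (by linear_combination g * k1) h1
  have r2 := residue1 l m2 z2 (G := g * JJi (b2 * yS l)) (g := g) (by linear_combination g * k2) h2
  have r3 := residue1 l m3 z3 (G := g * JJi (b3 * yS l)) (g := g) (by linear_combination g * k3) h3
  rw [← piS_mul l (mul_mem (mul_mem (sub_mem m1 m2) (sub_mem m1 m3)) (sub_mem m2 m3)), ← r1, ← r2, ← r3,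
    ← piS_mul l (mul_mem (pow_mem m1 2) (sub_mem m2 m3)), ← piS_mul l (mul_mem (pow_mem m2 2) (sub_mem m1 m3)),
    ← piS_mul l (mul_mem (pow_mem m3 2) (sub_mem m1 m2)), ← map_sub, ← map_add]
  congr 1
  have e1 : g * JJi (b1 * yS l) = F * (1 - b2 * yS l) * (1 - b3 * yS l) := by
    rw [hF]
    calc _ = g * JJi (b1 * yS l) * 1 * 1 := by ring
      _ = g * JJi (b1 * yS l) * ((1 - b2 * yS l) * JJi (b2 * yS l)) * ((1 - b3 * yS l) * JJi (b3 * yS l)) := by rw [k2, k3]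
      _ = _ := by ring
  have e2 : g * JJi (b2 * yS l) = F * (1 - b1 * yS l) * (1 - b3 * yS l) := by
    rw [hF]
    calc _ = g * JJi (b2 * yS l) * 1 * 1 := by ring
      _ = g * JJi (b2 * yS l) * ((1 - b1 * yS l) * JJi (b1 * yS l)) * ((1 - b3 * yS l) * JJi (b3 * yS l)) := by rw [k1, k3]
      _ = _ := by ring
  have e3 : g * JJi (b3 * yS l) = F * (1 - b1 * yS l) * (1 - b2 * yS l) := by
    rw [hF]
    calc _ = g * JJi (b3 * yS l) * 1 * 1 := by ring
      _ = g * JJi (b3 * yS l) * ((1 - b1 * yS l) * JJi (b1 * yS l)) * ((1 - b2 * yS l) * JJi (b2 * yS l)) := by rw [k1, k2]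
      _ = _ := by ring
  rw [e1, e2, e3]; ring

lemma residue4 (l : Fin 4) {b1 b2 b3 b4 F g γ1 γ2 γ3 γ4 : SS}
    (m1 : b1 ∈ serR (Bs (Nz l))) (m2 : b2 ∈ serR (Bs (Nz l))) (m3 : b3 ∈ serR (Bs (Nz l))) (m4 : b4 ∈ serR (Bs (Nz l)))
    (z1 : MvPowerSeries.constantCoeff b1 = 0) (z2 : MvPowerSeries.constantCoeff b2 = 0)
    (z3 : MvPowerSeries.constantCoeff b3 = 0) (z4 : MvPowerSeries.constantCoeff b4 = 0)
    (hF : F = g * JJi (b1 * yS l) * JJi (b2 * yS l) * JJi (b3 * yS l) * JJi (b4 * yS l))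
    (h1 : Cg l b1 g γ1) (h2 : Cg l b2 g γ2) (h3 : Cg l b3 g γ3) (h4 : Cg l b4 g γ4) :
    (b1 - b2) * (b1 - b3) * (b1 - b4) * (b2 - b3) * (b2 - b4) * (b3 - b4) * piS l F =
      (b2 - b3) * (b2 - b4) * (b3 - b4) * (b1 ^ 3 * γ1) - (b1 - b3) * (b1 - b4) * (b3 - b4) * (b2 ^ 3 * γ2) +
      (b1 - b2) * (b1 - b4) * (b2 - b4) * (b3 ^ 3 * γ3) - (b1 - b2) * (b1 - b3) * (b2 - b3) * (b4 ^ 3 * γ4) := by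
  have k1 := JJi_mul (a := b1 * yS l) (by rw [map_mul, z1, zero_mul])
  have k2 := JJi_mul (a := b2 * yS l) (by rw [map_mul, z2, zero_mul])
  have k3 := JJi_mul (a := b3 * yS l) (by rw [map_mul, z3, zero_mul])
  have k4 := JJi_mul (a := b4 * yS l) (by rw [map_mul, z4, zero_mul])
  have r1 := residue1 l m1 z1 (G := g * JJi (b1 * yS l)) (g := g) (by linear_combination g * k1) h1
  have r2 := residue1 l m2 z2 (G := g * JJi (b2 * yS l)) (g := g) (by linear_combination g * k2) h2
  have r3 := residue1 l m3 z3 (G := g * JJi (b3 * yS l)) (g := g) (by linear_combination g * k3) h3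
  have r4 := residue1 l m4 z4 (G := g * JJi (b4 * yS l)) (g := g) (by linear_combination g * k4) h4
  have m12 := sub_mem m1 m2
  have m13 := sub_mem m1 m3
  have m14 := sub_mem m1 m4
  have m23 := sub_mem m2 m3
  have m24 := sub_mem m2 m4
  have m34 := sub_mem m3 m4
  rw [← piS_mul l (mul_mem (mul_mem (mul_mem (mul_mem (mul_mem m12 m13) m14) m23) m24) m34), ← r1, ← r2, ← r3, ← r4,
    ← piS_mul l (pow_mem m1 3), ← piS_mul l (pow_mem m2 3), ← piS_mul l (pow_mem m3 3), ← piS_mul l (pow_mem m4 3),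
    ← piS_mul l (mul_mem (mul_mem m23 m24) m34), ← piS_mul l (mul_mem (mul_mem m13 m14) m34),
    ← piS_mul l (mul_mem (mul_mem m12 m14) m24), ← piS_mul l (mul_mem (mul_mem m12 m13) m23),
    ← map_sub, ← map_add, ← map_sub]
  congr 1
  have e1 : g * JJi (b1 * yS l) = F * (1 - b2 * yS l) * (1 - b3 * yS l) * (1 - b4 * yS l) := by
    rw [hF]
    calc _ = g * JJi (b1 * yS l) * 1 * 1 * 1 := by ring
      _ = g * JJi (b1 * yS l) * ((1 - b2 * yS l) * JJi (b2 * yS l)) * ((1 - b3 * yS l) * JJi (b3 * yS l))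
        * ((1 - b4 * yS l) * JJi (b4 * yS l)) := by rw [k2, k3, k4]
      _ = _ := by ring
  have e2 : g * JJi (b2 * yS l) = F * (1 - b1 * yS l) * (1 - b3 * yS l) * (1 - b4 * yS l) := by
    rw [hF]
    calc _ = g * JJi (b2 * yS l) * 1 * 1 * 1 := by ring
      _ = g * JJi (b2 * yS l) * ((1 - b1 * yS l) * JJi (b1 * yS l)) * ((1 - b3 * yS l) * JJi (b3 * yS l))
        * ((1 - b4 * yS l) * JJi (b4 * yS l)) := by rw [k1, k3, k4]
      _ = _ := by ring
  have e3 : g * JJi (b3 * yS l) = F * (1 - b1 * yS l) * (1 - b2 * yS l) * (1 - b4 * yS l) := by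
    rw [hF]
    calc _ = g * JJi (b3 * yS l) * 1 * 1 * 1 := by ring
      _ = g * JJi (b3 * yS l) * ((1 - b1 * yS l) * JJi (b1 * yS l)) * ((1 - b2 * yS l) * JJi (b2 * yS l))
        * ((1 - b4 * yS l) * JJi (b4 * yS l)) := by rw [k1, k2, k4]
      _ = _ := by ring
  have e4 : g * JJi (b4 * yS l) = F * (1 - b1 * yS l) * (1 - b2 * yS l) * (1 - b3 * yS l) := by
    rw [hF]
    calc _ = g * JJi (b4 * yS l) * 1 * 1 * 1 := by ring
      _ = g * JJi (b4 * yS l) * ((1 - b1 * yS l) * JJi (b1 * yS l)) * ((1 - b2 * yS l) * JJi (b2 * yS l))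
        * ((1 - b3 * yS l) * JJi (b3 * yS l)) := by rw [k1, k2, k3]
      _ = _ := by ring
  rw [e1, e2, e3, e4]; ring

lemma residue3' (l : Fin 4) {b1 b2 b3 F g γ1 γ2 γ3 G1 G2 G3 : SS}
    (m1 : b1 ∈ serR (Bs (Nz l))) (m2 : b2 ∈ serR (Bs (Nz l))) (m3 : b3 ∈ serR (Bs (Nz l)))
    (z1 : MvPowerSeries.constantCoeff b1 = 0) (z2 : MvPowerSeries.constantCoeff b2 = 0)
    (z3 : MvPowerSeries.constantCoeff b3 = 0)
    (hF : F = g * JJi (b1 * yS l) * JJi (b2 * yS l) * JJi (b3 * yS l))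
    (h1 : Cg l b1 g γ1) (h2 : Cg l b2 g γ2) (h3 : Cg l b3 g γ3)
    (n12 : b1 - b2 ≠ 0) (n13 : b1 - b3 ≠ 0) (n23 : b2 - b3 ≠ 0)
    (q1 : b1 ^ 2 * γ1 = (b1 - b2) * (b1 - b3) * G1) (q2 : b2 ^ 2 * γ2 = (b2 - b1) * (b2 - b3) * G2)
    (q3 : b3 ^ 2 * γ3 = (b3 - b1) * (b3 - b2) * G3) :
    piS l F = G1 + G2 + G3 := by
  have := residue3 l m1 m2 m3 z1 z2 z3 hF h1 h2 h3
  apply mul_left_cancel₀ (mul_ne_zero (mul_ne_zero n12 n13) n23)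
  rw [this]
  linear_combination (b2 - b3) * q1 - (b1 - b3) * q2 + (b1 - b2) * q3

lemma residue4' (l : Fin 4) {b1 b2 b3 b4 F g γ1 γ2 γ3 γ4 G1 G2 G3 G4 : SS}
    (m1 : b1 ∈ serR (Bs (Nz l))) (m2 : b2 ∈ serR (Bs (Nz l))) (m3 : b3 ∈ serR (Bs (Nz l))) (m4 : b4 ∈ serR (Bs (Nz l)))
    (z1 : MvPowerSeries.constantCoeff b1 = 0) (z2 : MvPowerSeries.constantCoeff b2 = 0)
    (z3 : MvPowerSeries.constantCoeff b3 = 0) (z4 : MvPowerSeries.constantCoeff b4 = 0)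
    (hF : F = g * JJi (b1 * yS l) * JJi (b2 * yS l) * JJi (b3 * yS l) * JJi (b4 * yS l))
    (h1 : Cg l b1 g γ1) (h2 : Cg l b2 g γ2) (h3 : Cg l b3 g γ3) (h4 : Cg l b4 g γ4)
    (n12 : b1 - b2 ≠ 0) (n13 : b1 - b3 ≠ 0) (n14 : b1 - b4 ≠ 0) (n23 : b2 - b3 ≠ 0) (n24 : b2 - b4 ≠ 0)
    (n34 : b3 - b4 ≠ 0)
    (q1 : b1 ^ 3 * γ1 = (b1 - b2) * (b1 - b3) * (b1 - b4) * G1)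
    (q2 : b2 ^ 3 * γ2 = (b2 - b1) * (b2 - b3) * (b2 - b4) * G2)
    (q3 : b3 ^ 3 * γ3 = (b3 - b4) * (b3 - b1) * (b3 - b2) * G3)
    (q4 : b4 ^ 3 * γ4 = (b4 - b3) * (b4 - b1) * (b4 - b2) * G4) :
    piS l F = G1 + G2 + G3 + G4 := by
  have := residue4 l m1 m2 m3 m4 z1 z2 z3 z4 hF h1 h2 h3 h4
  apply mul_left_cancel₀ (mul_ne_zero (mul_ne_zero (mul_ne_zero (mul_ne_zero (mul_ne_zero n12 n13) n14) n23) n24) n34)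
  rw [this, q1, q2, q3, q4]
  ring
end c3

section c4

structure IsK (κ : SS) : Prop where
  mem : ∀ l, κ ∈ serR (Bs (Nz l))
  inv : ∀ σ, prm σ κ = κ

lemma IsK.mul {a b : SS} (ha : IsK a) (hb : IsK b) : IsK (a * b) :=
  ⟨fun l => mul_mem (ha.mem l) (hb.mem l), fun σ => by rw [map_mul, ha.inv, hb.inv]⟩
lemma IsK.sub {a b : SS} (ha : IsK a) (hb : IsK b) : IsK (a - b) :=
  ⟨fun l => sub_mem (ha.mem l) (hb.mem l), fun σ => by rw [map_sub, ha.inv, hb.inv]⟩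
lemma IsK.pow {a : SS} (ha : IsK a) (n : ℕ) : IsK (a ^ n) :=
  ⟨fun l => pow_mem (ha.mem l) n, fun σ => by rw [map_pow, ha.inv]⟩
lemma IsK.J {a : SS} (ha : IsK a) (h : MvPowerSeries.constantCoeff a = 0) : IsK (JJi a) :=
  ⟨fun l => JJi_mem (ha.mem l), fun σ => by rw [prm_J σ h, ha.inv]⟩
lemma IsK.one : IsK 1 := ⟨fun _ => one_mem _, fun _ => map_one _⟩
lemma IsK.s : IsK sS := ⟨fun _ => sS_mem _, prm_s⟩
lemma IsK.u : IsK uS := ⟨fun _ => uS_mem _, prm_u⟩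
lemma IsK.t : IsK tS := ⟨fun _ => tS_mem _, prm_t⟩

def dS (a b : SS) : SS := 1 - a * b
def jj (c a b : SS) : SS := JJi (c * a * b)

lemma jj_mul {c : SS} (h : MvPowerSeries.constantCoeff c = 0) (a b : SS) : dS (c * a) b * jj c a b = 1 := by
  rw [dS, jj]; exact JJi_mul (by simp [h])

lemma prm_d (σ : Equiv.Perm (Fin 4)) (a b : SS) : prm σ (dS a b) = dS (prm σ a) (prm σ b) := by
  simp [dS]
lemma prm_jj (σ : Equiv.Perm (Fin 4)) {c : SS} (h : MvPowerSeries.constantCoeff c = 0) (a b : SS) :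
    prm σ (jj c a b) = jj (prm σ c) (prm σ a) (prm σ b) := by
  rw [jj, prm_J _ (by simp [h]), map_mul, map_mul, jj]

lemma prm_jjs (σ : Equiv.Perm (Fin 4)) (a b : SS) : prm σ (jj sS a b) = jj sS (prm σ a) (prm σ b) := by
  rw [prm_jj σ ccs, prm_s]
lemma prm_jjt (σ : Equiv.Perm (Fin 4)) (a b : SS) : prm σ (jj tS a b) = jj tS (prm σ a) (prm σ b) := by
  rw [prm_jj σ cct, prm_t]
lemma prm_jju (σ : Equiv.Perm (Fin 4)) (a b : SS) : prm σ (jj uS a b) = jj uS (prm σ a) (prm σ b) := by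
  rw [prm_jj σ ccu, prm_u]

/-- column products -/
def colP (f : SS → SS → SS) (b : Fin 4) : SS := ∏ a, if a = b then 1 else f (xS a) (yS b)

lemma prm_colP (σ : Equiv.Perm (Fin 4)) (f : SS → SS → SS)
    (hf : ∀ a b, prm σ (f a b) = f (prm σ a) (prm σ b)) (b : Fin 4) : prm σ (colP f b) = colP f (σ b) := by
  rw [colP, map_prod, colP]
  refine Fintype.prod_equiv σ _ _ fun a => ?_
  simp only [σ.injective.eq_iff]
  split_ifs
  · simp
  · rw [hf, prm_x, prm_y]

def ebar : SS := ∑ i, yS i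
lemma prm_ebar (σ : Equiv.Perm (Fin 4)) : prm σ ebar = ebar := by
  rw [ebar, map_sum, ← Equiv.sum_comp σ yS]
  simp only [prm_y]

def T0 (κ : SS) (i : Fin 4) : SS := κ * ebar * (xS i * ∏ b, if b = i then colP (jj tS) b else
  colP dS b * colP (jj sS) b * colP (jj tS) b)

lemma prm_T0 (σ : Equiv.Perm (Fin 4)) {κ : SS} (hκ : IsK κ) (i : Fin 4) : prm σ (T0 κ i) = T0 κ (σ i) := by
  rw [T0, T0, map_mul, map_mul, map_mul, hκ.inv, prm_ebar, prm_x, map_prod]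
  refine congrArg (fun z => κ * ebar * (xS (σ i) * z)) ?_
  refine Fintype.prod_equiv σ _ _ fun b => ?_
  simp only [σ.injective.eq_iff]
  split_ifs
  · rw [prm_colP σ _ (prm_jjt σ)]
  · rw [map_mul, map_mul, prm_colP σ _ (prm_jjt σ), prm_colP σ _ (prm_jjs σ), prm_colP σ _ (prm_d σ)]

def E0 (κ : SS) : SS := κ * ebar * ((∑ i, xS i) * ∏ b, (colP dS b * colP (jj sS) b * colP (jj tS) b))

lemma HL_poly {R : Type*} [CommRing R] (x0 x1 x2 x3 s : R) :
    (x0 + x1 + x2 + x3) * ((x0-x1)*(x0-x2)*(x0-x3)*(x1-x2)*(x1-x3)*(x2-x3)) =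
    x0 * ((x0 - s*x1)*(x0-s*x2)*(x0-s*x3)) * ((x1-x2)*(x1-x3)*(x2-x3))
    - x1 * ((x1 - s*x0)*(x1-s*x2)*(x1-s*x3)) * ((x0-x2)*(x0-x3)*(x2-x3))
    + x2 * ((x2 - s*x0)*(x2-s*x1)*(x2-s*x3)) * ((x0-x1)*(x0-x3)*(x1-x3))
    - x3 * ((x3 - s*x0)*(x3-s*x1)*(x3-s*x2)) * ((x0-x1)*(x0-x2)*(x1-x2)) := by ring

lemma HL_abs {R : Type*} [CommRing R] (x0 x1 x2 x3 y0 y1 y2 y3 s : R) (h0 : x0 * y0 = 1) (h1 : x1 * y1 = 1)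
    (h2 : x2 * y2 = 1) (h3 : x3 * y3 = 1) :
    (x0 + x1 + x2 + x3) * (((1-x1*y0)*(1-x2*y0)*(1-x3*y0))*((1-x0*y1)*(1-x2*y1)*(1-x3*y1))*
      ((1-x0*y2)*(1-x1*y2)*(1-x3*y2))*((1-x0*y3)*(1-x1*y3)*(1-x2*y3))) =
    x0 * (((1-s*x1*y0)*(1-s*x2*y0)*(1-s*x3*y0))*((1-x0*y1)*(1-x2*y1)*(1-x3*y1))*
      ((1-x0*y2)*(1-x1*y2)*(1-x3*y2))*((1-x0*y3)*(1-x1*y3)*(1-x2*y3))) +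
    x1 * (((1-x1*y0)*(1-x2*y0)*(1-x3*y0))*((1-s*x0*y1)*(1-s*x2*y1)*(1-s*x3*y1))*
      ((1-x0*y2)*(1-x1*y2)*(1-x3*y2))*((1-x0*y3)*(1-x1*y3)*(1-x2*y3))) +
    x2 * (((1-x1*y0)*(1-x2*y0)*(1-x3*y0))*((1-x0*y1)*(1-x2*y1)*(1-x3*y1))*
      ((1-s*x0*y2)*(1-s*x1*y2)*(1-s*x3*y2))*((1-x0*y3)*(1-x1*y3)*(1-x2*y3))) +
    x3 * (((1-x1*y0)*(1-x2*y0)*(1-x3*y0))*((1-x0*y1)*(1-x2*y1)*(1-x3*y1))*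
      ((1-x0*y2)*(1-x1*y2)*(1-x3*y2))*((1-s*x0*y3)*(1-s*x1*y3)*(1-s*x2*y3))) := by
  have key := HL_poly x0 x1 x2 x3 s
  have d : ∀ a b y : R, a * y = 1 → 1 - b * y = y * (a - b) := fun a b y h => by linear_combination -h
  have d' : ∀ a b y : R, a * y = 1 → 1 - s * b * y = y * (a - s * b) := fun a b y h => by linear_combination -h
  rw [d x0 x1 y0 h0, d x0 x2 y0 h0, d x0 x3 y0 h0, d x1 x0 y1 h1, d x1 x2 y1 h1, d x1 x3 y1 h1,
    d x2 x0 y2 h2, d x2 x1 y2 h2, d x2 x3 y2 h2, d x3 x0 y3 h3, d x3 x1 y3 h3, d x3 x2 y3 h3,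
    d' x0 x1 y0 h0, d' x0 x2 y0 h0, d' x0 x3 y0 h0, d' x1 x0 y1 h1, d' x1 x2 y1 h1, d' x1 x3 y1 h1,
    d' x2 x0 y2 h2, d' x2 x1 y2 h2, d' x2 x3 y2 h2, d' x3 x0 y3 h3, d' x3 x1 y3 h3, d' x3 x2 y3 h3]
  rw [← neg_sub x0 x1, ← neg_sub x0 x2, ← neg_sub x0 x3, ← neg_sub x1 x2, ← neg_sub x1 x3, ← neg_sub x2 x3]
  have e : ∀ y a b c : R, (y * a) * (y * b) * (y * c) = y ^ 3 * (a * b * c) := by intros; ring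
  simp only [e]
  generalize x0 - x1 = a01 at *
  generalize x0 - x2 = a02 at *
  generalize x0 - x3 = a03 at *
  generalize x1 - x2 = a12 at *
  generalize x1 - x3 = a13 at *
  generalize x2 - x3 = a23 at *
  generalize (x0 - s*x1)*(x0-s*x2)*(x0-s*x3) = q0 at *
  generalize (x1 - s*x0)*(x1-s*x2)*(x1-s*x3) = q1 at *
  generalize (x2 - s*x0)*(x2-s*x1)*(x2-s*x3) = q2 at *
  generalize (x3 - s*x0)*(x3-s*x1)*(x3-s*x2) = q3 at *
  linear_combination (y0^3*y1^3*y2^3*y3^3*(a01*a02*a03*a12*a13*a23)) * key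

lemma colP_0 (f : SS → SS → SS) : colP f 0 = f (xS 1) (yS 0) * f (xS 2) (yS 0) * f (xS 3) (yS 0) := by
  simp [colP, Fin.prod_univ_four]
lemma colP_1 (f : SS → SS → SS) : colP f 1 = f (xS 0) (yS 1) * f (xS 2) (yS 1) * f (xS 3) (yS 1) := by
  simp [colP, Fin.prod_univ_four]
lemma colP_2 (f : SS → SS → SS) : colP f 2 = f (xS 0) (yS 2) * f (xS 1) (yS 2) * f (xS 3) (yS 2) := by
  simp [colP, Fin.prod_univ_four]
lemma colP_3 (f : SS → SS → SS) : colP f 3 = f (xS 0) (yS 3) * f (xS 1) (yS 3) * f (xS 2) (yS 3) := by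
  simp [colP, Fin.prod_univ_four]

lemma colP_mul (b : Fin 4) : colP (fun x y => dS (sS * x) y) b * colP (jj sS) b = 1 := by
  rw [colP, colP, ← Finset.prod_mul_distrib]
  apply Finset.prod_eq_one
  intro a _
  split_ifs
  · simp
  · exact jj_mul ccs _ _

lemma E0_eq (κ : SS) : E0 κ = T0 κ 0 + T0 κ 1 + T0 κ 2 + T0 κ 3 := by
  have h := HL_abs (xS 0) (xS 1) (xS 2) (xS 3) (yS 0) (yS 1) (yS 2) (yS 3) sS (xyS 0) (xyS 1) (xyS 2) (xyS 3)
  have h' : (xS 0 + xS 1 + xS 2 + xS 3) * (colP dS 0 * colP dS 1 * colP dS 2 * colP dS 3) =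
    xS 0 * (colP (fun x y => dS (sS * x) y) 0 * colP dS 1 * colP dS 2 * colP dS 3) +
    xS 1 * (colP dS 0 * colP (fun x y => dS (sS * x) y) 1 * colP dS 2 * colP dS 3) +
    xS 2 * (colP dS 0 * colP dS 1 * colP (fun x y => dS (sS * x) y) 2 * colP dS 3) +
    xS 3 * (colP dS 0 * colP dS 1 * colP dS 2 * colP (fun x y => dS (sS * x) y) 3) := by
    simp only [colP_0, colP_1, colP_2, colP_3, dS]
    exact h
  have k0 := colP_mul 0
  have k1 := colP_mul 1
  have k2 := colP_mul 2
  have k3 := colP_mul 3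
  simp only [E0, T0, Fin.prod_univ_four, Fin.sum_univ_four]
  simp only [Fin.reduceEq, if_true, if_false]
  generalize colP (fun x y => dS (sS * x) y) 0 = D0 at *
  generalize colP (fun x y => dS (sS * x) y) 1 = D1 at *
  generalize colP (fun x y => dS (sS * x) y) 2 = D2 at *
  generalize colP (fun x y => dS (sS * x) y) 3 = D3 at *
  generalize colP (jj sS) 0 = A0 at *
  generalize colP (jj sS) 1 = A1 at *
  generalize colP (jj sS) 2 = A2 at *
  generalize colP (jj sS) 3 = A3 at *
  generalize colP (jj tS) 0 = B0 at *
  generalize colP (jj tS) 1 = B1 at *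
  generalize colP (jj tS) 2 = B2 at *
  generalize colP (jj tS) 3 = B3 at *
  generalize colP dS 0 = P0 at *
  generalize colP dS 1 = P1 at *
  generalize colP dS 2 = P2 at *
  generalize colP dS 3 = P3 at *
  linear_combination κ * ebar * (A0*A1*A2*A3*B0*B1*B2*B3) * h' + 
    κ * ebar * xS 0 * B0*B1*B2*B3*P1*P2*P3*A1*A2*A3 * k0 + κ * ebar * xS 1 * B0*B1*B2*B3*P0*P2*P3*A0*A2*A3 * k1
    + κ * ebar * xS 2 * B0*B1*B2*B3*P1*P0*P3*A1*A0*A3 * k2 + κ * ebar * xS 3 * B0*B1*B2*B3*P1*P2*P0*A1*A2*A0 * k3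

lemma ct_E0 {κ : SS} (hκ : IsK κ) : ctS (E0 κ) = 4 * ctS (T0 κ 0) := by
  have h : ∀ i, ctS (T0 κ i) = ctS (T0 κ 0) := by
    intro i
    rw [← ctS_prm (Equiv.swap 0 i) (T0 κ 0), prm_T0 _ hκ, Equiv.swap_apply_left]
  rw [E0_eq, map_add, map_add, map_add, h 1, h 2, h 3]; ring
end c4

section c5

lemma Cg_d {l : Fin 4} {p a b α β : SS} (ha : Cg l p a α) (hb : Cg l p b β) : Cg l p (dS a b) (dS α β) :=
  Cg_sub Cg_one (Cg_mul ha hb)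
lemma Cg_jj {l : Fin 4} {p c a b α β : SS} (hc : MvPowerSeries.constantCoeff c = 0) (h : Cg l p c c)
    (ha : Cg l p a α) (hb : Cg l p b β) : Cg l p (jj c a b) (jj c α β) :=
  Cg_J (by simp [hc]) (by simp [hc]) (Cg_mul (Cg_mul h ha) hb)
lemma Cg_jjs {l : Fin 4} {p a b α β : SS} (ha : Cg l p a α) (hb : Cg l p b β) :
    Cg l p (jj sS a b) (jj sS α β) := Cg_jj ccs Cg_s ha hb
lemma Cg_jjt {l : Fin 4} {p a b α β : SS} (ha : Cg l p a α) (hb : Cg l p b β) :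
    Cg l p (jj tS a b) (jj tS α β) := Cg_jj cct Cg_t ha hb
lemma Cg_jju {l : Fin 4} {p a b α β : SS} (ha : Cg l p a α) (hb : Cg l p b β) :
    Cg l p (jj uS a b) (jj uS α β) := Cg_jj ccu Cg_u ha hb
lemma Cg_K {l : Fin 4} {p κ : SS} (h : IsK κ) : Cg l p κ κ := Cg_const (h.mem l)

lemma X_ne_z (i : Fin 2) : (MvPowerSeries.X i : SS) ≠ 0 := by
  intro h
  have := congrArg (MvPowerSeries.coeff (Finsupp.single i 1)) h
  rw [MvPowerSeries.coeff_index_single_self_X, map_zero] at this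
  exact one_ne_zero this
lemma sS_ne : sS ≠ 0 := X_ne_z 0
lemma uS_ne : uS ≠ 0 := X_ne_z 1
lemma tS_ne : tS ≠ 0 := mul_ne_zero sS_ne uS_ne
lemma xS_ne (i : Fin 4) : xS i ≠ 0 := left_ne_zero_of_mul_eq_one (xyS i)
lemma cc_x (i : Fin 4) : MvPowerSeries.constantCoeff (xS i) = xx i := by simp [xS, cS]
lemma xx_inj {i j : Fin 4} (h : i ≠ j) : xx i - xx j ≠ 0 := by
  intro e
  rw [sub_eq_zero] at e
  have e2 : mono 0 = mono (Pi.single j 1 - Pi.single i 1) := by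
    have := congrArg (· * yy i) e
    simp only [xx_mul_yy] at this
    rw [mono_zero, this, xx, yy, mono_mul]
    congr 1
  have e3 := congrArg ctL e2
  rw [ctL_mono, ctL_mono, if_pos rfl, if_neg] at e3
  · exact one_ne_zero e3
  · intro h0
    have := congrFun h0 i
    simp [h] at this
lemma xS_sub_ne {i j : Fin 4} (h : i ≠ j) : xS i - xS j ≠ 0 := by
  intro e
  apply xx_inj h
  have := congrArg MvPowerSeries.constantCoeff e
  rwa [map_sub, cc_x, cc_x, map_zero] at this
lemma nz_c {c : SS} (hc : c ≠ 0) {i j : Fin 4} (h : i ≠ j) : c * xS i - c * xS j ≠ 0 := by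
  rw [← mul_sub]; exact mul_ne_zero hc (xS_sub_ne h)
lemma xx_ne (i : Fin 4) : xx i ≠ 0 := by
  intro h
  have := xx_mul_yy i
  rw [h, zero_mul] at this
  exact zero_ne_one this
lemma nz_st (i j : Fin 4) : sS * xS i - tS * xS j ≠ 0 := by
  have : sS * xS i - tS * xS j = sS * (xS i - uS * xS j) := by rw [tS]; ring
  rw [this]
  refine mul_ne_zero sS_ne fun e => xx_ne i ?_
  have := congrArg MvPowerSeries.constantCoeff e
  rwa [map_sub, map_mul, ccu, zero_mul, sub_zero, cc_x, map_zero] at this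
lemma nz_ts (i j : Fin 4) : tS * xS i - sS * xS j ≠ 0 := by
  rw [← neg_sub, neg_ne_zero]; exact nz_st j i

def pr (j k : Fin 4) : SS := dS (xS j) (yS k) * dS (xS k) (yS j) * (jj sS (xS j) (yS k) * jj sS (xS k) (yS j)) *
  (jj tS (xS j) (yS k) * jj tS (xS k) (yS j))

def g1 (κ : SS) (i j k : Fin 4) (w : SS) : SS := κ * (1 + w * (yS i + yS j + yS k)) *
  (dS w (yS i) * jj sS w (yS i) * jj tS w (yS i)) * (dS w (yS j) * jj sS w (yS j) * jj tS w (yS j)) *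
  (dS w (yS k) * jj sS w (yS k) * jj tS w (yS k)) * (pr i j * pr i k * pr j k)

def hf (i j : Fin 4) : SS := dS (xS i) (yS j) * jj sS (tS * xS i) (yS j) * jj tS (tS * xS i) (yS j) *
  jj sS (xS i) (yS j) * jj sS (xS j) (yS i) * jj tS (xS j) (yS i)

def kp (κ : SS) : SS := κ * (1 - tS) * JJi (sS * tS) * JJi (tS * tS)

def Rf (κ : SS) (i j k : Fin 4) : SS := kp κ * (1 + tS * (1 + xS i * yS j + xS i * yS k)) * hf i j * hf i k * pr j k

lemma pr_comm (j k : Fin 4) : pr j k = pr k j := by unfold pr; ring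
lemma g1_c1 (κ : SS) (i j k : Fin 4) (w : SS) : g1 κ i j k w = g1 κ j i k w := by
  unfold g1; rw [pr_comm j i]; ring
lemma g1_c2 (κ : SS) (i j k : Fin 4) (w : SS) : g1 κ i j k w = g1 κ i k j w := by
  unfold g1; rw [pr_comm k j]; ring

lemma xdS (i j : Fin 4) : xS i * dS (xS j) (yS i) = xS i - xS j := by
  rw [dS]; linear_combination - xS j * xyS i
lemma dii (c : SS) (i : Fin 4) : dS (c * xS i) (yS i) = 1 - c := by
  rw [dS]; linear_combination - c * xyS i
lemma jii (a c : SS) (i : Fin 4) : jj a (c * xS i) (yS i) = JJi (a * c) := by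
  rw [jj]; refine congrArg JJi ?_; linear_combination a * c * xyS i
lemma jii2 (a c d : SS) (i : Fin 4) : jj a (c * (d * xS i)) (yS i) = JJi (a * c * d) := by
  rw [jj]; refine congrArg JJi ?_; linear_combination a * c * d * xyS i

lemma pole1 (κ : SS) (i j k : Fin 4) : (tS * xS i) ^ 2 * g1 κ i j k (tS * xS i) =
    (tS * xS i - tS * xS j) * (tS * xS i - tS * xS k) * Rf κ i j k := by
  have e1 := jj_mul cct (xS i) (yS j)
  have e2 := jj_mul cct (xS i) (yS k)
  have e3 := xyS i
  have e4 := xdS i j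
  have e5 := xdS i k
  calc _ = tS ^ 2 * κ * (1 + tS * (xS i * yS i + xS i * yS j + xS i * yS k)) *
      (dS (tS * xS i) (yS i) * jj sS (tS * xS i) (yS i) * jj tS (tS * xS i) (yS i)) *
      (dS (tS * xS i) (yS j) * jj tS (xS i) (yS j)) * (dS (tS * xS i) (yS k) * jj tS (xS i) (yS k)) *
      (xS i * dS (xS j) (yS i)) * (xS i * dS (xS k) (yS i)) * (hf i j * hf i k * pr j k) := by
        rw [g1, pr, pr, hf, hf]; generalize pr j k = z; ring
    _ = _ := by
      rw [e1, e2, e3, e4, e5, dii, jii, jii, Rf, kp]; ring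

lemma Cg_pr {l j k : Fin 4} {p : SS} (hj : j ≠ l) (hk : k ≠ l) : Cg l p (pr j k) (pr j k) := by
  unfold pr
  repeat first | with_reducible exact Cg_x hj | with_reducible exact Cg_x hk | with_reducible exact Cg_y hj | with_reducible exact Cg_y hk | with_reducible apply Cg_jjs | with_reducible apply Cg_jjt | with_reducible apply Cg_d | with_reducible apply Cg_mul

lemma Cg_g1 {κ : SS} (hκ : IsK κ) {l i j k : Fin 4} (hi : i ≠ l) (hj : j ≠ l) (hk : k ≠ l) {p w ω : SS}
    (hw : Cg l p w ω) : Cg l p (g1 κ i j k w) (g1 κ i j k ω) := by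
  unfold g1
  repeat first | with_reducible exact hw | with_reducible exact Cg_K hκ | with_reducible exact Cg_one | with_reducible exact Cg_y hi | with_reducible exact Cg_y hj | with_reducible exact Cg_y hk | with_reducible exact Cg_pr hi hj | with_reducible exact Cg_pr hi hk | with_reducible exact Cg_pr hj hk | with_reducible apply Cg_jjs | with_reducible apply Cg_jjt | with_reducible apply Cg_d | with_reducible apply Cg_mul | with_reducible apply Cg_add

lemma T0_form (κ : SS) : T0 κ 0 = g1 κ 1 2 3 (xS 0) * JJi (tS * xS 1 * yS 0) * JJi (tS * xS 2 * yS 0) *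
    JJi (tS * xS 3 * yS 0) := by
  change _ = g1 κ 1 2 3 (xS 0) * jj tS (xS 1) (yS 0) * jj tS (xS 2) (yS 0) * jj tS (xS 3) (yS 0)
  have hc : ∀ b : Fin 4, colP dS b * colP (jj sS) b * colP (jj tS) b =
    ∏ a, if a = b then 1 else dS (xS a) (yS b) * jj sS (xS a) (yS b) * jj tS (xS a) (yS b) := by
    intro b
    rw [colP, colP, colP, ← Finset.prod_mul_distrib, ← Finset.prod_mul_distrib]
    refine Finset.prod_congr rfl fun a _ => ?_
    split_ifs <;> simp
  have he : ebar * xS 0 = 1 + xS 0 * (yS 1 + yS 2 + yS 3) := by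
    rw [ebar, Fin.sum_univ_four]; linear_combination xyS 0
  calc T0 κ 0 = κ * (ebar * xS 0) * (∏ b, if b = 0 then colP (jj tS) b else
     colP dS b * colP (jj sS) b * colP (jj tS) b) := by rw [T0]; ring
    _ = _ := by
      rw [he, Fin.prod_univ_four]
      simp only [hc, Fin.prod_univ_four, colP_0]
      simp only [Fin.reduceEq, if_true, if_false]
      rw [g1, pr, pr, pr]
      generalize 1 + xS 0 * (yS 1 + yS 2 + yS 3) = z
      ring

lemma step1 {κ : SS} (hκ : IsK κ) : piS 0 (T0 κ 0) = Rf κ 1 2 3 + Rf κ 2 1 3 + Rf κ 3 1 2 := by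
  have hm : ∀ i : Fin 4, i ≠ 0 → tS * xS i ∈ serR (Bs (Nz 0)) := fun i hi => mul_mem (tS_mem _) (xS_mem hi)
  have hz : ∀ i : Fin 4, MvPowerSeries.constantCoeff (tS * xS i) = 0 := fun i => by simp [cct]
  have hC : ∀ i : Fin 4, i ≠ 0 → Cg 0 (tS * xS i) (g1 κ 1 2 3 (xS 0)) (g1 κ 1 2 3 (tS * xS i)) :=
    fun i hi => Cg_g1 hκ (by decide) (by decide) (by decide) (Cg_var (hm i hi))
  refine residue3' 0 (hm 1 (by decide)) (hm 2 (by decide)) (hm 3 (by decide)) (hz 1) (hz 2) (hz 3)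
    (T0_form κ) (hC 1 (by decide)) (hC 2 (by decide)) (hC 3 (by decide)) (nz_c tS_ne (by decide))
    (nz_c tS_ne (by decide)) (nz_c tS_ne (by decide)) (pole1 κ 1 2 3) ?_ ?_
  · rw [g1_c1]; exact pole1 κ 2 1 3
  · rw [g1_c2, g1_c1]; exact pole1 κ 3 1 2

lemma prm_pr (σ : Equiv.Perm (Fin 4)) (j k : Fin 4) : prm σ (pr j k) = pr (σ j) (σ k) := by
  simp only [pr, map_mul, prm_d, prm_jjs, prm_jjt, prm_x, prm_y]
lemma prm_hf (σ : Equiv.Perm (Fin 4)) (j k : Fin 4) : prm σ (hf j k) = hf (σ j) (σ k) := by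
  simp only [hf, map_mul, prm_d, prm_jjs, prm_jjt, prm_x, prm_y, prm_t]
lemma IsK.kp {κ : SS} (h : IsK κ) : IsK (kp κ) :=
  ((h.mul (IsK.one.sub IsK.t)).mul ((IsK.s.mul IsK.t).J (by simp [ccs]))).mul ((IsK.t.mul IsK.t).J (by simp [cct]))
lemma prm_Rf (σ : Equiv.Perm (Fin 4)) {κ : SS} (h : IsK κ) (i j k : Fin 4) :
    prm σ (Rf κ i j k) = Rf κ (σ i) (σ j) (σ k) := by
  simp only [Rf, map_mul, map_add, map_one, h.kp.inv, prm_hf, prm_pr, prm_x, prm_y, prm_t]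

lemma ct_step1 {κ : SS} (hκ : IsK κ) : ctS (T0 κ 0) = 3 * ctS (Rf κ 1 2 3) := by
  have h2 : ctS (Rf κ 2 1 3) = ctS (Rf κ 1 2 3) := by
    rw [← ctS_prm (Equiv.swap 1 2) (Rf κ 1 2 3), prm_Rf _ hκ]
    congr 1
  have h3 : ctS (Rf κ 3 1 2) = ctS (Rf κ 1 2 3) := by
    rw [← ctS_prm (Equiv.swap 1 2 * Equiv.swap 1 3) (Rf κ 1 2 3), prm_Rf _ hκ,
      show (Equiv.swap 1 2 * Equiv.swap 1 3 : Equiv.Perm (Fin 4)) 1 = 3 by decide,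
      show (Equiv.swap 1 2 * Equiv.swap 1 3 : Equiv.Perm (Fin 4)) 2 = 1 by decide,
      show (Equiv.swap 1 2 * Equiv.swap 1 3 : Equiv.Perm (Fin 4)) 3 = 2 by decide]
  rw [← ctS_piS 0, step1 hκ, map_add, map_add, h2, h3]; ring

end c5

section c6

def g2 (κ : SS) (j k : Fin 4) (w : SS) : SS := κ * (1 + tS * (1 + w * yS j + w * yS k)) *
  (dS w (yS j) * jj sS (tS * w) (yS j) * jj tS (tS * w) (yS j) * jj sS w (yS j)) *
  (dS w (yS k) * jj sS (tS * w) (yS k) * jj tS (tS * w) (yS k) * jj sS w (yS k)) * pr j k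

lemma g2_c (κ : SS) (j k : Fin 4) (w : SS) : g2 κ j k w = g2 κ k j w := by
  unfold g2; rw [pr_comm]; ring

def Gs (κ : SS) (j k : Fin 4) : SS := κ * (1 + tS * (1 + sS + sS * xS j * yS k)) *
  ((1 - sS) * JJi (sS * tS * sS) * JJi (tS * tS * sS) * JJi (sS * sS)) * JJi uS *
  (jj sS (tS * (sS * xS j)) (yS k) * jj tS (tS * (sS * xS j)) (yS k) * jj sS (sS * xS j) (yS k)) *
  (dS (xS j) (yS k) * jj sS (xS k) (yS j) * jj tS (xS j) (yS k) * jj tS (xS k) (yS j)) * jj uS (xS k) (yS j)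

def Gt (κ : SS) (j k : Fin 4) : SS := κ * (1 + tS * (1 + tS + tS * xS j * yS k)) *
  ((1 - tS) * JJi (sS * tS * tS) * JJi (tS * tS * tS) * JJi (sS * tS)) * JJi uS *
  (uS ^ 2 * xS j * yS k * jj uS (xS j) (yS k)) *
  (jj sS (tS * (tS * xS j)) (yS k) * jj tS (tS * (tS * xS j)) (yS k) * jj sS (tS * xS j) (yS k)) *
  (dS (xS j) (yS k) * jj sS (xS j) (yS k) * jj sS (xS k) (yS j) * jj tS (xS k) (yS j))

lemma pole2s (κ : SS) (j k : Fin 4) : (sS * xS j) ^ 3 * g2 κ j k (sS * xS j) =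
    (sS * xS j - tS * xS j) * (sS * xS j - sS * xS k) * (sS * xS j - tS * xS k) * Gs κ j k := by
  have e1 := jj_mul ccs (xS j) (yS k)
  have e2 := jj_mul ccu (xS k) (yS j)
  have e3 := JJi_mul ccu
  have f1 : sS * xS j - tS * xS j = sS * xS j * (1 - uS) := by rw [tS]; ring
  have f2 : sS * xS j - sS * xS k = sS * (xS j * dS (xS k) (yS j)) := by rw [xdS]; ring
  have f3 : sS * xS j - tS * xS k = sS * xS j * dS (uS * xS k) (yS j) := by
    rw [tS, dS]; linear_combination sS * uS * xS k * xyS j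
  have h0 : sS * xS j * yS j = sS := by linear_combination sS * xyS j
  rw [f1, f2, f3]
  symm
  calc _ = (sS * xS j) ^ 3 * (κ * (1 + tS * (1 + sS + sS * xS j * yS k)) *
      ((1 - sS) * JJi (sS * tS * sS) * JJi (tS * tS * sS) * JJi (sS * sS)) * 
      (jj sS (tS * (sS * xS j)) (yS k) * jj tS (tS * (sS * xS j)) (yS k) * jj sS (sS * xS j) (yS k)) *
      (dS (xS j) (yS k) * jj sS (xS k) (yS j) * jj tS (xS j) (yS k) * jj tS (xS k) (yS j)) * dS (xS k) (yS j)) *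
      (((1 - uS) * JJi uS) * (dS (uS * xS k) (yS j) * jj uS (xS k) (yS j))) := by
        rw [Gs]; ring
    _ = (sS * xS j) ^ 3 * (κ * (1 + tS * (1 + sS + sS * xS j * yS k)) *
      ((1 - sS) * JJi (sS * tS * sS) * JJi (tS * tS * sS) * JJi (sS * sS)) * 
      (jj sS (tS * (sS * xS j)) (yS k) * jj tS (tS * (sS * xS j)) (yS k) * jj sS (sS * xS j) (yS k)) *
      (dS (xS j) (yS k) * jj sS (xS k) (yS j) * jj tS (xS j) (yS k) * jj tS (xS k) (yS j)) * dS (xS k) (yS j)) *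
      (dS (sS * xS j) (yS k) * jj sS (xS j) (yS k)) := by rw [e1, e2, e3, mul_one]
    _ = _ := by
      rw [g2, pr, h0, dii, jii2, jii2, jii]; ring

lemma pole2t (κ : SS) (j k : Fin 4) : (tS * xS j) ^ 3 * g2 κ j k (tS * xS j) =
    (tS * xS j - sS * xS j) * (tS * xS j - sS * xS k) * (tS * xS j - tS * xS k) * Gt κ j k := by
  have e1 := jj_mul cct (xS j) (yS k)
  have e2 := jj_mul ccu (xS j) (yS k)
  have e3 := JJi_mul ccu
  have f1 : tS * xS j - sS * xS j = - (sS * xS j * (1 - uS)) := by rw [tS]; ring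
  have f2 : tS * xS j - tS * xS k = tS * (xS j * dS (xS k) (yS j)) := by rw [xdS]; ring
  have f3 : tS * xS j - sS * xS k = - (sS * xS k * dS (uS * xS j) (yS k)) := by
    rw [tS, dS]; linear_combination - sS * uS * xS j * xyS k
  have h0 : tS * xS j * yS j = tS := by linear_combination tS * xyS j
  rw [f1, f2, f3]
  symm
  calc _ = (tS * xS j) * (sS * uS * xS j) ^ 2 * (κ * (1 + tS * (1 + tS + tS * xS j * yS k)) *
      ((1 - tS) * JJi (sS * tS * tS) * JJi (tS * tS * tS) * JJi (sS * tS)) * 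
      (jj sS (tS * (tS * xS j)) (yS k) * jj tS (tS * (tS * xS j)) (yS k) * jj sS (tS * xS j) (yS k)) *
      (dS (xS j) (yS k) * jj sS (xS j) (yS k) * jj sS (xS k) (yS j) * jj tS (xS k) (yS j)) * dS (xS k) (yS j)) *
      (((1 - uS) * JJi uS) * (dS (uS * xS j) (yS k) * jj uS (xS j) (yS k)) * (xS k * yS k)) := by
        rw [Gt]; ring
    _ = (tS * xS j) ^ 3 * (κ * (1 + tS * (1 + tS + tS * xS j * yS k)) *
      ((1 - tS) * JJi (sS * tS * tS) * JJi (tS * tS * tS) * JJi (sS * tS)) * 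
      (jj sS (tS * (tS * xS j)) (yS k) * jj tS (tS * (tS * xS j)) (yS k) * jj sS (tS * xS j) (yS k)) *
      (dS (xS j) (yS k) * jj sS (xS j) (yS k) * jj sS (xS k) (yS j) * jj tS (xS k) (yS j)) * dS (xS k) (yS j)) *
      (dS (tS * xS j) (yS k) * jj tS (xS j) (yS k)) := by rw [e1, e2, e3, xyS, mul_one, mul_one, ← tS]; ring
    _ = _ := by
      rw [g2, pr, h0, dii, jii2, jii2, jii]; ring

lemma Cg_g2 {κ : SS} (hκ : IsK κ) {l j k : Fin 4} (hj : j ≠ l) (hk : k ≠ l) {p w ω : SS}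
    (hw : Cg l p w ω) : Cg l p (g2 κ j k w) (g2 κ j k ω) := by
  unfold g2
  repeat first | with_reducible exact hw | with_reducible exact Cg_K hκ | with_reducible exact Cg_one | with_reducible exact Cg_t | with_reducible exact Cg_y hj | with_reducible exact Cg_y hk | with_reducible exact Cg_pr hj hk | with_reducible apply Cg_jjs | with_reducible apply Cg_jjt | with_reducible apply Cg_d | with_reducible apply Cg_mul | with_reducible apply Cg_add

lemma Rf_form (κ : SS) : Rf κ 1 2 3 = g2 (kp κ) 2 3 (xS 1) * JJi (sS * xS 2 * yS 1) * JJi (tS * xS 2 * yS 1) *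
    JJi (sS * xS 3 * yS 1) * JJi (tS * xS 3 * yS 1) := by
  change _ = g2 (kp κ) 2 3 (xS 1) * jj sS (xS 2) (yS 1) * jj tS (xS 2) (yS 1) * jj sS (xS 3) (yS 1) * jj tS (xS 3) (yS 1)
  rw [Rf, g2, hf, hf]
  generalize kp κ * (1 + tS * (1 + xS 1 * yS 2 + xS 1 * yS 3)) = z
  ring

lemma step2 {κ : SS} (hκ : IsK κ) : piS 1 (Rf κ 1 2 3) =
    Gs (kp κ) 2 3 + Gt (kp κ) 2 3 + Gs (kp κ) 3 2 + Gt (kp κ) 3 2 := by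
  have hms : ∀ i : Fin 4, i ≠ 1 → sS * xS i ∈ serR (Bs (Nz 1)) := fun i hi => mul_mem (sS_mem _) (xS_mem hi)
  have hmt : ∀ i : Fin 4, i ≠ 1 → tS * xS i ∈ serR (Bs (Nz 1)) := fun i hi => mul_mem (tS_mem _) (xS_mem hi)
  have hzs : ∀ i : Fin 4, MvPowerSeries.constantCoeff (sS * xS i) = 0 := fun i => by simp [ccs]
  have hzt : ∀ i : Fin 4, MvPowerSeries.constantCoeff (tS * xS i) = 0 := fun i => by simp [cct]
  have hC : ∀ b ∈ serR (Bs (Nz 1)), Cg 1 b (g2 (kp κ) 2 3 (xS 1)) (g2 (kp κ) 2 3 b) :=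
    fun b hb => Cg_g2 hκ.kp (by decide) (by decide) (Cg_var hb)
  have n2 : (2 : Fin 4) ≠ 1 := by decide
  have n3 : (3 : Fin 4) ≠ 1 := by decide
  refine residue4' 1 (hms 2 n2) (hmt 2 n2) (hms 3 n3) (hmt 3 n3) (hzs 2) (hzt 2) (hzs 3) (hzt 3)
    (Rf_form κ) (hC _ (hms 2 n2)) (hC _ (hmt 2 n2)) (hC _ (hms 3 n3)) (hC _ (hmt 3 n3))
    (nz_st _ _) (nz_c sS_ne (by decide)) (nz_st _ _) (nz_ts _ _) (nz_c tS_ne (by decide)) (nz_st _ _)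
    (pole2s _ 2 3) (pole2t _ 2 3) ?_ ?_
  · rw [g2_c]; exact pole2s _ 3 2
  · rw [g2_c]; exact pole2t _ 3 2

lemma prm_Gs (σ : Equiv.Perm (Fin 4)) {κ : SS} (h : IsK κ) (j k : Fin 4) :
    prm σ (Gs κ j k) = Gs κ (σ j) (σ k) := by
  have hJ : prm σ (JJi (sS * tS * sS)) = JJi (sS * tS * sS) := (((IsK.s.mul IsK.t).mul IsK.s).J (by simp [ccs])).inv σ
  have hJ2 : prm σ (JJi (tS * tS * sS)) = JJi (tS * tS * sS) := (((IsK.t.mul IsK.t).mul IsK.s).J (by simp [ccs])).inv σ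
  have hJ3 : prm σ (JJi (sS * sS)) = JJi (sS * sS) := (((IsK.s.mul IsK.s)).J (by simp [ccs])).inv σ
  have hJ4 : prm σ (JJi uS) = JJi uS := (IsK.u.J ccu).inv σ
  simp only [Gs, map_mul, map_add, map_sub, map_one, h.inv, prm_x, prm_y, prm_t, prm_s, prm_d, prm_jjs, prm_jjt, prm_jju,
    hJ, hJ2, hJ3, hJ4]
lemma prm_Gt (σ : Equiv.Perm (Fin 4)) {κ : SS} (h : IsK κ) (j k : Fin 4) :
    prm σ (Gt κ j k) = Gt κ (σ j) (σ k) := by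
  have hJ : prm σ (JJi (sS * tS * tS)) = JJi (sS * tS * tS) := (((IsK.s.mul IsK.t).mul IsK.t).J (by simp [ccs])).inv σ
  have hJ2 : prm σ (JJi (tS * tS * tS)) = JJi (tS * tS * tS) := (((IsK.t.mul IsK.t).mul IsK.t).J (by simp [cct])).inv σ
  have hJ3 : prm σ (JJi (sS * tS)) = JJi (sS * tS) := (((IsK.s.mul IsK.t)).J (by simp [ccs])).inv σ
  have hJ4 : prm σ (JJi uS) = JJi uS := (IsK.u.J ccu).inv σ
  simp only [Gt, map_mul, map_add, map_sub, map_one, map_pow, h.inv, prm_x, prm_y, prm_t, prm_s, prm_u, prm_d, prm_jjs, prm_jjt, prm_jju,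
    hJ, hJ2, hJ3, hJ4]

lemma ct_step2 {κ : SS} (hκ : IsK κ) : ctS (Rf κ 1 2 3) = 2 * (ctS (Gs (kp κ) 2 3) + ctS (Gt (kp κ) 2 3)) := by
  have h2 : ctS (Gs (kp κ) 3 2) = ctS (Gs (kp κ) 2 3) := by
    rw [← ctS_prm (Equiv.swap 2 3) (Gs (kp κ) 2 3), prm_Gs _ hκ.kp, Equiv.swap_apply_left, Equiv.swap_apply_right]
  have h3 : ctS (Gt (kp κ) 3 2) = ctS (Gt (kp κ) 2 3) := by
    rw [← ctS_prm (Equiv.swap 2 3) (Gt (kp κ) 2 3), prm_Gt _ hκ.kp, Equiv.swap_apply_left, Equiv.swap_apply_right]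
  rw [← ctS_piS 1, step2 hκ, map_add, map_add, map_add, h2, h3]; ring

lemma ct_all {κ : SS} (hκ : IsK κ) : ctS (E0 κ) = 24 * (ctS (Gs (kp κ) 2 3) + ctS (Gt (kp κ) 2 3)) := by
  rw [ct_E0 hκ, ct_step1 hκ, ct_step2 hκ]; ring
end c6

section c7

lemma fin_poly {R : Type*} [CommRing R] (s u t : R) (ht : t = s * u) :
    s ^ 2 * (-(u * (1 - s))) * ((1 - s) * (1 - u * t) * ((1-s)*(1-s^2*t)*(1-s*t^2)*(1-t^3)*(1-s*t^3)*(1+t*(1+s+s*s))))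
    - t ^ 2 * (s - u) * ((1 - s) * (1 - u * t) * ((1+s*t)*(1-s*t)*(1-s^3)*(1-s*t^2)*(1-t^3)*(1-s^3*t)))
    + u ^ 2 * (s * (1 - u)) * ((1 - s) * ((1-s^3)*(1-s^2*t)*(1-s^3*t)*(1-s^2*t^2)*(1-s*t^3)*(1-u)*(1+t*(1+s+s*u))))
    + (s - u) * (-(u * (1 - s))) * (s * ((1 - u * t) * ((1-s)*(1-s^3)*(1-s^2*t)*(1-s*t^2)*(1-s^3*t)*u^2*s*(1+t*(1+t+t*s))))
      - t * ((1-t)*(1-s^2)*(1-s^3)*(1-s^2*t)^2*(1-s^3*t)*(1+s*t)*u^2*t)) =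
    ((1-u)*(1-s)^2*(1-t)*(1-u*t)) * (s*(1-u)*(s-u)*(-(u*(1-s)))) * 
      (1+s^2*t^2+s^2*t^3+s^3*t^2+s^3*t^3+s^5*t^5) := by
  subst ht; ring

def dm (a b : ℕ) : SS := 1 - sS ^ a * uS ^ b
def Jm (a b : ℕ) : SS := JJi (sS ^ a * uS ^ b)
lemma Jm_mul (a b : ℕ) (h : a + b ≠ 0) : dm a b * Jm a b = 1 := by
  apply JJi_mul
  rw [map_mul, map_pow, map_pow, ccs, ccu]
  rcases Nat.eq_zero_or_pos a with h1 | h1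
  · rw [zero_pow (n := b) (by omega), mul_zero]
  · rw [zero_pow (n := a) (by omega), zero_mul]
lemma Jm_eq {m : SS} (a b : ℕ) (h : m = sS ^ a * uS ^ b) : JJi m = Jm a b := by rw [h, Jm]

def kap : SS := JJi sS ^ 4 * JJi tS ^ 4
lemma IsK_kap : IsK kap := ((IsK.s.J ccs).pow 4).mul ((IsK.t.J cct).pow 4)

def kq : SS := Jm 1 0 ^ 4 * Jm 1 1 ^ 4 * dm 1 1 * Jm 2 1 * Jm 2 2
lemma kp_kap : kp kap = kq := by
  rw [kp, kap, Jm_eq (m := sS) 1 0 (by ring), Jm_eq (m := tS) 1 1 (by rw [tS]; ring),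
    Jm_eq (m := sS * tS) 2 1 (by rw [tS]; ring), Jm_eq (m := tS * tS) 2 2 (by rw [tS]; ring), kq,
    show dm 1 1 = 1 - tS by rw [tS, dm]; ring]

def cs0 : SS := dm 1 0 * Jm 3 1 * Jm 3 2 * Jm 2 0
def ct0 : SS := dm 1 1 * Jm 3 2 * Jm 3 3 * Jm 2 1

def g3s (κ : SS) (k : Fin 4) (w : SS) : SS := κ * (1 + tS * (1 + sS + sS * w * yS k)) *
  ((1 - sS) * JJi (sS * tS * sS) * JJi (tS * tS * sS) * JJi (sS * sS)) * JJi uS *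
  (jj sS (tS * (sS * w)) (yS k) * jj tS (tS * (sS * w)) (yS k) * jj sS (sS * w) (yS k)) *
  (dS w (yS k) * jj tS w (yS k))

def g3t (κ : SS) (k : Fin 4) (w : SS) : SS := κ * (1 + tS * (1 + tS + tS * w * yS k)) *
  ((1 - tS) * JJi (sS * tS * tS) * JJi (tS * tS * tS) * JJi (sS * tS)) * JJi uS *
  (uS ^ 2 * w * yS k * jj uS w (yS k)) *
  (jj sS (tS * (tS * w)) (yS k) * jj tS (tS * (tS * w)) (yS k) * jj sS (tS * w) (yS k)) *
  (dS w (yS k) * jj sS w (yS k))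

lemma Gs_form (κ : SS) : Gs κ 2 3 = g3s κ 3 (xS 2) * JJi (sS * xS 3 * yS 2) * JJi (tS * xS 3 * yS 2) *
    JJi (uS * xS 3 * yS 2) := by
  change _ = g3s κ 3 (xS 2) * jj sS (xS 3) (yS 2) * jj tS (xS 3) (yS 2) * jj uS (xS 3) (yS 2)
  rw [Gs, g3s]
  generalize κ * (1 + tS * (1 + sS + sS * xS 2 * yS 3)) *
    ((1 - sS) * JJi (sS * tS * sS) * JJi (tS * tS * sS) * JJi (sS * sS)) * JJi uS = z
  ring
lemma Gt_form (κ : SS) : Gt κ 2 3 = g3t κ 3 (xS 2) * JJi (sS * xS 3 * yS 2) * JJi (tS * xS 3 * yS 2) := by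
  change _ = g3t κ 3 (xS 2) * jj sS (xS 3) (yS 2) * jj tS (xS 3) (yS 2)
  rw [Gt, g3t]
  generalize κ * (1 + tS * (1 + tS + tS * xS 2 * yS 3)) *
    ((1 - tS) * JJi (sS * tS * tS) * JJi (tS * tS * tS) * JJi (sS * tS)) * JJi uS = z
  ring

lemma IsK_c : IsK ((1 - sS) * JJi (sS * tS * sS) * JJi (tS * tS * sS) * JJi (sS * sS)) :=
  (((IsK.one.sub IsK.s).mul (((IsK.s.mul IsK.t).mul IsK.s).J (by simp [ccs]))).mul
    (((IsK.t.mul IsK.t).mul IsK.s).J (by simp [ccs]))).mul ((IsK.s.mul IsK.s).J (by simp [ccs]))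
lemma IsK_c' : IsK ((1 - tS) * JJi (sS * tS * tS) * JJi (tS * tS * tS) * JJi (sS * tS)) :=
  (((IsK.one.sub IsK.t).mul (((IsK.s.mul IsK.t).mul IsK.t).J (by simp [ccs]))).mul
    (((IsK.t.mul IsK.t).mul IsK.t).J (by simp [cct]))).mul ((IsK.s.mul IsK.t).J (by simp [ccs]))
lemma IsK_Ju : IsK (JJi uS) := IsK.u.J ccu
lemma IsK_u2 : IsK (uS ^ 2) := IsK.u.pow 2

lemma Cg_g3s {κ : SS} (hκ : IsK κ) {l k : Fin 4} (hk : k ≠ l) {p w ω : SS}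
    (hw : Cg l p w ω) : Cg l p (g3s κ k w) (g3s κ k ω) := by
  unfold g3s
  repeat first | with_reducible exact hw | with_reducible exact Cg_K hκ | with_reducible exact Cg_K IsK_c | with_reducible exact Cg_K IsK_Ju | with_reducible exact Cg_one | with_reducible exact Cg_s | with_reducible exact Cg_t | with_reducible exact Cg_y hk | with_reducible apply Cg_jjs | with_reducible apply Cg_jjt | with_reducible apply Cg_jju | with_reducible apply Cg_d | with_reducible apply Cg_mul | with_reducible apply Cg_add

lemma Cg_g3t {κ : SS} (hκ : IsK κ) {l k : Fin 4} (hk : k ≠ l) {p w ω : SS}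
    (hw : Cg l p w ω) : Cg l p (g3t κ k w) (g3t κ k ω) := by
  unfold g3t
  repeat first | with_reducible exact hw | with_reducible exact Cg_K hκ | with_reducible exact Cg_K IsK_c' | with_reducible exact Cg_K IsK_Ju | with_reducible exact Cg_K IsK_u2 | with_reducible exact Cg_one | with_reducible exact Cg_s | with_reducible exact Cg_t | with_reducible exact Cg_y hk | with_reducible apply Cg_jjs | with_reducible apply Cg_jjt | with_reducible apply Cg_jju | with_reducible apply Cg_d | with_reducible apply Cg_mul | with_reducible apply Cg_add

lemma jii3 (a c d e : SS) (i : Fin 4) : jj a (c * (d * (e * xS i))) (yS i) = JJi (a * c * d * e) := by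
  rw [jj]; refine congrArg JJi ?_; linear_combination a * c * d * e * xyS i

lemma g3s_ev (κ c : SS) (k : Fin 4) : g3s κ k (c * xS k) = κ * (1 + tS * (1 + sS + sS * c)) * cs0 * Jm 0 1 *
    (JJi (sS * tS * sS * c) * JJi (tS * tS * sS * c) * JJi (sS * sS * c)) * ((1 - c) * JJi (tS * c)) := by
  rw [g3s, jii3, jii3, jii2, dii, jii, cs0, show sS * (c * xS k) * yS k = sS * c by linear_combination sS * c * xyS k,
    Jm_eq (m := sS * tS * sS) 3 1 (by rw [tS]; ring), Jm_eq (m := tS * tS * sS) 3 2 (by rw [tS]; ring),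
    Jm_eq (m := sS * sS) 2 0 (by ring), Jm_eq (m := uS) 0 1 (by ring), show dm 1 0 = 1 - sS by rw [dm]; ring]

lemma g3t_ev (κ c : SS) (k : Fin 4) : g3t κ k (c * xS k) = κ * (1 + tS * (1 + tS + tS * c)) * ct0 * Jm 0 1 *
    (uS ^ 2 * c * JJi (uS * c)) *
    (JJi (sS * tS * tS * c) * JJi (tS * tS * tS * c) * JJi (sS * tS * c)) * ((1 - c) * JJi (sS * c)) := by
  rw [g3t, jii3, jii3, jii2, dii, jii, jii, ct0, show tS * (c * xS k) * yS k = tS * c by linear_combination tS * c * xyS k,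
    show uS ^ 2 * (c * xS k) * yS k = uS ^ 2 * c by linear_combination uS ^ 2 * c * xyS k,
    Jm_eq (m := sS * tS * tS) 3 2 (by rw [tS]; ring), Jm_eq (m := tS * tS * tS) 3 3 (by rw [tS]; ring),
    Jm_eq (m := sS * tS) 2 1 (by rw [tS]; ring), Jm_eq (m := uS) 0 1 (by ring), show dm 1 1 = 1 - tS by rw [dm, tS]; ring]

def P1 : SS := 1 + tS * (1 + sS + sS * sS)
def P3 : SS := 1 + tS * (1 + sS + sS * uS)
def Q1 : SS := 1 + tS * (1 + tS + tS * sS)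
def Q2 : SS := 1 + tS * (1 + tS + tS * tS)
def H1 : SS := kq * P1 * cs0 * Jm 0 1 * (Jm 4 1 * Jm 4 2 * Jm 3 0) * (dm 1 0 * Jm 2 1)
def H2 : SS := kq * ((1 + tS) * (1 + sS * tS)) * cs0 * Jm 0 1 * (Jm 4 2 * Jm 4 3 * Jm 3 1) * (dm 1 1 * Jm 2 2)
def H3 : SS := kq * P3 * cs0 * Jm 0 1 * (Jm 3 2 * Jm 3 3 * Jm 2 1) * (dm 0 1 * Jm 1 2)
def I1 : SS := kq * Q1 * ct0 * Jm 0 1 * (uS ^ 2 * sS * Jm 1 1) * (Jm 4 2 * Jm 4 3 * Jm 3 1) * (dm 1 0 * Jm 2 0)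
def I2 : SS := kq * Q2 * ct0 * Jm 0 1 * (uS ^ 2 * tS * Jm 1 2) * (Jm 4 3 * Jm 4 4 * Jm 3 2) * (dm 1 1 * Jm 2 1)

lemma h1e : g3s kq 3 (sS * xS 3) = H1 := by
  rw [g3s_ev, H1, Jm_eq (m := sS * tS * sS * sS) 4 1 (by rw [tS]; ring), Jm_eq (m := tS * tS * sS * sS) 4 2 (by rw [tS]; ring),
    Jm_eq (m := sS * sS * sS) 3 0 (by ring), Jm_eq (m := tS * sS) 2 1 (by rw [tS]; ring),
    show dm 1 0 = 1 - sS by rw [dm]; ring, P1]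
lemma h2e : g3s kq 3 (tS * xS 3) = H2 := by
  rw [g3s_ev, H2, Jm_eq (m := sS * tS * sS * tS) 4 2 (by rw [tS]; ring), Jm_eq (m := tS * tS * sS * tS) 4 3 (by rw [tS]; ring),
    Jm_eq (m := sS * sS * tS) 3 1 (by rw [tS]; ring), Jm_eq (m := tS * tS) 2 2 (by rw [tS]; ring),
    show dm 1 1 = 1 - tS by rw [dm, tS]; ring, show 1 + tS * (1 + sS + sS * tS) = (1 + tS) * (1 + sS * tS) by ring]
lemma h3e : g3s kq 3 (uS * xS 3) = H3 := by
  rw [g3s_ev, H3, Jm_eq (m := sS * tS * sS * uS) 3 2 (by rw [tS]; ring), Jm_eq (m := tS * tS * sS * uS) 3 3 (by rw [tS]; ring),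
    Jm_eq (m := sS * sS * uS) 2 1 (by ring), Jm_eq (m := tS * uS) 1 2 (by rw [tS]; ring),
    show dm 0 1 = 1 - uS by rw [dm]; ring, P3]
lemma i1e : g3t kq 3 (sS * xS 3) = I1 := by
  rw [g3t_ev, I1, Jm_eq (m := sS * tS * tS * sS) 4 2 (by rw [tS]; ring), Jm_eq (m := tS * tS * tS * sS) 4 3 (by rw [tS]; ring),
    Jm_eq (m := sS * tS * sS) 3 1 (by rw [tS]; ring), Jm_eq (m := sS * sS) 2 0 (by ring),
    Jm_eq (m := uS * sS) 1 1 (by ring),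
    show dm 1 0 = 1 - sS by rw [dm]; ring, Q1]
lemma i2e : g3t kq 3 (tS * xS 3) = I2 := by
  rw [g3t_ev, I2, Jm_eq (m := sS * tS * tS * tS) 4 3 (by rw [tS]; ring), Jm_eq (m := tS * tS * tS * tS) 4 4 (by rw [tS]; ring),
    Jm_eq (m := sS * tS * tS) 3 2 (by rw [tS]; ring), Jm_eq (m := sS * tS) 2 1 (by rw [tS]; ring),
    Jm_eq (m := uS * tS) 1 2 (by rw [tS]; ring),
    show dm 1 1 = 1 - tS by rw [dm, tS]; ring, Q2]

lemma IsK_kq : IsK kq := kp_kap ▸ IsK_kap.kp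

lemma res_s : (sS - tS) * (sS - uS) * (tS - uS) * piS 2 (Gs kq 2 3) =
    sS ^ 2 * (tS - uS) * H1 - tS ^ 2 * (sS - uS) * H2 + uS ^ 2 * (sS - tS) * H3 := by
  have n : (3 : Fin 4) ≠ 2 := by decide
  have ms := mul_mem (sS_mem _) (xS_mem n)
  have mt := mul_mem (tS_mem _) (xS_mem n)
  have mu := mul_mem (uS_mem _) (xS_mem n)
  have h := residue3 2 ms mt mu (by simp [ccs]) (by simp [cct]) (by simp [ccu]) (Gs_form kq)
    (Cg_g3s IsK_kq n (Cg_var ms)) (Cg_g3s IsK_kq n (Cg_var mt)) (Cg_g3s IsK_kq n (Cg_var mu))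
  rw [h1e, h2e, h3e] at h
  apply mul_left_cancel₀ (pow_ne_zero 3 (xS_ne 3))
  linear_combination h

lemma res_t : (sS - tS) * piS 2 (Gt kq 2 3) = sS * I1 - tS * I2 := by
  have n : (3 : Fin 4) ≠ 2 := by decide
  have ms := mul_mem (sS_mem _) (xS_mem n)
  have mt := mul_mem (tS_mem _) (xS_mem n)
  have h := residue2 2 ms mt (by simp [ccs]) (by simp [cct]) (Gt_form kq)
    (Cg_g3t IsK_kq n (Cg_var ms)) (Cg_g3t IsK_kq n (Cg_var mt))
  rw [i1e, i2e] at h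
  apply mul_left_cancel₀ (xS_ne 3)
  linear_combination h

def Dd : SS := dm 1 0 ^ 2 * dm 1 1 ^ 2 * dm 2 0 * dm 2 1 ^ 2 * dm 2 2 * dm 3 0 * dm 3 1 ^ 2 * dm 3 2 ^ 2 * dm 3 3 *
  dm 4 1 * dm 4 2 * dm 4 3
def Ee : SS := dm 0 1 * dm 1 0 ^ 2 * dm 1 1 * dm 1 2

lemma EH1 : Ee * Dd * H1 = dm 1 0 * dm 1 2 * (dm 1 0 * dm 3 1 * dm 3 2 * dm 3 3 * dm 4 3 * P1) := by
  calc _ = dm 1 0 * dm 1 2 * (dm 1 0 * dm 3 1 * dm 3 2 * dm 3 3 * dm 4 3 * P1) *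
     ((dm 1 0 * Jm 1 0) ^ 4 * (dm 1 1 * Jm 1 1) ^ 4 * (dm 2 0 * Jm 2 0) * (dm 2 1 * Jm 2 1) ^ 2 * (dm 2 2 * Jm 2 2) *
     (dm 3 0 * Jm 3 0) * (dm 3 1 * Jm 3 1) * (dm 3 2 * Jm 3 2) * (dm 4 1 * Jm 4 1) * (dm 4 2 * Jm 4 2) * (dm 0 1 * Jm 0 1)) := by
          rw [Ee, Dd, H1, kq, cs0]; ring
    _ = _ := by
      rw [Jm_mul 1 0, Jm_mul 1 1, Jm_mul 2 0, Jm_mul 2 1, Jm_mul 2 2, Jm_mul 3 0, Jm_mul 3 1, Jm_mul 3 2, Jm_mul 4 1, Jm_mul 4 2, Jm_mul 0 1] <;> simp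
lemma EH2 : Ee * Dd * H2 = dm 1 0 * dm 1 2 * ((1 + sS * tS) * dm 2 1 * dm 3 0 * dm 3 2 * dm 3 3 * dm 4 1) := by
  have h : (1 + tS) * dm 1 1 * Jm 2 2 = 1 := by
    have e := Jm_mul 2 2 (by simp)
    rw [dm] at e; rw [dm, tS]; linear_combination e
  calc _ = dm 1 0 * dm 1 2 * ((1 + sS * tS) * dm 2 1 * dm 3 0 * dm 3 2 * dm 3 3 * dm 4 1) *
     ((dm 1 0 * Jm 1 0) ^ 4 * (dm 1 1 * Jm 1 1) ^ 4 * (dm 2 0 * Jm 2 0) * (dm 2 1 * Jm 2 1) * (dm 2 2 * Jm 2 2) *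
     (dm 3 1 * Jm 3 1) ^ 2 * (dm 3 2 * Jm 3 2) * (dm 4 2 * Jm 4 2) * (dm 4 3 * Jm 4 3) * (dm 0 1 * Jm 0 1)) *
     ((1 + tS) * dm 1 1 * Jm 2 2) := by
          rw [Ee, Dd, H2, kq, cs0]; generalize 1 + sS * tS = z; generalize 1 + tS = z'; ring
    _ = _ := by
      rw [h, Jm_mul 1 0, Jm_mul 1 1, Jm_mul 2 0, Jm_mul 2 1, Jm_mul 2 2, Jm_mul 3 1, Jm_mul 3 2, Jm_mul 4 3, Jm_mul 4 2, Jm_mul 0 1] <;> simp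
lemma EH3 : Ee * Dd * H3 = dm 1 0 * (dm 3 0 * dm 3 1 * dm 4 1 * dm 4 2 * dm 4 3 * dm 0 1 * P3) := by
  calc _ = dm 1 0 * (dm 3 0 * dm 3 1 * dm 4 1 * dm 4 2 * dm 4 3 * dm 0 1 * P3) *
     ((dm 1 0 * Jm 1 0) ^ 4 * (dm 1 1 * Jm 1 1) ^ 4 * (dm 2 0 * Jm 2 0) * (dm 2 1 * Jm 2 1) ^ 2 * (dm 2 2 * Jm 2 2) *
     (dm 3 1 * Jm 3 1) * (dm 3 2 * Jm 3 2) ^ 2 * (dm 3 3 * Jm 3 3) * (dm 0 1 * Jm 0 1) * (dm 1 2 * Jm 1 2)) := by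
          rw [Ee, Dd, H3, kq, cs0]; ring
    _ = _ := by
      rw [Jm_mul 1 0, Jm_mul 1 1, Jm_mul 2 0, Jm_mul 2 1, Jm_mul 2 2, Jm_mul 3 1, Jm_mul 3 2, Jm_mul 3 3, Jm_mul 0 1, Jm_mul 1 2] <;> simp
lemma EI1 : Ee * Dd * I1 = dm 1 2 * (dm 1 0 * dm 3 0 * dm 3 1 * dm 3 2 * dm 4 1 * uS ^ 2 * sS * Q1) := by
  calc _ = dm 1 2 * (dm 1 0 * dm 3 0 * dm 3 1 * dm 3 2 * dm 4 1 * uS ^ 2 * sS * Q1) *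
     ((dm 1 0 * Jm 1 0) ^ 4 * (dm 1 1 * Jm 1 1) ^ 5 * (dm 2 0 * Jm 2 0) * (dm 2 1 * Jm 2 1) ^ 2 * (dm 2 2 * Jm 2 2) *
     (dm 3 1 * Jm 3 1) * (dm 3 2 * Jm 3 2) * (dm 3 3 * Jm 3 3) * (dm 4 2 * Jm 4 2) * (dm 4 3 * Jm 4 3) * (dm 0 1 * Jm 0 1)) := by
          rw [Ee, Dd, I1, kq, ct0]; ring
    _ = _ := by
      rw [Jm_mul 1 0, Jm_mul 1 1, Jm_mul 2 0, Jm_mul 2 1, Jm_mul 2 2, Jm_mul 3 1, Jm_mul 3 2, Jm_mul 3 3, Jm_mul 0 1, Jm_mul 4 2, Jm_mul 4 3] <;> simp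
lemma EI2 : Ee * Dd * I2 = dm 1 1 * dm 2 0 * dm 3 0 * dm 3 1 ^ 2 * dm 4 1 * (1 + sS * tS) * uS ^ 2 * tS := by
  have h : Q2 * dm 1 1 * Jm 4 4 = 1 := by
    have e := Jm_mul 4 4 (by simp)
    rw [dm] at e; rw [dm, Q2, tS]; linear_combination e
  have h' : dm 4 2 * Jm 2 1 = 1 + sS * tS := by
    have e := Jm_mul 2 1 (by simp)
    rw [dm] at e; rw [dm, tS]; linear_combination (1 + sS ^ 2 * uS) * e
  calc _ = dm 1 1 * dm 2 0 * dm 3 0 * dm 3 1 ^ 2 * dm 4 1 * (dm 4 2 * Jm 2 1) * uS ^ 2 * tS *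
     ((dm 1 0 * Jm 1 0) ^ 4 * (dm 1 1 * Jm 1 1) ^ 4 * (dm 2 1 * Jm 2 1) ^ 2 * (dm 2 2 * Jm 2 2) *
     (dm 3 2 * Jm 3 2) ^ 2 * (dm 3 3 * Jm 3 3) * (dm 4 3 * Jm 4 3) * (dm 0 1 * Jm 0 1) * (dm 1 2 * Jm 1 2)) *
     (Q2 * dm 1 1 * Jm 4 4) := by
          rw [Ee, Dd, I2, kq, ct0]; ring
    _ = _ := by
      rw [h, h', Jm_mul 1 0, Jm_mul 1 1, Jm_mul 2 1, Jm_mul 2 2, Jm_mul 3 2, Jm_mul 3 3, Jm_mul 0 1, Jm_mul 1 2, Jm_mul 4 3] <;> simp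

def Nn : SS := 1+sS^2*tS^2+sS^2*tS^3+sS^3*tS^2+sS^3*tS^3+sS^5*tS^5

lemma dm_ne (a b : ℕ) (h : a + b ≠ 0) : dm a b ≠ 0 := left_ne_zero_of_mul_eq_one (Jm_mul a b h)

lemma dm_t (a b : ℕ) : dm (a + b) b = 1 - sS ^ a * tS ^ b := by rw [dm, tS]; ring

lemma s_sub_u : sS - uS ≠ 0 := by
  intro h
  have := congrArg (MvPowerSeries.coeff (Finsupp.single 0 1)) h
  rw [map_sub, sS, uS, MvPowerSeries.coeff_index_single_self_X, map_zero,
    MvPowerSeries.coeff_index_single_X, if_neg (by decide), sub_zero] at this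
  exact one_ne_zero this

lemma final_id : Dd * (piS 2 (Gs kq 2 3) + piS 2 (Gt kq 2 3)) = Nn := by
  have e1 := res_s
  have e2 := res_t
  have f1 : sS - tS = sS * dm 0 1 := by rw [dm, tS]; ring
  have f2 : tS - uS = - (uS * dm 1 0) := by rw [dm, tS]; ring
  rw [f1, f2] at e1
  rw [f1] at e2
  have hp := fin_poly sS uS tS rfl
  have W : Ee * (sS * dm 0 1 * (sS - uS) * (-(uS * dm 1 0))) ≠ 0 := by
    refine mul_ne_zero ?_ (mul_ne_zero (mul_ne_zero (mul_ne_zero sS_ne (dm_ne _ _ (by simp))) s_sub_u)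
      (neg_ne_zero.2 (mul_ne_zero uS_ne (dm_ne _ _ (by simp)))))
    rw [Ee]
    exact mul_ne_zero (mul_ne_zero (mul_ne_zero (dm_ne _ _ (by simp)) (pow_ne_zero _ (dm_ne _ _ (by simp)))) (dm_ne _ _ (by simp))) (dm_ne _ _ (by simp))
  apply mul_left_cancel₀ W
  have a1 := EH1
  have a2 := EH2
  have a3 := EH3
  have a4 := EI1
  have a5 := EI2
  have hp' : sS ^ 2 * (-(uS * dm 1 0)) * (dm 1 0 * dm 1 2 * (dm 1 0 * dm 3 1 * dm 3 2 * dm 3 3 * dm 4 3 * P1))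
    - tS ^ 2 * (sS - uS) * (dm 1 0 * dm 1 2 * ((1 + sS * tS) * dm 2 1 * dm 3 0 * dm 3 2 * dm 3 3 * dm 4 1))
    + uS ^ 2 * (sS * dm 0 1) * (dm 1 0 * (dm 3 0 * dm 3 1 * dm 4 1 * dm 4 2 * dm 4 3 * dm 0 1 * P3))
    + (sS - uS) * (-(uS * dm 1 0)) * (sS * (dm 1 2 * (dm 1 0 * dm 3 0 * dm 3 1 * dm 3 2 * dm 4 1 * uS ^ 2 * sS * Q1))
      - tS * (dm 1 1 * dm 2 0 * dm 3 0 * dm 3 1 ^ 2 * dm 4 1 * (1 + sS * tS) * uS ^ 2 * tS)) =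
    Ee * (sS * dm 0 1 * (sS - uS) * (-(uS * dm 1 0))) * Nn := by
    rw [Ee, Nn, P1, P3, Q1, show dm 1 0 = 1 - sS by rw [dm]; ring, show dm 0 1 = 1 - uS by rw [dm]; ring,
      show dm 1 2 = 1 - uS * tS by rw [dm, tS]; ring, show dm 1 1 = 1 - tS by rw [dm, tS]; ring,
      show dm 2 0 = 1 - sS ^ 2 by rw [dm]; ring, show dm 2 1 = 1 - sS * tS by rw [dm, tS]; ring,
      show dm 3 0 = 1 - sS ^ 3 by rw [dm]; ring, show dm 3 1 = 1 - sS ^ 2 * tS by rw [dm, tS]; ring,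
      show dm 3 2 = 1 - sS * tS ^ 2 by rw [dm, tS]; ring, show dm 3 3 = 1 - tS ^ 3 by rw [dm, tS]; ring,
      show dm 4 1 = 1 - sS ^ 3 * tS by rw [dm, tS]; ring, show dm 4 2 = 1 - sS ^ 2 * tS ^ 2 by rw [dm, tS]; ring,
      show dm 4 3 = 1 - sS * tS ^ 3 by rw [dm, tS]; ring]
    exact hp
  rw [← hp', ← a1, ← a2, ← a3, ← a4, ← a5]
  generalize piS 2 (Gs kq 2 3) = A at *
  generalize piS 2 (Gt kq 2 3) = B at *
  clear hp hp' a1 a2 a3 a4 a5 W f1 f2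
  generalize Ee = E at *
  generalize Dd = D at *
  linear_combination E * D * e1 + E * D * (sS - uS) * (-(uS * dm 1 0)) * e2

end c7

section c8

def av : MatVar 4 → (Fin 2 →₀ ℕ)
  | Sum.inl _ => Finsupp.single 0 1
  | Sum.inr _ => Finsupp.single 0 1 + Finsupp.single 1 1

lemma av0 (v : MatVar 4) : av v 0 = 1 := by rcases v with v | v <;> simp [av]

def cv (v : MatVar 4) : LL := xx (vcol v) * yy (vrow v)
def mv (v : MatVar 4) : SS := MvPowerSeries.monomial (av v) (cv v)

lemma mv_inl (a b : Fin 4) : mv (vr true a b) = sS * xS b * yS a := by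
  rw [mv, vr, if_pos rfl, av, cv]
  change MvPowerSeries.monomial _ (xx b * yy a) = _
  rw [sS, xS, yS, mul_assoc, ← map_mul, MvPowerSeries.X]
  change _ = _ * MvPowerSeries.C _
  rw [← MvPowerSeries.monomial_zero_eq_C_apply, MvPowerSeries.monomial_mul_monomial, add_zero, one_mul]

lemma mv_inr (a b : Fin 4) : mv (vr false a b) = tS * xS b * yS a := by
  rw [mv, vr, if_neg (by decide), av, cv]
  change MvPowerSeries.monomial _ (xx b * yy a) = _
  rw [tS, sS, uS, xS, yS, mul_assoc _ (cS _), ← map_mul, MvPowerSeries.X, MvPowerSeries.X]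
  change _ = _ * MvPowerSeries.C _
  rw [← MvPowerSeries.monomial_zero_eq_C_apply, MvPowerSeries.monomial_mul_monomial,
    MvPowerSeries.monomial_mul_monomial, add_zero, one_mul, one_mul]

lemma coeff_J (a : Fin 2 →₀ ℕ) (ha : a 0 = 1) (c : LL) (n : Fin 2 →₀ ℕ) :
    MvPowerSeries.coeff n (JJi (MvPowerSeries.monomial a c)) = if n = n 0 • a then c ^ (n 0) else 0 := by
  have ha0 : a ≠ 0 := by rintro rfl; simp at ha
  have h0 : MvPowerSeries.constantCoeff (MvPowerSeries.monomial a c : SS) = 0 := by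
    classical
    rw [← MvPowerSeries.coeff_zero_eq_constantCoeff_apply, MvPowerSeries.coeff_monomial, if_neg ha0.symm]
  let f : SS := fun n => if n = n 0 • a then c ^ (n 0) else 0
  have hf : ∀ n, MvPowerSeries.coeff n f = if n = n 0 • a then c ^ (n 0) else 0 := fun n => rfl
  have : f = JJi (MvPowerSeries.monomial a c) := by
    apply JJi_uniq h0
    classical
    ext1 m
    rw [sub_mul, one_mul, map_sub, MvPowerSeries.coeff_monomial_mul, MvPowerSeries.coeff_one, hf, hf]
    rcases Nat.eq_zero_or_pos (m 0) with h | h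
    · have : ¬ a ≤ m := fun hle => by have := hle 0; omega
      rw [if_neg this, sub_zero, h, zero_smul, pow_zero]
    · have hm : m ≠ 0 := by rintro rfl; simp at h
      rw [if_neg hm]
      obtain ⟨k, hk⟩ : ∃ k, m 0 = k + 1 := ⟨m 0 - 1, by omega⟩
      by_cases hle : a ≤ m
      · rw [if_pos hle]
        have e0 : (m - a) 0 = k := by rw [Finsupp.tsub_apply, ha]; omega
        have e1 : (m - a = k • a) ↔ (m = (k + 1) • a) := by
          rw [add_smul, one_smul]
          constructor
          · intro h; rw [← h, tsub_add_cancel_of_le hle]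
          · intro h; rw [h, add_tsub_cancel_right]
        rw [e0, hk]
        simp only [e1]
        split_ifs
        · rw [pow_succ']; simp
        · simp
      · rw [if_neg hle, if_neg, sub_zero]
        intro h'
        apply hle
        rw [h', hk, add_smul, one_smul]
        exact le_add_self
  rw [← this, hf]

def lD (d : MatVar 4 →₀ ℕ) : MatVar 4 →₀ (Fin 2 →₀ ℕ) := Finsupp.equivFunOnFinite.symm (fun v => d v • av v)
lemma lD_apply (d : MatVar 4 →₀ ℕ) (v : MatVar 4) : lD d v = d v • av v := rfl

lemma sum0 (d : MatVar 4 →₀ ℕ) : (∑ v, d v • av v) 0 = (Finsupp.weight (bideg 4) d).1 + (Finsupp.weight (bideg 4) d).2 := by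
  rw [weight_eq, Fintype.sum_sum_type]
  simp [av]
lemma sum1 (d : MatVar 4 →₀ ℕ) : (∑ v, d v • av v) 1 = (Finsupp.weight (bideg 4) d).2 := by
  rw [weight_eq, Fintype.sum_sum_type]
  simp [av]

lemma fin2_ext {a b : Fin 2 →₀ ℕ} (h0 : a 0 = b 0) (h1 : a 1 = b 1) : a = b := by
  ext i; fin_cases i
  · exact h0
  · exact h1

def PPs : SS := ∏ v : MatVar 4, JJi (mv v)

lemma coeff_PP0 (n : Fin 2 →₀ ℕ) (h : ¬ n 1 ≤ n 0) : MvPowerSeries.coeff n PPs = 0 := by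
  classical
  rw [PPs, MvPowerSeries.coeff_prod]
  refine Finset.sum_eq_zero fun l hl => ?_
  rw [Finset.mem_finsuppAntidiag] at hl
  have : ∃ v, ¬ (l v = l v 0 • av v) := by
    by_contra hc
    push Not at hc
    apply h
    have h1 : n = ∑ v, (Finsupp.equivFunOnFinite.symm (fun v => l v 0) : MatVar 4 →₀ ℕ) v • av v := by
      rw [← hl.1]; exact Finset.sum_congr rfl fun v _ => hc v
    rw [h1, sum0, sum1]
    exact Nat.le_add_left _ _
  obtain ⟨v, hv⟩ := this
  apply Finset.prod_eq_zero (Finset.mem_univ v)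
  rw [mv, coeff_J _ (av0 v), if_neg hv]

lemma coeff_PP (n : Fin 2 →₀ ℕ) (h : n 1 ≤ n 0) : MvPowerSeries.coeff n PPs =
    ∑ d : Sd (n 0 - n 1) (n 1), ∏ v, cv v ^ (d.1 v) := by
  classical
  rw [PPs, MvPowerSeries.coeff_prod]
  symm
  refine Finset.sum_of_injOn (fun d => lD d.1) ?_ ?_ ?_ ?_
  · intro d _ d' _ hdd
    apply Subtype.ext
    ext v
    have := DFunLike.congr_fun (DFunLike.congr_fun hdd v) 0
    simpa [lD_apply, av0] using this
  · intro d _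
    rw [Finset.mem_coe, Finset.mem_finsuppAntidiag]
    refine ⟨?_, Finset.subset_univ _⟩
    change ∑ v, d.1 v • av v = n
    apply fin2_ext
    · rw [sum0, d.2]; change n 0 - n 1 + n 1 = n 0; omega
    · rw [sum1, d.2]
  · intro l hl hni
    rw [Finset.mem_finsuppAntidiag] at hl
    have : ∃ v, ¬ (l v = l v 0 • av v) := by
      by_contra hc
      push Not at hc
      apply hni
      let d : MatVar 4 →₀ ℕ := Finsupp.equivFunOnFinite.symm (fun v => l v 0)
      have h1 : n = ∑ v, d v • av v := by
        rw [← hl.1]; exact Finset.sum_congr rfl fun v _ => hc v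
      refine ⟨⟨d, ?_⟩, by simp, ?_⟩
      · have e0 := sum0 d
        have e1 := sum1 d
        rw [← h1] at e0 e1
        ext
        · change _ = n 0 - n 1; omega
        · exact e1.symm
      · ext1 v
        exact (hc v).symm
    obtain ⟨v, hv⟩ := this
    apply Finset.prod_eq_zero (Finset.mem_univ v)
    rw [mv, coeff_J _ (av0 v), if_neg hv]
  · intro d _
    refine Finset.prod_congr rfl fun v _ => ?_
    have e : lD d.1 v 0 = d.1 v := by simp [lD_apply, av0]
    rw [mv, coeff_J _ (av0 v), e, if_pos (lD_apply _ _)]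

lemma vcol_vr (e : Bool) (a b : Fin 4) : vcol (vr e a b) = b := by cases e <;> rfl
lemma vrow_vr (e : Bool) (a b : Fin 4) : vrow (vr e a b) = a := by cases e <;> rfl

lemma sum_matvar {S : Type*} [AddCommMonoid S] (f : MatVar 4 → S) :
    ∑ v, f v = ∑ e : Bool, ∑ a, ∑ b, f (vr e a b) := by
  rw [Fintype.sum_sum_type, Fintype.sum_bool, Fintype.sum_prod_type, Fintype.sum_prod_type]
  rfl

lemma prod_cv (d : MatVar 4 →₀ ℕ) (k l : Fin 4) : (∏ v, cv v ^ d v) * (xx k * yy l) = mono (wtJ (d, (k, l))) := by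
  have h : ∀ v, cv v ^ d v = mono (Pi.single (vcol v) (d v : ℤ) + - Pi.single (vrow v) (d v : ℤ)) := by
    intro v
    rw [cv, mul_pow, xx_pow, yy_pow, mono_mul]
  rw [Finset.prod_congr rfl fun v _ => h v, mono_prod, xx, yy, mono_mul, mono_mul]
  refine congrArg mono ?_
  ext i
  rw [Pi.add_apply, Finset.sum_apply, sum_matvar, wtJ]
  simp only [vcol_vr, vrow_vr, Pi.add_apply, Pi.neg_apply, Pi.single_apply]
  congr 1
  · refine Finset.sum_congr rfl fun e _ => ?_
    simp only [Finset.sum_add_distrib, Finset.sum_neg_distrib]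
    rw [sub_eq_add_neg]
    congr 1
    · refine Finset.sum_congr rfl fun a _ => ?_
      simp
    · congr 1
      rw [Finset.sum_comm]
      refine Finset.sum_congr rfl fun a _ => ?_
      simp
  · simp only [eq_comm (a := i)]
    rw [sub_eq_add_neg]

lemma coeff_cS (a : LL) (f : SS) (n : Fin 2 →₀ ℕ) : MvPowerSeries.coeff n (cS a * f) = a * MvPowerSeries.coeff n f :=
  MvPowerSeries.coeff_C_mul _ _ _

lemma J_diag (c : SS) (b : Fin 4) (f : SS → SS → SS) (hf : f = jj c) :
    ∏ a, f (xS a) (yS b) = JJi c * colP f b := by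
  subst hf
  rw [colP, ← Finset.mul_prod_erase _ _ (Finset.mem_univ b), ← Finset.mul_prod_erase Finset.univ (fun a => if a = b then 1 else jj c (xS a) (yS b)) (Finset.mem_univ b)]
  have e : jj c (xS b) (yS b) = JJi c := by
    rw [jj]; refine congrArg JJi ?_; linear_combination c * xyS b
  rw [e, if_pos rfl, one_mul]
  congr 1
  refine Finset.prod_congr rfl fun a ha => ?_
  rw [if_neg (Finset.ne_of_mem_erase ha)]

lemma PP_eq : PPs = (JJi sS ^ 4 * ∏ b, colP (jj sS) b) * (JJi tS ^ 4 * ∏ b, colP (jj tS) b) := by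
  rw [PPs, prod_matvar, Fintype.prod_bool]
  simp only [mv_inl, mv_inr]
  have e1 : ∀ a : Fin 4, ∏ b, JJi (sS * xS b * yS a) = JJi sS * colP (jj sS) a := fun a => (J_diag sS a (jj sS) rfl :)
  have e2 : ∀ a : Fin 4, ∏ b, JJi (tS * xS b * yS a) = JJi tS * colP (jj tS) a := fun a => (J_diag tS a (jj tS) rfl :)
  simp only [e1, e2]
  rw [Finset.prod_mul_distrib, Finset.prod_mul_distrib]
  simp

lemma dd_pair (i j : Fin 4) : dS (xS i) (yS j) * dS (xS j) (yS i) = (xS i - xS j) * (yS i - yS j) := by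
  rw [dS, dS]
  linear_combination (xS j * yS j - 1) * xyS i

lemma dd_eq : ∏ b, colP dS b = cS (delta * deltab) := by
  rw [Fin.prod_univ_four, colP_0, colP_1, colP_2, colP_3]
  have e : cS (delta * deltab) = ((xS 0 - xS 1) * (yS 0 - yS 1)) * ((xS 0 - xS 2) * (yS 0 - yS 2)) *
    ((xS 0 - xS 3) * (yS 0 - yS 3)) * ((xS 1 - xS 2) * (yS 1 - yS 2)) * ((xS 1 - xS 3) * (yS 1 - yS 3)) *
    ((xS 2 - xS 3) * (yS 2 - yS 3)) := by
    simp only [delta, deltab, map_mul, map_sub]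
    have hx : ∀ i, cS (xx i) = xS i := fun _ => rfl
    have hy : ∀ i, cS (yy i) = yS i := fun _ => rfl
    simp only [hx, hy]
    generalize xS 0 - xS 1 = a1
    generalize xS 0 - xS 2 = a2
    generalize xS 0 - xS 3 = a3
    generalize xS 1 - xS 2 = a4
    generalize xS 1 - xS 3 = a5
    generalize xS 2 - xS 3 = a6
    generalize yS 0 - yS 1 = b1
    generalize yS 0 - yS 2 = b2
    generalize yS 0 - yS 3 = b3
    generalize yS 1 - yS 2 = b4
    generalize yS 1 - yS 3 = b5
    generalize yS 2 - yS 3 = b6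
    ring
  rw [e, ← dd_pair, ← dd_pair, ← dd_pair, ← dd_pair, ← dd_pair, ← dd_pair]
  ring

lemma E0_PP : E0 kap = cS (delta * deltab * ((∑ k, xx k) * ∑ l, yy l)) * PPs := by
  have e1 : cS (∑ k, xx k) = ∑ k, xS k := by rw [map_sum]; rfl
  have e2 : cS (∑ k, yy k) = ebar := by rw [map_sum]; rfl
  rw [map_mul, map_mul cS (∑ k, xx k), e1, e2, ← dd_eq, PP_eq, E0, kap, Finset.prod_mul_distrib, Finset.prod_mul_distrib]
  ring

lemma coeff_E0 (n : Fin 2 →₀ ℕ) (h : n 1 ≤ n 0) : MvPowerSeries.coeff n (E0 kap) =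
    delta * deltab * ∑ b : BI (n 0 - n 1) (n 1), mono (wtJ (toJ b)) := by
  rw [E0_PP, coeff_cS, coeff_PP n h, mul_assoc]
  congr 1
  rw [mul_comm, Finset.sum_mul, Fintype.sum_prod_type]
  refine Finset.sum_congr rfl fun d _ => ?_
  rw [Finset.sum_mul_sum, Fintype.sum_prod_type, Finset.mul_sum]
  refine Finset.sum_congr rfl fun k _ => ?_
  rw [Finset.mul_sum]
  exact Finset.sum_congr rfl fun l _ => prod_cv d.1 k l

lemma coeff_E00 (n : Fin 2 →₀ ℕ) (h : ¬ n 1 ≤ n 0) : MvPowerSeries.coeff n (E0 kap) = 0 := by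
  rw [E0_PP, coeff_cS, coeff_PP0 n h, mul_zero]
end c8

section c9a

def mk2 (p q : ℕ) : Fin 2 →₀ ℕ := Finsupp.single 0 p + Finsupp.single 1 q
@[simp] lemma mk2_0 (p q : ℕ) : mk2 p q 0 = p := by simp [mk2]
@[simp] lemma mk2_1 (p q : ℕ) : mk2 p q 1 = q := by simp [mk2]
lemma mk2_eq (n : Fin 2 →₀ ℕ) : mk2 (n 0) (n 1) = n := by
  ext i; fin_cases i <;> simp

def Th (f : QQ) : QQ := fun n => if n 1 ≤ n 0 then MvPowerSeries.coeff (mk2 (n 0 - n 1) (n 1)) f else 0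

lemma coeff_Th (f : QQ) (n : Fin 2 →₀ ℕ) : MvPowerSeries.coeff n (Th f) =
    if n 1 ≤ n 0 then MvPowerSeries.coeff (mk2 (n 0 - n 1) (n 1)) f else 0 := rfl

lemma Th_inj {f g : QQ} (h : Th f = Th g) : f = g := by
  ext n
  have := congrArg (MvPowerSeries.coeff (mk2 (n 0 + n 1) (n 1))) h
  simpa [coeff_Th, mk2_eq] using this

lemma Th_add (f g : QQ) : Th (f + g) = Th f + Th g := by
  ext n
  rw [map_add, coeff_Th, coeff_Th, coeff_Th]
  split_ifs <;> simp

lemma Th_sub (f g : QQ) : Th (f - g) = Th f - Th g := by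
  ext n
  rw [map_sub, coeff_Th, coeff_Th, coeff_Th]
  split_ifs <;> simp

lemma Th_one : Th 1 = 1 := by
  classical
  ext n
  rw [coeff_Th, MvPowerSeries.coeff_one, MvPowerSeries.coeff_one]
  by_cases h : n = 0
  · subst h
    have : mk2 0 0 = 0 := by simp [mk2]
    simp [this]
  · rw [if_neg h]
    split_ifs with h1 h2
    · exfalso; apply h
      have a := DFunLike.congr_fun h2 0
      have b := DFunLike.congr_fun h2 1
      simp at a b
      ext i; fin_cases i
      · change n 0 = 0; omega
      · exact b
    · rfl
    · rfl

lemma mk2_le {p q : ℕ} {n : Fin 2 →₀ ℕ} : mk2 p q ≤ n ↔ p ≤ n 0 ∧ q ≤ n 1 := by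
  constructor
  · intro h; exact ⟨by simpa using h 0, by simpa using h 1⟩
  · rintro ⟨h0, h1⟩ i; fin_cases i
    · simpa using h0
    · simpa using h1

lemma mon_eq (a b : ℕ) : (MvPowerSeries.X 0 ^ a * MvPowerSeries.X 1 ^ b : QQ) = MvPowerSeries.monomial (mk2 a b) 1 := by
  rw [MvPowerSeries.X_pow_eq, MvPowerSeries.X_pow_eq, MvPowerSeries.monomial_mul_monomial, one_mul, mk2]

lemma Th_mon (a b : ℕ) (f : QQ) : Th (MvPowerSeries.X 0 ^ a * MvPowerSeries.X 1 ^ b * f) =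
    MvPowerSeries.X 0 ^ (a + b) * MvPowerSeries.X 1 ^ b * Th f := by
  classical
  rw [mon_eq, mon_eq]
  ext n
  rw [coeff_Th, MvPowerSeries.coeff_monomial_mul, MvPowerSeries.coeff_monomial_mul, coeff_Th]
  simp only [mk2_le, mk2_0, mk2_1, Finsupp.tsub_apply, one_mul]
  by_cases h1 : n 1 ≤ n 0
  · rw [if_pos h1]
    by_cases h2 : a ≤ n 0 - n 1 ∧ b ≤ n 1
    · rw [if_pos h2, if_pos (by omega), if_pos (by omega)]
      refine congrArg (fun m => MvPowerSeries.coeff m f) ?_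
      ext i; fin_cases i
      · simp; omega
      · simp
    · rw [if_neg h2]
      split_ifs
      · omega
      · rfl
      · rfl
  · rw [if_neg h1]
    split_ifs
    · omega
    · rfl
    · rfl

def dq (a b : ℕ) : QQ := 1 - MvPowerSeries.X 0 ^ a * MvPowerSeries.X 1 ^ b
lemma Th_dq (a b : ℕ) (f : QQ) : Th (dq a b * f) = dq (a + b) b * Th f := by
  rw [dq, dq, sub_mul, sub_mul, one_mul, one_mul, Th_sub, Th_mon]

lemma Th_dq2 (a b : ℕ) (f : QQ) : Th (dq a b ^ 2 * f) = dq (a + b) b ^ 2 * Th f := by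
  rw [pow_two, mul_assoc, Th_dq, Th_dq, pow_two, mul_assoc]

def mq (a b : ℕ) : QQ := MvPowerSeries.X 0 ^ a * MvPowerSeries.X 1 ^ b
lemma Th_mq (a b : ℕ) : Th (mq a b) = mq (a + b) b := by
  have := Th_mon a b 1
  rwa [Th_one, mul_one, mul_one] at this

def DenQ (f : QQ) : QQ := dq 1 0 ^ 2 * (dq 0 1 ^ 2 * (dq 2 0 * (dq 1 1 ^ 2 * (dq 0 2 * (dq 3 0 * (dq 2 1 ^ 2 * (dq 1 2 ^ 2 * (dq 0 3 * (dq 3 1 * (dq 2 2 * (dq 1 3 * f)))))))))))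
def NumQ : QQ := 1 + mq 2 2 + mq 2 3 + mq 3 2 + mq 3 3 + mq 5 5

lemma Th_Den (f : QQ) : Th (DenQ f) = (dq 1 0 ^2*dq 1 1 ^2*dq 2 0*dq 2 1 ^2*dq 2 2*dq 3 0*dq 3 1 ^2*dq 3 2 ^2*dq 3 3*dq 4 1*dq 4 2*dq 4 3) * Th f := by
  rw [DenQ]
  simp only [Th_dq, Th_dq2, Nat.reduceAdd, mul_assoc]

lemma Th_Num : Th NumQ = 1 + mq 4 2 + mq 5 3 + mq 5 2 + mq 6 3 + mq 10 5 := by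
  rw [NumQ]
  simp only [Th_add, Th_one, Th_mq, Nat.reduceAdd]
end c9a
section c9b

lemma emb_dq (a b : ℕ) : emb (dq a b) = dm a b := by
  rw [dq, dm, map_sub, map_one, map_mul, map_pow, map_pow, emb_s, emb_u]

lemma emb_mq (a b : ℕ) : emb (mq (a + b) b) = sS ^ a * tS ^ b := by
  rw [mq, map_mul, map_pow, map_pow, emb_s, emb_u, tS, mul_pow, pow_add, mul_assoc]

lemma emb_DQ : emb (dq 1 0 ^2*dq 1 1 ^2*dq 2 0*dq 2 1 ^2*dq 2 2*dq 3 0*dq 3 1 ^2*dq 3 2 ^2*dq 3 3*dq 4 1*dq 4 2*dq 4 3) = Dd := by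
  rw [Dd]
  simp only [map_mul, map_pow, emb_dq]

lemma emb_NQ : emb (Th NumQ) = Nn := by
  rw [Th_Num, Nn]
  simp only [map_add, map_one]
  rw [emb_mq 2 2, emb_mq 2 3, emb_mq 3 2, emb_mq 3 3, emb_mq 5 5]

lemma Q_id : (dq 1 0 ^2*dq 1 1 ^2*dq 2 0*dq 2 1 ^2*dq 2 2*dq 3 0*dq 3 1 ^2*dq 3 2 ^2*dq 3 3*dq 4 1*dq 4 2*dq 4 3) * ctS (E0 kap) = 24 * Th NumQ := by
  have e := congrArg ctS final_id
  rw [← emb_DQ, ← emb_NQ, ctS_emb_mul, ctS_emb, map_add, ctS_piS, ctS_piS] at e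
  rw [ct_all IsK_kap, kp_kap, ← e]
  generalize ctS (Gs kq 2 3) + ctS (Gt kq 2 3) = w
  generalize (dq 1 0 ^2*dq 1 1 ^2*dq 2 0*dq 2 1 ^2*dq 2 2*dq 3 0*dq 3 1 ^2*dq 3 2 ^2*dq 3 3*dq 4 1*dq 4 2*dq 4 3) = z
  ring

lemma Th_mixed (K : Type*) [Field K] [CharZero K] : 24 * Th (mixedPS2 K 4) = ctS (E0 kap) := by
  ext n
  have h24 : (24 : QQ) = MvPowerSeries.C 24 := (map_ofNat MvPowerSeries.C 24).symm
  rw [h24, MvPowerSeries.coeff_C_mul, coeff_Th, coeff_ctS]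
  by_cases h : n 1 ≤ n 0
  · rw [if_pos h, coeff_E0 n h, ← mixedDim_eq K]
    change 24 * ((mixedDim K 4 (mk2 _ _ 0) (mk2 _ _ 1) : ℕ) : ℚ) = _
    rw [mk2_0, mk2_1]
  · rw [if_neg h, coeff_E00 n h, mul_zero, map_zero]

lemma main_id (K : Type*) [Field K] [CharZero K] : DenQ (mixedPS2 K 4) = NumQ := by
  apply Th_inj
  have e := Q_id
  rw [← Th_mixed K, mul_left_comm, ← Th_Den] at e
  have h24 : (24 : QQ) = MvPowerSeries.C 24 := (map_ofNat MvPowerSeries.C 24).symm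
  ext n
  have := congrArg (MvPowerSeries.coeff n) e
  rw [h24, MvPowerSeries.coeff_C_mul, MvPowerSeries.coeff_C_mul] at this
  linarith
end c9b

/-- The bigraded Poincaré series of the mixed trace algebra of two generic `4 × 4`
matrices is `(1 + s²t² + s²t³ + s³t² + s³t³ + s⁵t⁵) /
((1−s)²(1−t)²(1−s²)(1−st)²(1−t²)(1−s³)(1−s²t)²(1−st²)²(1−t³)(1−s³t)(1−s²t²)(1−st³))`. -/
theorem poincare_T42 (K : Type*) [Field K] [CharZero K] :
    mixedPS2 K 4 *
        ((1 - ps) ^ 2 * (1 - pt) ^ 2 *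
          (1 - ps ^ 2) * (1 - ps * pt) ^ 2 * (1 - pt ^ 2) *
          (1 - ps ^ 3) * (1 - ps ^ 2 * pt) ^ 2 * (1 - ps * pt ^ 2) ^ 2 * (1 - pt ^ 3) *
          (1 - ps ^ 3 * pt) * (1 - ps ^ 2 * pt ^ 2) * (1 - ps * pt ^ 3)) =
      1 + ps ^ 2 * pt ^ 2 + ps ^ 2 * pt ^ 3 + ps ^ 3 * pt ^ 2 + ps ^ 3 * pt ^ 3 +
        ps ^ 5 * pt ^ 5 := by

  have e := main_id K
  rw [DenQ, NumQ] at e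
  simp only [dq, mq, pow_zero, pow_one, one_mul, mul_one] at e
  simp only [ps, pt]
  rw [← e]
  ring
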